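/- Let A be a complete intersection noetherian local ring and M a finitely generated A-module. Then M is a test module for A if and only if M is a Test module for A. -/

import Mathlib

open CategoryTheory IsLocalRing

universe u

/-! ## Homological dimensions -/

/-- Flat dimension at most `n`: `M` is flat, or there is a surjection from a flat
module whose kernel has flat dimension at most `n - 1`. -/
def FlatDimLE (A : Type u) [CommRing A] :
    ℕ → ∀ (M : Type u) [AddCommGroup M] [Module A M], Prop
  | 0 => fun M _ _ => Module.Flat A M
  | n + 1 => fun M _ _ =>
      ∃ (F : Type u) (_ : AddCommGroup F) (_ : Module A F), Module.Flat A F ∧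
        ∃ f : F →ₗ[A] M, Function.Surjective f ∧ FlatDimLE A n (LinearMap.ker f)

/-- Projective dimension at most `n`. -/
def ProjDimLE (A : Type u) [CommRing A] :
    ℕ → ∀ (M : Type u) [AddCommGroup M] [Module A M], Prop
  | 0 => fun M _ _ => Module.Projective A M
  | n + 1 => fun M _ _ =>
      ∃ (P : Type u) (_ : AddCommGroup P) (_ : Module A P), Module.Projective A P ∧
        ∃ f : P →ₗ[A] M, Function.Surjective f ∧ ProjDimLE A n (LinearMap.ker f)

/-- Injective dimension at most `n`. -/
def InjDimLE (A : Type u) [CommRing A] :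
    ℕ → ∀ (M : Type u) [AddCommGroup M] [Module A M], Prop
  | 0 => fun M _ _ => Module.Injective A M
  | n + 1 => fun M _ _ =>
      ∃ (I : Type u) (_ : AddCommGroup I) (_ : Module A I), Module.Injective A I ∧
        ∃ f : M →ₗ[A] I, Function.Injective f ∧ InjDimLE A n (I ⧸ LinearMap.range f)

/-! ## Classes of local rings -/

/-- A Gorenstein (noetherian) local ring: a noetherian local ring having finite injective
dimension as a module over itself. -/
def IsGorensteinLocalRing (A : Type u) [CommRing A] : Prop :=
  IsNoetherianRing A ∧ IsLocalRing A ∧ ∃ n : ℕ, InjDimLE A n A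

/-- A regular local ring: a noetherian local ring whose maximal ideal is generated by
`dim A` elements. -/
def IsRegularLocal (A : Type u) [CommRing A] : Prop :=
  IsNoetherianRing A ∧ IsLocalRing A ∧
    ∃ s : Finset A, (Ideal.span (s : Set A)).IsMaximal ∧
      (s.card : WithBot ℕ∞) = ringKrullDim A

/-- A deformation: a surjective ring homomorphism whose kernel is generated by a
regular sequence. -/
def IsDeformation {Q A' : Type u} [CommRing Q] [CommRing A'] (f : Q →+* A') : Prop :=
  Function.Surjective f ∧
    ∃ rs : List Q, RingTheory.Sequence.IsRegular Q rs ∧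
      RingHom.ker f = Ideal.span {x | x ∈ rs}

/-- A noetherian local ring is complete intersection if its `m`-adic completion is a
quotient of a regular local ring by an ideal generated by a regular sequence. -/
def IsCompleteIntersectionLocalRing (A : Type u) [CommRing A] [IsLocalRing A] : Prop :=
  ∃ (Q : Type u) (_ : CommRing Q), IsRegularLocal Q ∧
    ∃ f : Q →+* AdicCompletion (maximalIdeal A) A, IsDeformation f

/-! ## Tor, test modules -/

/-- Vanishing of `Tor_i^A(M, N)`. -/
def TorVanish (A : Type u) [CommRing A] (i : ℕ)
    (M : Type u) [AddCommGroup M] [Module A M]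
    (N : Type u) [AddCommGroup N] [Module A N] : Prop :=
  Subsingleton (((Tor (ModuleCat.{u} A) i).obj (ModuleCat.of A M)).obj (ModuleCat.of A N))

/-- `M` is a test module for `A`: for every local homomorphism `A → B` of noetherian local
rings and every finitely generated `B`-module `N`, vanishing of `Tor_i^A(M,N)` for all
`i ≫ 0` implies that `N` has finite flat dimension over `A`. -/
def IsTestModule (A : Type u) [CommRing A] [IsLocalRing A] [IsNoetherianRing A]
    (M : Type u) [AddCommGroup M] [Module A M] : Prop :=
  ∀ (B : Type u) [CommRing B] [IsLocalRing B] [IsNoetherianRing B] [Algebra A B],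
    IsLocalHom (algebraMap A B) →
    ∀ (N : Type u) [AddCommGroup N] [Module A N] [Module B N] [IsScalarTower A B N],
      Module.Finite B N →
      (∃ i₀ : ℕ, ∀ i ≥ i₀, TorVanish A i M N) →
      ∃ n : ℕ, FlatDimLE A n N

/-- `M` is a Test module for `A`: for every finitely generated `A`-module `N`, vanishing of
`Tor_i^A(M,N)` for all `i ≫ 0` implies that `N` has finite flat dimension over `A`. -/
def IsCapitalTestModule (A : Type u) [CommRing A] [IsLocalRing A] [IsNoetherianRing A]
    (M : Type u) [AddCommGroup M] [Module A M] : Prop :=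
  ∀ (N : Type u) [AddCommGroup N] [Module A N], Module.Finite A N →
    (∃ i₀ : ℕ, ∀ i ≥ i₀, TorVanish A i M N) →
    ∃ n : ℕ, FlatDimLE A n N

/-! ## Weakly regular homomorphisms and upper CI dimension -/

/-- `A → A'` (given as an algebra) is a weakly regular local homomorphism: it is a local
homomorphism, flat, and the closed fiber `A' ⊗_A k = A'/m A'` is a regular local ring. -/
def IsWeaklyRegularAlgebra (A : Type u) [CommRing A] [IsLocalRing A]
    (A' : Type u) [CommRing A'] [Algebra A A'] : Prop :=
  IsLocalHom (algebraMap A A') ∧ Module.Flat A A' ∧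
    IsRegularLocal (A' ⧸ Ideal.map (algebraMap A A') (maximalIdeal A))

/-- `M` has finite upper complete intersection dimension `CI*-dim_A(M) < ∞`: there are a
weakly regular homomorphism `A → A'` of noetherian local rings and a deformation `Q → A'`
such that `pd_Q (A' ⊗_A M) < ∞`. -/
def CIStarDimFinite (A : Type u) [CommRing A] [IsLocalRing A]
    (M : Type u) [AddCommGroup M] [Module A M] : Prop :=
  ∃ (A' : Type u) (_ : CommRing A') (_ : IsLocalRing A') (_ : IsNoetherianRing A')
    (_ : Algebra A A'), IsWeaklyRegularAlgebra A A' ∧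
    ∃ (Q : Type u) (_ : CommRing Q) (_ : IsLocalRing Q) (_ : IsNoetherianRing Q)
      (f : Q →+* A'), IsDeformation f ∧
        ∃ n : ℕ,
          let _inst : Module Q (TensorProduct A A' M) :=
            Module.compHom (TensorProduct A A' M) f
          ProjDimLE Q n (TensorProduct A A' M)

/-! ## Gorenstein dimension -/

/-- Vanishing of `Ext^i_A(M, N)`. -/
def ExtVanish (A : Type u) [CommRing A] (i : ℕ)
    (M : Type u) [AddCommGroup M] [Module A M]
    (N : Type u) [AddCommGroup N] [Module A N] : Prop :=
  Subsingleton (((Ext A (ModuleCat.{u} A) i).obj (Opposite.op (ModuleCat.of A M))).obj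
    (ModuleCat.of A N))

/-- `G-dim_A M = 0`: the biduality map is an isomorphism and
`Ext^i(M, A) = 0 = Ext^i(M*, A)` for `i > 0`. -/
def GDimZero (A : Type u) [CommRing A] (M : Type u) [AddCommGroup M] [Module A M] : Prop :=
  Function.Bijective (Module.Dual.eval A M) ∧
    (∀ i > 0, ExtVanish A i M A) ∧
    (∀ i > 0, ExtVanish A i (Module.Dual A M) A)

/-- `G-dim_A M ≤ n`: `M` admits a resolution of length `n` by modules of G-dimension `0`. -/
def GDimLE (A : Type u) [CommRing A] :
    ℕ → ∀ (M : Type u) [AddCommGroup M] [Module A M], Prop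
  | 0 => fun M _ _ => GDimZero A M
  | n + 1 => fun M _ _ =>
      ∃ (T : Type u) (_ : AddCommGroup T) (_ : Module A T), GDimZero A T ∧
        ∃ f : T →ₗ[A] M, Function.Surjective f ∧ GDimLE A n (LinearMap.ker f)

/-! ## Complexity -/

/-- The length of a module: the length of the longest chain in its lattice of submodules.
For a module annihilated by the maximal ideal (such as `Tor_n^A(M, k)`) this is its
dimension as a `k`-vector space. -/
noncomputable def moduleLength (A : Type u) [CommRing A]
    (M : Type u) [AddCommGroup M] [Module A M] : WithBot ℕ∞ :=
  Order.krullDim (Submodule A M)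

/-- `cx_A(M) ≤ c`: there exists a real `α` with
`dim_k Tor_n^A(M, k) ≤ α n^(c-1)` for all `n ≫ 0`. -/
def ComplexityLE (A : Type u) [CommRing A] [IsLocalRing A]
    (M : Type u) [AddCommGroup M] [Module A M] (c : ℕ) : Prop :=
  ∃ α : ℝ, ∃ n₀ : ℕ, ∀ n ≥ n₀, ∃ d : ℕ,
    moduleLength A
      (((Tor (ModuleCat.{u} A) n).obj (ModuleCat.of A M)).obj
        (ModuleCat.of A (ResidueField A))) = (d : ℕ∞) ∧
      (d : ℝ) ≤ α * (n : ℝ) ^ ((c : ℤ) - 1)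

/-- The complexity `cx_A(M)`: the least `c` as above. -/
noncomputable def complexity (A : Type u) [CommRing A] [IsLocalRing A]
    (M : Type u) [AddCommGroup M] [Module A M] : ℕ :=
  sInf {c : ℕ | ComplexityLE A M c}

/-- The embedding dimension `dim_k m/m²` of a local ring. -/
noncomputable def embDim (A : Type u) [CommRing A] [IsLocalRing A] : ℕ :=
  Module.finrank (ResidueField A) (CotangentSpace A)

/-! ## Graded differential modules -/

open TensorProduct

/-- A differential of degree `-1` on a module `W`, together with a `ℤ`-grading of `W` given by
its projections. -/
structure GradedDiff (R : Type*) [CommRing R] (W : Type*) [AddCommGroup W] [Module R W] where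
  /-- the differential -/
  d : W →ₗ[R] W
  /-- the projections onto the homogeneous components -/
  π : ℤ → W →ₗ[R] W
  d_d : ∀ w, d (d w) = 0
  π_same : ∀ n w, π n (π n w) = π n w
  π_ne : ∀ m n w, m ≠ n → π m (π n w) = 0
  exists_sum_π : ∀ w, ∃ s : Finset ℤ, ∑ n ∈ s, π n w = w
  d_π_succ : ∀ n w, d (π (n + 1) w) = π n (d w)

namespace GradedDiff

variable {R : Type*} [CommRing R] {W : Type*} [AddCommGroup W] [Module R W]
variable (X : GradedDiff R W)

theorem d_π {m n : ℤ} (h : m = n + 1) (w : W) : X.d (X.π m w) = X.π n (X.d w) := by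
  subst h; exact X.d_π_succ n w

theorem d_π_sub (n : ℤ) (w : W) : X.d (X.π n w) = X.π (n - 1) (X.d w) :=
  X.d_π (by ring) w

theorem eq_zero_of_π {w : W} (h : ∀ n, X.π n w = 0) : w = 0 := by
  obtain ⟨s, hs⟩ := X.exists_sum_π w
  rw [← hs]; exact Finset.sum_eq_zero fun n _ => h n

theorem π_eq_zero_of_ne {m n : ℤ} {w : W} (hw : X.π n w = w) (h : m ≠ n) : X.π m w = 0 := by
  rw [← hw, X.π_ne _ _ _ h]

/-- The cycles of degree `n`. -/
def Z (n : ℤ) : Submodule R W := LinearMap.ker (LinearMap.prod (X.π n - LinearMap.id) X.d)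

/-- The boundaries of degree `n`. -/
def B (n : ℤ) : Submodule R W := LinearMap.range (X.d ∘ₗ X.π (n + 1))

theorem mem_Z {n : ℤ} {w : W} : w ∈ X.Z n ↔ X.π n w = w ∧ X.d w = 0 := by
  simp [Z, sub_eq_zero]

theorem mem_B {n : ℤ} {w : W} : w ∈ X.B n ↔ ∃ u, X.π (n + 1) u = u ∧ X.d u = w := by
  constructor
  · rintro ⟨u, rfl⟩
    exact ⟨X.π (n + 1) u, X.π_same _ _, rfl⟩
  · rintro ⟨u, hu, rfl⟩
    exact ⟨u, by simp [hu]⟩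

theorem mem_B_of_d {n : ℤ} {u w : W} (h : X.d u = w) (hw : X.π n w = w) : w ∈ X.B n :=
  ⟨u, by rw [LinearMap.comp_apply, X.d_π_succ, h, hw]⟩

theorem B_le_Z (n : ℤ) : X.B n ≤ X.Z n := by
  rintro _ ⟨u, rfl⟩
  rw [mem_Z]
  simp only [LinearMap.comp_apply]
  exact ⟨by rw [X.d_π_succ, X.π_same], X.d_d _⟩

/-- The homology in degree `n`. -/
abbrev H (n : ℤ) : Type _ := X.Z n ⧸ (X.B n).submoduleOf (X.Z n)

/-- The class of a cycle. -/
def cls {n : ℤ} (w : W) (hw : w ∈ X.Z n) : X.H n := Submodule.Quotient.mk ⟨w, hw⟩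

theorem cls_surj {n : ℤ} (x : X.H n) : ∃ w, ∃ hw : w ∈ X.Z n, X.cls w hw = x := by
  obtain ⟨⟨w, hw⟩, rfl⟩ := Submodule.Quotient.mk_surjective _ x
  exact ⟨w, hw, rfl⟩

theorem cls_eq_zero {n : ℤ} {w : W} {hw : w ∈ X.Z n} : X.cls w hw = 0 ↔ w ∈ X.B n := by
  rw [cls, Submodule.Quotient.mk_eq_zero]; rfl

theorem cls_eq_cls {n : ℤ} {w w' : W} {hw : w ∈ X.Z n} {hw' : w' ∈ X.Z n} :
    X.cls w hw = X.cls w' hw' ↔ w - w' ∈ X.B n := by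
  rw [cls, cls, Submodule.Quotient.eq]; rfl

theorem smul_cls {n : ℤ} {w : W} (r : R) (hw : w ∈ X.Z n) :
    r • X.cls w hw = X.cls (r • w) ((X.Z n).smul_mem r hw) := rfl

/-- Vanishing of the homology in degree `n`. -/
def ExactAt (n : ℤ) : Prop := X.Z n ≤ X.B n

theorem subsingleton_H_iff {n : ℤ} : Subsingleton (X.H n) ↔ X.ExactAt n := by
  rw [Submodule.Quotient.subsingleton_iff, Submodule.submoduleOf_eq_top]; rfl

/-- Morphisms of graded differential modules. -/
structure IsMor {W' : Type*} [AddCommGroup W'] [Module R W'] (X : GradedDiff R W)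
    (Y : GradedDiff R W') (f : W →ₗ[R] W') : Prop where
  comm_d : ∀ w, f (X.d w) = Y.d (f w)
  comm_π : ∀ n w, f (X.π n w) = Y.π n (f w)

variable {W' : Type*} [AddCommGroup W'] [Module R W'] {Y : GradedDiff R W'}
variable {W'' : Type*} [AddCommGroup W''] [Module R W''] {V : GradedDiff R W''}
variable {X} {f : W →ₗ[R] W'} {g : W' →ₗ[R] W''}

theorem IsMor.mem_Z (hf : IsMor X Y f) {n : ℤ} {w : W} (hw : w ∈ X.Z n) : f w ∈ Y.Z n := by
  rw [GradedDiff.mem_Z] at hw ⊢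
  exact ⟨by rw [← hf.comm_π, hw.1], by rw [← hf.comm_d, hw.2, map_zero]⟩

theorem IsMor.mem_B (hf : IsMor X Y f) {n : ℤ} {w : W} (hw : w ∈ X.B n) : f w ∈ Y.B n := by
  rw [GradedDiff.mem_B] at hw ⊢
  obtain ⟨u, hu, rfl⟩ := hw
  exact ⟨f u, by rw [← hf.comm_π, hu], by rw [← hf.comm_d]⟩

/-- The map induced in homology. -/
def IsMor.hmap (hf : IsMor X Y f) (n : ℤ) : X.H n →ₗ[R] Y.H n :=
  Submodule.mapQ _ _ (f.restrict fun _ hw => hf.mem_Z hw) fun _ hw => hf.mem_B hw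

theorem IsMor.hmap_cls (hf : IsMor X Y f) {n : ℤ} {w : W} (hw : w ∈ X.Z n) :
    hf.hmap n (X.cls w hw) = Y.cls (f w) (hf.mem_Z hw) := rfl

theorem exact_hmap_hmap (hf : IsMor X Y f) (hg : IsMor Y V g) (hi : Function.Injective f)
    (he : Function.Exact f g) (hs : Function.Surjective g) (n : ℤ) :
    Function.Exact (hf.hmap n) (hg.hmap n) := by
  intro y
  obtain ⟨y, hy, rfl⟩ := Y.cls_surj y
  rw [hg.hmap_cls, cls_eq_zero]
  constructor
  · intro h
    obtain ⟨v, hv, hvy⟩ := V.mem_B.1 h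
    obtain ⟨u, rfl⟩ := hs v
    have hgu : g (y - Y.d (Y.π (n + 1) u)) = 0 := by
      rw [map_sub, hg.comm_d, hg.comm_π, hv, hvy, sub_self]
    obtain ⟨w, hw⟩ := (he _).1 hgu
    have hB : Y.d (Y.π (n + 1) u) ∈ Y.B n := ⟨u, rfl⟩
    have hyu : y - Y.d (Y.π (n + 1) u) ∈ Y.Z n := sub_mem hy (Y.B_le_Z n hB)
    have hwZ : w ∈ X.Z n := by
      rw [← hw, GradedDiff.mem_Z] at hyu
      exact X.mem_Z.2 ⟨hi (by rw [hf.comm_π, hyu.1]), hi (by rw [hf.comm_d, hyu.2, map_zero])⟩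
    refine ⟨X.cls w hwZ, ?_⟩
    rw [hf.hmap_cls, cls_eq_cls, hw]
    simpa using hB
  · rintro ⟨x, hx⟩
    obtain ⟨w, hw, rfl⟩ := X.cls_surj x
    rw [hf.hmap_cls, cls_eq_cls] at hx
    have := hg.mem_B hx
    rw [map_sub, he.apply_apply_eq_zero, zero_sub] at this
    simpa using neg_mem this

theorem exists_connecting (hf : IsMor X Y f) (hg : IsMor Y V g) (hi : Function.Injective f)
    (he : Function.Exact f g) (hs : Function.Surjective g) (n : ℤ) :
    ∃ δ : V.H (n + 1) →ₗ[R] X.H n,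
      Function.Exact (hg.hmap (n + 1)) δ ∧ Function.Exact δ (hf.hmap n) := by
  classical
  -- elements of degree `n + 1` of `W'` whose image is a cycle
  let K : Submodule R W' := (V.Z (n + 1)).comap g ⊓ LinearMap.ker (Y.π (n + 1) - LinearMap.id)
  have hK : ∀ k : K, g k ∈ V.Z (n + 1) ∧ Y.π (n + 1) k = k := fun k =>
    ⟨k.2.1, by simpa [sub_eq_zero] using k.2.2⟩
  have hdK : ∀ k : K, Y.d k ∈ LinearMap.range f := fun k =>
    (he _).1 (by rw [hg.comm_d]; exact (V.mem_Z.1 (hK k).1).2)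
  let ef := LinearEquiv.ofInjective f hi
  let dK : K →ₗ[R] LinearMap.range f := (Y.d.domRestrict K).codRestrict _ hdK
  let τ : K →ₗ[R] W := ef.symm.toLinearMap ∘ₗ dK
  have hτ : ∀ k, f (τ k) = Y.d k := fun k => by
    have := congrArg Subtype.val (ef.apply_symm_apply (dK k))
    exact this
  have hτZ : ∀ k, τ k ∈ X.Z n := fun k => by
    rw [GradedDiff.mem_Z]
    refine ⟨hi ?_, hi ?_⟩
    · rw [hf.comm_π, hτ, ← Y.d_π_succ, (hK k).2]
    · rw [hf.comm_d, hτ, Y.d_d, map_zero]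
  let τ' : K →ₗ[R] X.H n := Submodule.mkQ _ ∘ₗ τ.codRestrict _ hτZ
  have hτ' : ∀ k, τ' k = X.cls (τ k) (hτZ k) := fun k => rfl
  let p : K →ₗ[R] V.H (n + 1) := Submodule.mkQ _ ∘ₗ (g.domRestrict K).codRestrict _ fun k => (hK k).1
  have hp : ∀ k, p k = V.cls (g k) (hK k).1 := fun k => rfl
  have hps : Function.Surjective p := by
    intro v
    obtain ⟨v, hv, rfl⟩ := V.cls_surj v
    obtain ⟨y, rfl⟩ := hs v
    have h2 : g (Y.π (n + 1) y) = g y := by rw [hg.comm_π, (V.mem_Z.1 hv).1]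
    refine ⟨⟨Y.π (n + 1) y, ?_, ?_⟩, ?_⟩
    · show g (Y.π (n + 1) y) ∈ V.Z (n + 1)
      rwa [h2]
    · simp [Y.π_same]
    · rw [hp, cls_eq_cls]; simp [h2]
  -- `p k = 0` iff `k` is, modulo `f`, a boundary
  have hpk : ∀ k : K, p k = 0 → ∃ w u, (k : W') = f w + Y.d u ∧ X.π (n + 1) w = w := by
    intro k hk
    rw [hp, cls_eq_zero, GradedDiff.mem_B] at hk
    obtain ⟨v, hv, hvk⟩ := hk
    obtain ⟨u, rfl⟩ := hs v
    obtain ⟨w, hw⟩ := (he ((k : W') - Y.d u)).1 (by rw [map_sub, hg.comm_d, hvk, sub_self])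
    refine ⟨X.π (n + 1) w, Y.π (n + 1 + 1) u, ?_, X.π_same _ _⟩
    rw [hf.comm_π, hw, map_sub, (hK k).2, Y.d_π_succ, sub_add_cancel]
  have hker : LinearMap.ker p ≤ LinearMap.ker τ' := by
    intro k hk
    obtain ⟨w, u, hwu, hw⟩ := hpk k hk
    rw [LinearMap.mem_ker, hτ', cls_eq_zero, GradedDiff.mem_B]
    exact ⟨w, hw, hi (by rw [hf.comm_d, hτ, hwu, map_add, Y.d_d, add_zero])⟩
  let δ₀ : (K ⧸ LinearMap.ker p) →ₗ[R] X.H n := (LinearMap.ker p).liftQ τ' hker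
  let ep := p.quotKerEquivOfSurjective hps
  let δ : V.H (n + 1) →ₗ[R] X.H n := δ₀ ∘ₗ ep.symm.toLinearMap
  have hδ : ∀ k, δ (p k) = τ' k := fun k => by
    have : ep.symm (p k) = Submodule.Quotient.mk k := by
      rw [LinearEquiv.symm_apply_eq]; rfl
    simp only [δ, LinearMap.comp_apply, LinearEquiv.coe_coe, this]
    rfl
  refine ⟨δ, ?_, ?_⟩
  · intro v
    obtain ⟨k, rfl⟩ := hps v
    rw [hδ, hτ', cls_eq_zero, GradedDiff.mem_B]
    constructor
    · rintro ⟨w, hw, hwk⟩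
      have hz : (k : W') - f w ∈ Y.Z (n + 1) := by
        rw [GradedDiff.mem_Z, map_sub, map_sub, (hK k).2, ← hf.comm_π, hw, ← hf.comm_d, hwk, hτ]
        simp
      refine ⟨Y.cls _ hz, ?_⟩
      rw [hg.hmap_cls, hp, cls_eq_cls]
      simp [he.apply_apply_eq_zero]
    · rintro ⟨y, hy⟩
      obtain ⟨y, hyZ, rfl⟩ := Y.cls_surj y
      have hyK : y ∈ K := ⟨hg.mem_Z hyZ, by simp [(Y.mem_Z.1 hyZ).1]⟩
      have : p (k - ⟨y, hyK⟩) = 0 := by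
        rw [map_sub, ← hy, sub_eq_zero]; rfl
      obtain ⟨w, u, hwu, hw⟩ := hpk _ this
      refine ⟨w, hw, hi ?_⟩
      have h3 : (k : W') - y = f w + Y.d u := hwu
      have h4 : (k : W') = f w + Y.d u + y := by rw [← h3]; abel
      rw [hf.comm_d, hτ, h4, map_add, map_add, Y.d_d, (Y.mem_Z.1 hyZ).2]; simp
  · intro x
    obtain ⟨w, hw, rfl⟩ := X.cls_surj x
    rw [hf.hmap_cls, cls_eq_zero, GradedDiff.mem_B]
    constructor
    · rintro ⟨u, hu, huw⟩
      have huK : u ∈ K := by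
        refine ⟨?_, by simp [hu]⟩
        show g u ∈ V.Z (n + 1)
        rw [GradedDiff.mem_Z, ← hg.comm_π, hu, ← hg.comm_d, huw, he.apply_apply_eq_zero]
        simp
      refine ⟨p ⟨u, huK⟩, ?_⟩
      rw [hδ, hτ', cls_eq_cls]
      have : τ ⟨u, huK⟩ = w := hi (by rw [hτ]; exact huw)
      rw [this, sub_self]; exact zero_mem _
    · rintro ⟨v, hv⟩
      obtain ⟨k, rfl⟩ := hps v
      rw [hδ, hτ', cls_eq_cls] at hv
      obtain ⟨u, hu, huw⟩ := X.mem_B.1 hv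
      refine ⟨(k : W') - f u, ?_, ?_⟩
      · rw [map_sub, (hK k).2, ← hf.comm_π, hu]
      · rw [map_sub, ← hτ, ← hf.comm_d, huw, map_sub]; abel

end GradedDiff

/-! ### Three-term exact sequences -/

section ThreeTerm

variable {R : Type*} [CommRing R] {M₁ M₂ M₃ : Type*} [AddCommGroup M₁] [AddCommGroup M₂]
  [AddCommGroup M₃] [Module R M₁] [Module R M₂] [Module R M₃] {f : M₁ →ₗ[R] M₂} {g : M₂ →ₗ[R] M₃}

theorem Module.length_le_add_of_exact (h : Function.Exact f g) :
    Module.length R M₂ ≤ Module.length R M₁ + Module.length R M₃ := by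
  have h1 := Module.length_eq_add_of_exact (LinearMap.ker g).subtype g.rangeRestrict
    (Submodule.subtype_injective _) g.surjective_rangeRestrict
    (by
      intro x
      simp only [Submodule.coe_subtype, Subtype.range_coe_subtype, Set.mem_ofPred_eq,
        LinearMap.mem_ker]
      exact ⟨fun hx => congrArg Subtype.val hx, fun hx => Subtype.ext hx⟩)
  rw [h1]
  refine add_le_add ?_ (Module.length_le_of_injective (LinearMap.range g).subtype
    (Submodule.subtype_injective _))
  rw [h.linearMap_ker_eq]
  exact Module.length_le_of_surjective f.rangeRestrict f.surjective_rangeRestrict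

theorem Function.Exact.subsingleton (h : Function.Exact f g) [Subsingleton M₁] [Subsingleton M₃] :
    Subsingleton M₂ := by
  refine subsingleton_of_forall_eq 0 fun x => ?_
  obtain ⟨y, rfl⟩ := (h x).1 (Subsingleton.elim _ _)
  rw [Subsingleton.elim y 0, map_zero]

end ThreeTerm

/-! ### Tensor products of graded differential modules with modules -/

namespace GradedDiff

open TensorProduct

section Tensor

variable (A : Type*) [CommRing A] {R : Type*} [CommRing R] [Algebra A R]
variable {W : Type*} [AddCommGroup W] [Module R W] [Module A W] [IsScalarTower A R W]
variable {W' : Type*} [AddCommGroup W'] [Module R W'] [Module A W'] [IsScalarTower A R W']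
variable {W'' : Type*} [AddCommGroup W''] [Module R W''] [Module A W''] [IsScalarTower A R W'']
variable (Y : Type*) [AddCommGroup Y] [Module A Y]

/-- Base change of an `R`-linear map along the second factor of a tensor product over `A`. -/
abbrev rT (f : W →ₗ[R] W') : W ⊗[A] Y →ₗ[R] W' ⊗[A] Y :=
  TensorProduct.AlgebraTensorModule.rTensor A Y f

variable {A Y}

theorem rT_rT (f : W' →ₗ[R] W'') (g : W →ₗ[R] W') (z : W ⊗[A] Y) :
    rT A Y f (rT A Y g z) = rT A Y (f ∘ₗ g) z := by
  rw [rT, rT, rT, AlgebraTensorModule.rTensor_comp]; rfl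

theorem rT_congr {f g : W →ₗ[R] W'} (h : ∀ w, f w = g w) (z : W ⊗[A] Y) :
    rT A Y f z = rT A Y g z := by
  rw [LinearMap.ext h]

theorem rT_eq_self {f : W →ₗ[R] W} (h : ∀ w, f w = w) (z : W ⊗[A] Y) :
    rT A Y f z = z := by
  rw [show f = LinearMap.id from LinearMap.ext h, rT, AlgebraTensorModule.rTensor_id]; rfl

theorem rT_eq_zero {f : W →ₗ[R] W'} (h : ∀ w, f w = 0) (z : W ⊗[A] Y) :
    rT A Y f z = 0 := by
  rw [show f = 0 from LinearMap.ext h, rT, map_zero]; rfl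

theorem rT_add (f g : W →ₗ[R] W') (z : W ⊗[A] Y) :
    rT A Y (f + g) z = rT A Y f z + rT A Y g z := by
  rw [rT, map_add]; rfl

theorem rT_sub (f g : W →ₗ[R] W') (z : W ⊗[A] Y) :
    rT A Y (f - g) z = rT A Y f z - rT A Y g z := by
  rw [rT, map_sub]; rfl

theorem rT_neg (f : W →ₗ[R] W') (z : W ⊗[A] Y) :
    rT A Y (-f) z = -rT A Y f z := by
  rw [rT, map_neg]; rfl

theorem rT_smul (a : R) (f : W →ₗ[R] W') (z : W ⊗[A] Y) :
    rT A Y (a • f) z = a • rT A Y f z := by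
  induction z with
  | zero => simp
  | add x y hx hy => rw [map_add, map_add, hx, hy, smul_add]
  | tmul w y => simp [TensorProduct.smul_tmul']

theorem sum_π_of_subset (X : GradedDiff R W) {s t : Finset ℤ} (hst : s ⊆ t) {w : W}
    (h : ∑ n ∈ s, X.π n w = w) : ∑ n ∈ t, X.π n w = w := by
  rw [← Finset.sum_subset hst, h]
  intro n _ hn
  rw [← h, map_sum]
  exact Finset.sum_eq_zero fun m hm => X.π_ne _ _ _ (by rintro rfl; exact hn hm)

variable (A Y)

/-- The tensor product of a graded differential module with a module. -/
def tensor (X : GradedDiff R W) : GradedDiff R (W ⊗[A] Y) where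
  d := rT A Y X.d
  π n := rT A Y (X.π n)
  d_d z := by rw [rT_rT]; exact rT_eq_zero X.d_d z
  π_same n z := by rw [rT_rT]; exact rT_congr (X.π_same n) z
  π_ne m n z h := by rw [rT_rT]; exact rT_eq_zero (fun w => X.π_ne m n w h) z
  exists_sum_π z := by
    classical
    induction z with
    | zero => exact ⟨∅, by simp⟩
    | tmul w y =>
      obtain ⟨s, hs⟩ := X.exists_sum_π w
      refine ⟨s, ?_⟩
      simp only [AlgebraTensorModule.rTensor_tmul]
      rw [← TensorProduct.sum_tmul, hs]
    | add x y hx hy =>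
      obtain ⟨s, hs⟩ := hx
      obtain ⟨t, ht⟩ := hy
      refine ⟨s ∪ t, ?_⟩
      have aux : ∀ (s t : Finset ℤ) (z : W ⊗[A] Y), s ⊆ t → ∑ n ∈ s, rT A Y (X.π n) z = z →
          ∑ n ∈ t, rT A Y (X.π n) z = z := by
        intro s t z hst h
        rw [← Finset.sum_subset hst, h]
        intro n _ hn
        rw [← h, map_sum]
        refine Finset.sum_eq_zero fun m hm => ?_
        rw [rT_rT]
        exact rT_eq_zero (fun w => X.π_ne _ _ _ (by rintro rfl; exact hn hm)) _
      simp only [map_add, Finset.sum_add_distrib]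
      rw [aux s _ x Finset.subset_union_left hs, aux t _ y Finset.subset_union_right ht]
  d_π_succ n z := by rw [rT_rT, rT_rT]; exact rT_congr (X.d_π_succ n) z

theorem tensor_d (X : GradedDiff R W) : (X.tensor A Y).d = rT A Y X.d := rfl

theorem tensor_π (X : GradedDiff R W) (n : ℤ) : (X.tensor A Y).π n = rT A Y (X.π n) := rfl

variable {A}

/-- A map of modules induces a morphism of tensor products. -/
theorem isMor_lTensor (X : GradedDiff R W) {Y Y' : Type*} [AddCommGroup Y] [Module A Y]
    [AddCommGroup Y'] [Module A Y'] (f : Y →ₗ[A] Y') :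
    IsMor (X.tensor A Y) (X.tensor A Y') (AlgebraTensorModule.lTensor R W f) where
  comm_d z := by
    rw [tensor_d, tensor_d]
    induction z with
    | zero => simp
    | add x y hx hy => simp only [map_add, hx, hy]
    | tmul w y => simp
  comm_π n z := by
    rw [tensor_π, tensor_π]
    induction z with
    | zero => simp
    | add x y hx hy => simp only [map_add, hx, hy]
    | tmul w y => simp

theorem ExactAt.tensor {X : GradedDiff R W} {n : ℤ} (h : X.ExactAt n) [Module.Flat A Y] :
    (X.tensor A Y).ExactAt n := by
  intro z hz
  rw [GradedDiff.mem_Z, tensor_d, tensor_π] at hz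
  let g : W →ₗ[R] W × W := LinearMap.inl R W W ∘ₗ (X.π n - LinearMap.id) + LinearMap.inr R W W ∘ₗ X.d
  have hex : Function.Exact ((X.d ∘ₗ X.π (n + 1)).restrictScalars A) (g.restrictScalars A) := by
    intro w
    have : g w = 0 ↔ w ∈ X.Z n := by
      simp [g, GradedDiff.mem_Z, sub_eq_zero]
    rw [LinearMap.restrictScalars_apply, this]
    exact ⟨fun hw => h hw, fun hw => X.B_le_Z n hw⟩
  have := Module.Flat.rTensor_exact Y hex
  have hgz : rT A Y g z = 0 := by
    rw [show g = _ from rfl, rT_add, ← rT_rT, ← rT_rT, hz.2, rT_sub, hz.1,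
      rT_eq_self (f := LinearMap.id) (fun _ => rfl)]
    simp
  obtain ⟨u, hu⟩ := (this z).1 hgz
  refine ⟨u, ?_⟩
  rw [LinearMap.comp_apply, tensor_d, tensor_π, rT_rT]
  exact hu

section SES

variable {Y₁ Y₂ Y₃ : Type*} [AddCommGroup Y₁] [AddCommGroup Y₂] [AddCommGroup Y₃]
  [Module A Y₁] [Module A Y₂] [Module A Y₃] {f : Y₁ →ₗ[A] Y₂} {g : Y₂ →ₗ[A] Y₃}

theorem lT_injective [Module.Flat A W] (hf : Function.Injective f) :
    Function.Injective (AlgebraTensorModule.lTensor R W f) :=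
  Module.Flat.lTensor_preserves_injective_linearMap (M := W) f hf

theorem lT_exact (he : Function.Exact f g) (hg : Function.Surjective g) :
    Function.Exact (AlgebraTensorModule.lTensor R W f) (AlgebraTensorModule.lTensor R W g) :=
  lTensor_exact W he hg

theorem lT_surjective (hg : Function.Surjective g) :
    Function.Surjective (AlgebraTensorModule.lTensor R W g) :=
  LinearMap.lTensor_surjective W hg

theorem tensor_exact₂ (X : GradedDiff R W) [Module.Flat A W] (hf : Function.Injective f)
    (he : Function.Exact f g) (hg : Function.Surjective g) (n : ℤ) :
    Function.Exact ((X.isMor_lTensor f).hmap n) ((X.isMor_lTensor g).hmap n) :=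
  exact_hmap_hmap _ _ (lT_injective hf) (lT_exact he hg) (lT_surjective hg) n

theorem exists_tensor_connecting (X : GradedDiff R W) [Module.Flat A W] (hf : Function.Injective f)
    (he : Function.Exact f g) (hg : Function.Surjective g) (n : ℤ) :
    ∃ δ : (X.tensor A Y₃).H (n + 1) →ₗ[R] (X.tensor A Y₁).H n,
      Function.Exact ((X.isMor_lTensor g).hmap (n + 1)) δ ∧
        Function.Exact δ ((X.isMor_lTensor f).hmap n) :=
  exists_connecting (X.isMor_lTensor f) (X.isMor_lTensor g) (lT_injective hf) (lT_exact he hg)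
    (lT_surjective hg) n

end SES

end Tensor

/-! ### Twists and cones -/

section Cone

variable {R : Type*} [CommRing R] {W : Type*} [AddCommGroup W] [Module R W]

/-- Shift of the grading by `s`, multiplying the differential by the sign `e`. -/
def twist (X : GradedDiff R W) (e : ℤˣ) (s : ℤ) : GradedDiff R W where
  d := (e : ℤ) • X.d
  π n := X.π (n + s)
  d_d w := by simp [X.d_d]
  π_same n w := X.π_same _ _
  π_ne m n w h := X.π_ne _ _ _ (by omega)
  exists_sum_π w := by
    obtain ⟨t, ht⟩ := X.exists_sum_π w
    refine ⟨t.map (Equiv.subRight s).toEmbedding, ?_⟩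
    rw [Finset.sum_map]
    simpa using ht
  d_π_succ n w := by
    simp only [LinearMap.smul_apply, map_zsmul]
    rw [X.d_π (show n + 1 + s = n + s + 1 by ring) w]

theorem twist_Z (X : GradedDiff R W) (e : ℤˣ) (s n : ℤ) : (X.twist e s).Z n = X.Z (n + s) := by
  ext w
  rcases Int.units_eq_one_or e with rfl | rfl <;> simp [GradedDiff.mem_Z, twist]

theorem twist_B (X : GradedDiff R W) (e : ℤˣ) (s n : ℤ) : (X.twist e s).B n = X.B (n + s) := by
  ext w
  simp only [GradedDiff.mem_B, twist, show n + 1 + s = n + s + 1 by ring]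
  rcases Int.units_eq_one_or e with rfl | rfl
  · simp
  constructor
  · rintro ⟨u, hu, rfl⟩; exact ⟨-u, by simp [hu], by simp⟩
  · rintro ⟨u, hu, rfl⟩; exact ⟨-u, by simp [hu], by simp⟩

theorem twist_exactAt (X : GradedDiff R W) (e : ℤˣ) {s n m : ℤ} (h : n + s = m) :
    (X.twist e s).ExactAt n ↔ X.ExactAt m := by
  rw [ExactAt, twist_Z, twist_B, h]; rfl

theorem nonempty_H_equiv {X Y : GradedDiff R W} {m n : ℤ} (hZ : X.Z m = Y.Z n)
    (hB : X.B m = Y.B n) : Nonempty (X.H m ≃ₗ[R] Y.H n) := by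
  unfold H
  rw [hZ, hB]
  exact ⟨LinearEquiv.refl _ _⟩

theorem nonempty_twist_H_equiv (X : GradedDiff R W) (e : ℤˣ) {s n m : ℤ} (h : n + s = m) :
    Nonempty ((X.twist e s).H n ≃ₗ[R] X.H m) := by
  subst h; exact nonempty_H_equiv (twist_Z _ _ _ _) (twist_B _ _ _ _)

theorem length_twist_H (X : GradedDiff R W) (e : ℤˣ) {s n m : ℤ} (h : n + s = m) :
    Module.length R ((X.twist e s).H n) = Module.length R (X.H m) :=
  (X.nonempty_twist_H_equiv e h).some.length_eq

/-- The mapping cone of a chain endomorphism `q` lowering degrees by `s + 1`. -/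
def cone (X : GradedDiff R W) (s : ℤ) (q : W →ₗ[R] W) (hd : ∀ w, q (X.d w) = X.d (q w))
    (hπ : ∀ n w, q (X.π (n + s + 1) w) = X.π n (q w)) : GradedDiff R (W × W) where
  d := LinearMap.prod (X.d ∘ₗ LinearMap.fst R W W + q ∘ₗ LinearMap.snd R W W)
    (-(X.d ∘ₗ LinearMap.snd R W W))
  π n := LinearMap.prodMap (X.π n) (X.π (n + s))
  d_d w := by ext <;> simp [X.d_d, hd]
  π_same n w := by ext <;> simp [X.π_same]
  π_ne m n w h := by
    ext
    · simp [X.π_ne _ _ _ h]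
    · simp [X.π_ne (m + s) (n + s) _ (by omega)]
  exists_sum_π w := by
    classical
    obtain ⟨t, ht⟩ := X.exists_sum_π w.1
    obtain ⟨t', ht'⟩ := (X.twist (-1) s).exists_sum_π w.2
    refine ⟨t ∪ t', ?_⟩
    ext
    · simpa [Prod.fst_sum] using X.sum_π_of_subset (w := w.1) Finset.subset_union_left ht
    · rw [Prod.snd_sum]
      exact (X.twist (-1) s).sum_π_of_subset (w := w.2) Finset.subset_union_right ht'
  d_π_succ n w := by
    ext
    · simp only [LinearMap.prod_apply, Function.prod, LinearMap.add_apply, LinearMap.comp_apply,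
        LinearMap.fst_apply, LinearMap.snd_apply, LinearMap.prodMap_apply, X.d_π_succ, map_add]
      rw [← hπ]
      congr 3
      ring_nf
    · simp only [LinearMap.prod_apply, Function.prod, LinearMap.neg_apply, LinearMap.comp_apply,
        LinearMap.snd_apply, LinearMap.prodMap_apply, map_neg]
      rw [X.d_π (n := n + s) (by ring)]

variable (X : GradedDiff R W) {s : ℤ} {q : W →ₗ[R] W} {hd : ∀ w, q (X.d w) = X.d (q w)}
    {hπ : ∀ n w, q (X.π (n + s + 1) w) = X.π n (q w)}

theorem cone_d_apply (w : W × W) : (X.cone s q hd hπ).d w = (X.d w.1 + q w.2, -X.d w.2) := rfl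

theorem cone_π_apply (n : ℤ) (w : W × W) :
    (X.cone s q hd hπ).π n w = (X.π n w.1, X.π (n + s) w.2) := rfl

end Cone

section ConeTensor

open TensorProduct

variable {A : Type*} [CommRing A] {R : Type*} [CommRing R] [Algebra A R]
variable {W : Type*} [AddCommGroup W] [Module R W] [Module A W] [IsScalarTower A R W]
variable (Y : Type*) [AddCommGroup Y] [Module A Y]
variable (X : GradedDiff R W) {s : ℤ} {q : W →ₗ[R] W} {hd : ∀ w, q (X.d w) = X.d (q w)}
    {hπ : ∀ n w, q (X.π (n + s + 1) w) = X.π n (q w)}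

theorem isMor_cone_inl : IsMor (X.tensor A Y) ((X.cone s q hd hπ).tensor A Y)
    (rT A Y (LinearMap.inl R W W)) where
  comm_d z := by
    rw [tensor_d, tensor_d, rT_rT, rT_rT]
    exact rT_congr (fun w => by simp [cone_d_apply]) z
  comm_π n z := by
    rw [tensor_π, tensor_π, rT_rT, rT_rT]
    exact rT_congr (fun w => by simp [cone_π_apply]) z

theorem isMor_cone_snd : IsMor ((X.cone s q hd hπ).tensor A Y) ((X.tensor A Y).twist (-1) s)
    (rT A Y (LinearMap.snd R W W)) where
  comm_d z := by
    show rT A Y _ (rT A Y _ z) = ((-1 : ℤ) • rT A Y X.d) (rT A Y _ z)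
    rw [rT_rT, neg_one_zsmul, LinearMap.neg_apply, rT_rT, ← rT_neg]
    exact rT_congr (fun w => by simp [cone_d_apply]) z
  comm_π n z := by
    show rT A Y _ (rT A Y _ z) = rT A Y (X.π (n + s)) (rT A Y _ z)
    rw [rT_rT, rT_rT]
    exact rT_congr (fun w => by simp [cone_π_apply]) z

theorem rT_inl_injective : Function.Injective (rT A Y (LinearMap.inl R W W)) := by
  refine Function.LeftInverse.injective (g := rT A Y (LinearMap.fst R W W)) fun z => ?_
  rw [rT_rT]; exact rT_eq_self (fun _ => rfl) z

theorem rT_snd_surjective : Function.Surjective (rT A Y (LinearMap.snd R W W)) := by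
  refine Function.RightInverse.surjective (g := rT A Y (LinearMap.inr R W W)) fun z => ?_
  rw [rT_rT]; exact rT_eq_self (fun _ => rfl) z

theorem rT_fst_snd (z : (W × W) ⊗[A] Y) :
    rT A Y (LinearMap.inl R W W) (rT A Y (LinearMap.fst R W W) z) +
      rT A Y (LinearMap.inr R W W) (rT A Y (LinearMap.snd R W W) z) = z := by
  rw [rT_rT, rT_rT, ← rT_add]
  exact rT_eq_self (fun w => by simp) z

theorem rT_inl_snd_exact :
    Function.Exact (rT A Y (LinearMap.inl R W W)) (rT A Y (LinearMap.snd R W W)) := by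
  intro z
  constructor
  · intro h
    refine ⟨rT A Y (LinearMap.fst R W W) z, ?_⟩
    conv_rhs => rw [← rT_fst_snd (R := R) Y z, h, map_zero, add_zero]
  · rintro ⟨w, rfl⟩
    rw [rT_rT]; exact rT_eq_zero (fun w => rfl) w

/-- The homology of the cone sits in an exact triangle. -/
theorem cone_tensor_exact (n : ℤ) :
    Function.Exact ((X.isMor_cone_inl (A := A) (hd := hd) (hπ := hπ) Y).hmap n)
      ((X.isMor_cone_snd (A := A) (hd := hd) (hπ := hπ) Y).hmap n) :=
  exact_hmap_hmap _ _ (rT_inl_injective Y) (rT_inl_snd_exact Y) (rT_snd_surjective Y) n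

/-- The image of `q` on cycles, read off from the cone. -/
theorem cone_tensor_d (z : (W × W) ⊗[A] Y) :
    rT A Y (LinearMap.fst R W W) (((X.cone s q hd hπ).tensor A Y).d z) =
      rT A Y X.d (rT A Y (LinearMap.fst R W W) z) +
        rT A Y q (rT A Y (LinearMap.snd R W W) z) := by
  rw [tensor_d, rT_rT, rT_rT, rT_rT, ← rT_add]
  exact rT_congr (fun w => rfl) z

end ConeTensor

end GradedDiff

set_option linter.unusedSectionVars false

/-! ### Complexes of free modules with a homogeneous basis, and total complexes -/

open TensorProduct

/-- A complex of free `A`-modules with a homogeneous basis indexed by `β`. -/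
structure BasedComplex (A : Type*) [CommRing A] (β : Type*) where
  /-- the degree of a basis element -/
  deg : β → ℕ
  /-- the differential -/
  bd : (β →₀ A) →ₗ[A] (β →₀ A)
  bd_bd : ∀ f, bd (bd f) = 0
  deg_eq : ∀ b b', bd (Finsupp.single b 1) b' ≠ 0 → deg b = deg b' + 1

namespace BasedComplex

variable {A : Type*} [CommRing A] {β : Type*} (F : BasedComplex A β)
variable {R : Type*} [CommRing R] [Algebra A R]
variable {W : Type*} [AddCommGroup W] [Module R W] [Module A W] [IsScalarTower A R W]

section Hat

variable (A R W β)

open scoped Classical in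
/-- The identification of `W ⊗ (β →₀ A)` with `β →₀ W`. -/
noncomputable def finsuppEquiv : W ⊗[A] (β →₀ A) ≃ₗ[R] (β →₀ W) :=
  TensorProduct.finsuppScalarRight A R W β

variable {A R W β}

theorem finsuppEquiv_tmul_apply (w : W) (f : β →₀ A) (b : β) :
    finsuppEquiv A β R W (w ⊗ₜ f) b = f b • w := by
  classical
  rw [finsuppEquiv]
  convert TensorProduct.finsuppScalarRight_apply_tmul_apply w f b

theorem finsuppEquiv_symm_single (b : β) (w : W) :
    (finsuppEquiv A β R W).symm (Finsupp.single b w) = w ⊗ₜ Finsupp.single b 1 := by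
  classical
  rw [finsuppEquiv]
  convert TensorProduct.finsuppScalarRight_symm_apply_single b w

variable (R W)

/-- The differential of `W ⊗ F`. -/
noncomputable def hat : (β →₀ W) →ₗ[R] (β →₀ W) :=
  (finsuppEquiv A β R W).toLinearMap ∘ₗ AlgebraTensorModule.lTensor R W F.bd ∘ₗ
    (finsuppEquiv A β R W).symm.toLinearMap

variable {R W}

theorem hat_single_apply (b b' : β) (w : W) :
    F.hat R W (Finsupp.single b w) b' = F.bd (Finsupp.single b 1) b' • w := by
  simp only [hat, LinearMap.comp_apply, LinearEquiv.coe_coe]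
  rw [finsuppEquiv_symm_single, AlgebraTensorModule.lTensor_tmul, finsuppEquiv_tmul_apply]

theorem hat_hat (v : β →₀ W) : F.hat R W (F.hat R W v) = 0 := by
  simp only [hat, LinearMap.comp_apply, LinearEquiv.coe_coe, LinearEquiv.symm_apply_apply]
  rw [LinearEquiv.map_eq_zero_iff]
  generalize (finsuppEquiv A β R W).symm v = z
  induction z with
  | zero => simp
  | add x y hx hy => rw [map_add, map_add, hx, hy, add_zero]
  | tmul w f => simp [F.bd_bd]

end Hat

variable (X : GradedDiff R W)

/-- The signed extension of the differential of `X` to `W ⊗ F`. -/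
noncomputable def diffHat : (β →₀ W) →ₗ[R] (β →₀ W) :=
  Finsupp.lsum ℕ fun b => Finsupp.lsingle b ∘ₗ ((((-1 : ℤˣ) ^ F.deg b : ℤˣ) : ℤ) • X.d)

theorem diffHat_single (b : β) (w : W) : F.diffHat X (Finsupp.single b w) =
    Finsupp.single b ((((-1 : ℤˣ) ^ F.deg b : ℤˣ) : ℤ) • X.d w) := by
  rw [diffHat, Finsupp.lsum_single]; rfl

theorem diffHat_apply (v : β →₀ W) (b : β) :
    F.diffHat X v b = (((-1 : ℤˣ) ^ F.deg b : ℤˣ) : ℤ) • X.d (v b) := by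
  classical
  induction v using Finsupp.induction_linear with
  | zero => simp
  | add f g hf hg => simp only [map_add, Finsupp.add_apply, hf, hg, smul_add]
  | single a w =>
    rw [diffHat_single, Finsupp.single_apply, Finsupp.single_apply]
    split_ifs with h
    · rw [h]
    · simp

/-- The projections to the homogeneous components of `W ⊗ F`. -/
noncomputable def projHat (n : ℤ) : (β →₀ W) →ₗ[R] (β →₀ W) :=
  Finsupp.lsum ℕ fun b => Finsupp.lsingle b ∘ₗ X.π (n - F.deg b)

theorem projHat_single (n : ℤ) (b : β) (w : W) : F.projHat X n (Finsupp.single b w) =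
    Finsupp.single b (X.π (n - F.deg b) w) := by
  rw [projHat, Finsupp.lsum_single]; rfl

theorem projHat_apply (n : ℤ) (v : β →₀ W) (b : β) :
    F.projHat X n v b = X.π (n - F.deg b) (v b) := by
  classical
  induction v using Finsupp.induction_linear with
  | zero => simp
  | add f g hf hg => simp only [map_add, Finsupp.add_apply, hf, hg]
  | single a w =>
    rw [projHat_single, Finsupp.single_apply, Finsupp.single_apply]
    split_ifs with h
    · rw [h]
    · simp

theorem diffHat_hat (v : β →₀ W) :
    F.diffHat X (F.hat R W v) + F.hat R W (F.diffHat X v) = 0 := by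
  induction v using Finsupp.induction_linear with
  | zero => simp
  | add f g hf hg =>
    rw [map_add, map_add, map_add, map_add, add_add_add_comm, hf, hg, add_zero]
  | single b w =>
    ext b'
    rw [Finsupp.add_apply, diffHat_apply, hat_single_apply, diffHat_single, hat_single_apply]
    by_cases h : F.bd (Finsupp.single b 1) b' = 0
    · simp [h]
    · rw [F.deg_eq b b' h, pow_succ, ← IsScalarTower.algebraMap_smul R (F.bd _ b') w, map_smul,
        IsScalarTower.algebraMap_smul]
      rw [smul_comm]
      simp

theorem hat_projHat (n : ℤ) (v : β →₀ W) :
    F.hat R W (F.projHat X (n + 1) v) = F.projHat X n (F.hat R W v) := by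
  induction v using Finsupp.induction_linear with
  | zero => simp
  | add f g hf hg => simp only [map_add, hf, hg]
  | single b w =>
    ext b'
    rw [projHat_apply, projHat_single, hat_single_apply, hat_single_apply]
    by_cases h : F.bd (Finsupp.single b 1) b' = 0
    · simp [h]
    · rw [F.deg_eq b b' h, ← IsScalarTower.algebraMap_smul R (F.bd _ b') w, map_smul,
        IsScalarTower.algebraMap_smul]
      congr 3
      push_cast
      ring

theorem hat_mapRange (j : ℤ) (v : β →₀ W) :
    F.hat R W (Finsupp.mapRange.linearMap (X.π j) v) =
      Finsupp.mapRange.linearMap (X.π j) (F.hat R W v) := by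
  induction v using Finsupp.induction_linear with
  | zero => simp
  | add f g hf hg => simp only [map_add, hf, hg]
  | single b w =>
    ext b'
    rw [Finsupp.mapRange.linearMap_apply, Finsupp.mapRange.linearMap_apply, Finsupp.mapRange_apply,
      Finsupp.mapRange_single, hat_single_apply, hat_single_apply,
      ← IsScalarTower.algebraMap_smul R (F.bd _ b') w, map_smul, IsScalarTower.algebraMap_smul]

theorem diffHat_mapRange (j : ℤ) (v : β →₀ W) :
    F.diffHat X (Finsupp.mapRange.linearMap (X.π (j + 1)) v) =
      Finsupp.mapRange.linearMap (X.π j) (F.diffHat X v) := by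
  ext b
  simp only [diffHat_apply, Finsupp.mapRange.linearMap_apply, Finsupp.mapRange_apply, map_zsmul,
    X.d_π_succ]

/-- The total complex of `X ⊗ F`. -/
noncomputable def tot : GradedDiff R (β →₀ W) where
  d := F.diffHat X + F.hat R W
  π n := F.projHat X n
  d_d v := by
    have h : F.diffHat X (F.diffHat X v) = 0 := by
      ext b; simp [diffHat_apply, X.d_d]
    rw [LinearMap.add_apply, LinearMap.add_apply, map_add, map_add, h, F.hat_hat, zero_add,
      add_zero, F.diffHat_hat]
  π_same n v := by ext b; simp [projHat_apply, X.π_same]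
  π_ne m n v h := by
    ext b
    rw [projHat_apply, projHat_apply, X.π_ne _ _ _ (by omega)]; rfl
  exists_sum_π v := by
    classical
    suffices h : ∃ s : Finset ℤ, ∀ t, s ⊆ t → ∑ n ∈ t, F.projHat X n v = v by
      obtain ⟨s, hs⟩ := h
      exact ⟨s, hs s subset_rfl⟩
    induction v using Finsupp.induction_linear with
    | zero => exact ⟨∅, by simp⟩
    | add f g hf hg =>
      obtain ⟨s, hs⟩ := hf
      obtain ⟨t, ht⟩ := hg
      refine ⟨s ∪ t, fun x hx => ?_⟩
      simp only [map_add, Finset.sum_add_distrib]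
      rw [hs x (Finset.union_subset_left hx), ht x (Finset.union_subset_right hx)]
    | single b w =>
      obtain ⟨s, hs⟩ := (X.twist 1 (-F.deg b)).exists_sum_π w
      refine ⟨s, fun t ht => ?_⟩
      have := (X.twist 1 (-F.deg b)).sum_π_of_subset ht hs
      conv_rhs => rw [← this]
      simp only [projHat_single, Finsupp.single_finsetSum]
      rfl
  d_π_succ n v := by
    rw [LinearMap.add_apply, LinearMap.add_apply, map_add, F.hat_projHat]
    congr 1
    ext b
    rw [diffHat_apply, projHat_apply, projHat_apply, diffHat_apply, map_zsmul,
      X.d_π (n := n - F.deg b) (by ring)]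

theorem tot_d (v : β →₀ W) : (F.tot X).d v = F.diffHat X v + F.hat R W v := rfl

theorem tot_π (n : ℤ) : (F.tot X).π n = F.projHat X n := rfl

/-! #### Comparison with the augmentation -/

section Augmentation

variable {M : Type*} [AddCommGroup M] [Module A M] (ε : (β →₀ A) →ₗ[A] M)

variable (R W) in
/-- The augmentation `W ⊗ F → W ⊗ M`. -/
noncomputable def augHat : (β →₀ W) →ₗ[R] W ⊗[A] M :=
  AlgebraTensorModule.lTensor R W ε ∘ₗ (finsuppEquiv A β R W).symm.toLinearMap

theorem augHat_single (b : β) (w : W) :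
    augHat R W ε (Finsupp.single b w) = w ⊗ₜ ε (Finsupp.single b 1) := by
  simp only [augHat, LinearMap.comp_apply, LinearEquiv.coe_coe]
  rw [finsuppEquiv_symm_single, AlgebraTensorModule.lTensor_tmul]

theorem augHat_surjective (hε : Function.Surjective ε) : Function.Surjective (augHat R W ε) :=
  (LinearMap.lTensor_surjective W hε).comp (finsuppEquiv A β R W).symm.surjective

theorem exists_hat_eq (hdeg : ∀ b, F.deg b ≠ 0 → ε (Finsupp.single b 1) = 0) (u : β →₀ W) :
    ∃ u', F.hat R W u' = F.hat R W u ∧ augHat R W ε u' = 0 := by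
  induction u using Finsupp.induction_linear with
  | zero => exact ⟨0, rfl, map_zero _⟩
  | add f g hf hg =>
    obtain ⟨f', hf, hf'⟩ := hf
    obtain ⟨g', hg, hg'⟩ := hg
    exact ⟨f' + g', by rw [map_add, map_add, hf, hg], by rw [map_add, hf', hg', add_zero]⟩
  | single b w =>
    by_cases hb : F.deg b = 0
    · refine ⟨0, ?_, map_zero _⟩
      rw [map_zero]
      ext b'
      rw [hat_single_apply]
      have : F.bd (Finsupp.single b 1) b' = 0 := by
        by_contra h
        have := F.deg_eq b b' h
        omega
      simp [this]
    · exact ⟨Finsupp.single b w, rfl, by rw [augHat_single, hdeg b hb, tmul_zero]⟩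

theorem mem_range_hat [Module.Flat A W] (hex : Function.Exact F.bd (F.bd.prod ε)) {v : β →₀ W}
    (hdeg : ∀ b, F.deg b ≠ 0 → ε (Finsupp.single b 1) = 0)
    (h1 : F.hat R W v = 0) (h2 : augHat R W ε v = 0) :
    ∃ u, F.hat R W u = v ∧ augHat R W ε u = 0 := by
  have hx := Module.Flat.lTensor_exact W hex
  have h3 : AlgebraTensorModule.lTensor R W F.bd ((finsuppEquiv A β R W).symm v) = 0 := by
    simpa [hat] using h1
  have h4 : AlgebraTensorModule.lTensor R W ε ((finsuppEquiv A β R W).symm v) = 0 := h2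
  have h5 : (F.bd.prod ε).lTensor W ((finsuppEquiv A β R W).symm v) = 0 := by
    have : F.bd.prod ε = LinearMap.inl A _ _ ∘ₗ F.bd + LinearMap.inr A _ _ ∘ₗ ε := by
      ext <;> simp
    rw [this, LinearMap.lTensor_add, LinearMap.lTensor_comp, LinearMap.lTensor_comp]
    simp only [LinearMap.add_apply, LinearMap.comp_apply]
    erw [h3, h4]
    simp
  obtain ⟨z, hz⟩ := (hx _).1 h5
  obtain ⟨u, hu, hu'⟩ := F.exists_hat_eq (R := R) (W := W) ε hdeg (finsuppEquiv A β R W z)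
  refine ⟨u, ?_, hu'⟩
  rw [hu]
  simp only [hat, LinearMap.comp_apply, LinearEquiv.coe_coe, LinearEquiv.symm_apply_apply]
  rw [← LinearEquiv.eq_symm_apply]
  exact hz

theorem isMor_augHat (hdeg : ∀ b, F.deg b ≠ 0 → ε (Finsupp.single b 1) = 0)
    (h0 : ∀ f, ε (F.bd f) = 0) : GradedDiff.IsMor (F.tot X) (X.tensor A M) (augHat R W ε) where
  comm_d v := by
    induction v using Finsupp.induction_linear with
    | zero => simp
    | add f g hf hg => simp only [map_add, hf, hg]
    | single b w =>
      have h1 : augHat R W ε (F.hat R W (Finsupp.single b w)) = 0 := by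
        simp only [hat, augHat, LinearMap.comp_apply, LinearEquiv.coe_coe,
          LinearEquiv.symm_apply_apply]
        rw [finsuppEquiv_symm_single, AlgebraTensorModule.lTensor_tmul,
          AlgebraTensorModule.lTensor_tmul, h0, tmul_zero]
      rw [tot_d, map_add, h1, add_zero, diffHat_single, augHat_single, augHat_single,
        GradedDiff.tensor_d, AlgebraTensorModule.rTensor_tmul]
      by_cases hb : F.deg b = 0
      · simp [hb]
      · simp [hdeg b hb]
  comm_π n v := by
    induction v using Finsupp.induction_linear with
    | zero => simp
    | add f g hf hg => simp only [map_add, hf, hg]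
    | single b w =>
      rw [tot_π, projHat_single, augHat_single, augHat_single, GradedDiff.tensor_π,
        AlgebraTensorModule.rTensor_tmul]
      by_cases hb : F.deg b = 0
      · simp [hb]
      · simp [hdeg b hb]

theorem augHat_mapRange (j : ℤ) (v : β →₀ W) :
    augHat R W ε (Finsupp.mapRange.linearMap (X.π j) v) =
      GradedDiff.rT A M (X.π j) (augHat R W ε v) := by
  induction v using Finsupp.induction_linear with
  | zero => simp
  | add f g hf hg => simp only [map_add, hf, hg]
  | single b w => simp [augHat_single]

/-- Cycles of the total complex in the kernel of the augmentation are boundaries. -/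
theorem exists_tot_d_eq [Module.Flat A W] (hex : Function.Exact F.bd (F.bd.prod ε)) {l : ℤ}
    (hl : ∀ n < l, ∀ w, X.π n w = 0) (h0 : ∀ f, ε (F.bd f) = 0)
    (hdeg : ∀ b, F.deg b ≠ 0 → ε (Finsupp.single b 1) = 0) (k : ℕ) :
    ∀ v : β →₀ W, (F.tot X).d v = 0 → augHat R W ε v = 0 →
      (∀ j ≥ l + k, Finsupp.mapRange.linearMap (X.π j) v = 0) → ∃ u, (F.tot X).d u = v := by
  induction k with
  | zero =>
    intro v _ _ hv
    refine ⟨0, ?_⟩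
    rw [map_zero, eq_comm]
    ext b
    refine X.eq_zero_of_π fun n => ?_
    by_cases hn : n < l
    · exact hl n hn _
    · have := DFunLike.congr_fun (hv n (by simpa using hn)) b
      simpa using this
  | succ k ih =>
    intro v hv hε hvj
    have h1 : F.hat R W (Finsupp.mapRange.linearMap (X.π (l + k)) v) = 0 := by
      have := congrArg (Finsupp.mapRange.linearMap (α := β) (X.π (l + k))) hv
      rw [tot_d, map_add, ← F.diffHat_mapRange, ← F.hat_mapRange,
        hvj (l + k + 1) (by push_cast; linarith), map_zero, map_zero, zero_add] at this
      exact this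
    have h2 : augHat R W ε (Finsupp.mapRange.linearMap (X.π (l + k)) v) = 0 := by
      rw [augHat_mapRange, hε, map_zero]
    obtain ⟨u, hu, hεu⟩ := F.mem_range_hat ε hex hdeg h1 h2
    have hu' : F.hat R W (Finsupp.mapRange.linearMap (X.π (l + k)) u) =
        Finsupp.mapRange.linearMap (X.π (l + k)) v := by
      rw [F.hat_mapRange, hu]
      ext b; simp [X.π_same]
    set u' := Finsupp.mapRange.linearMap (α := β) (X.π (l + k)) u with hu'def
    have hM := F.isMor_augHat X ε hdeg h0
    have hπu : ∀ j, j ≠ l + k → Finsupp.mapRange.linearMap (X.π j) u' = 0 := by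
      intro j hj
      ext b
      simp [hu'def, X.π_ne _ _ _ hj]
    obtain ⟨u₁, hu₁⟩ := ih (v - (F.tot X).d u') (by rw [map_sub, hv, (F.tot X).d_d, sub_zero])
      (by
        rw [map_sub, hε, tot_d, map_add]
        rw [← map_add, ← tot_d, hM.comm_d, hu'def, augHat_mapRange, hεu]
        simp)
      (by
        intro j hj
        rw [map_sub, tot_d, map_add, ← F.diffHat_mapRange, ← F.hat_mapRange, hπu (j + 1) (by omega),
          map_zero, zero_add]
        rcases eq_or_ne j (l + k) with rfl | hne
        · have : Finsupp.mapRange.linearMap (X.π (l + k)) u' = u' := by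
            ext b; simp [hu'def, X.π_same]
          rw [this, hu', sub_self]
        · rw [hπu j hne, map_zero, sub_zero]
          exact hvj j (by push_cast; omega))
    exact ⟨u₁ + u', by rw [map_add, hu₁, sub_add_cancel]⟩

/-- If `F` resolves `M`, then the homology of `X ⊗ M` controls that of the total complex. -/
theorem tot_exactAt [Module.Flat A W] (hex : Function.Exact F.bd (F.bd.prod ε)) {l : ℤ}
    (hl : ∀ n < l, ∀ w, X.π n w = 0) (h0 : ∀ f, ε (F.bd f) = 0)
    (hdeg : ∀ b, F.deg b ≠ 0 → ε (Finsupp.single b 1) = 0) (hε : Function.Surjective ε) {n : ℤ}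
    (hn : (X.tensor A M).ExactAt n) : (F.tot X).ExactAt n := by
  intro v hv
  have hM := F.isMor_augHat X ε hdeg h0
  obtain ⟨y, hy, hyv⟩ := (X.tensor A M).mem_B.1 (hn (hM.mem_Z hv))
  obtain ⟨u, rfl⟩ := augHat_surjective (R := R) (W := W) ε hε y
  have hvz := (F.tot X).mem_Z.1 hv
  have hk : ∃ k : ℕ, ∀ j ≥ l + k,
      Finsupp.mapRange.linearMap (X.π j) (v - (F.tot X).d u) = 0 := by
    generalize v - (F.tot X).d u = x
    induction x using Finsupp.induction_linear with
    | zero => exact ⟨0, by simp⟩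
    | add f g hf hg =>
      obtain ⟨k, hk⟩ := hf
      obtain ⟨k', hk'⟩ := hg
      refine ⟨max k k', fun j hj => ?_⟩
      push_cast at hj
      rw [map_add, hk j (by omega), hk' j (by omega), add_zero]
    | single b w =>
      obtain ⟨s, hs⟩ := X.exists_sum_π w
      obtain ⟨K, hK⟩ := s.bddAbove
      refine ⟨(K + 1 - l).toNat, fun j hj => ?_⟩
      rw [Finsupp.mapRange.linearMap_apply, Finsupp.mapRange_single]
      have : X.π j w = 0 := by
        rw [← hs, map_sum]
        refine Finset.sum_eq_zero fun i hi => X.π_ne _ _ _ ?_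
        have := hK hi
        omega
      rw [this, Finsupp.single_zero]
  obtain ⟨k, hk⟩ := hk
  obtain ⟨x, hx⟩ := F.exists_tot_d_eq X ε hex hl h0 hdeg k (v - (F.tot X).d u)
    (by rw [map_sub, hvz.2, (F.tot X).d_d, sub_zero])
    (by rw [map_sub, hM.comm_d, hyv, sub_self]) hk
  exact (F.tot X).mem_B_of_d (u := x + u) (by rw [map_add, hx, sub_add_cancel]) hvz.1

end Augmentation

/-! #### Minimal complexes -/

section Minimal

open GradedDiff

variable (Y : Type*) [AddCommGroup Y] [Module A Y]

theorem rT_hat_eq_zero (hmin : ∀ b b' (y : Y), F.bd (Finsupp.single b 1) b' • y = 0)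
    (z : (β →₀ W) ⊗[A] Y) : rT A Y (F.hat R W) z = 0 := by
  induction z with
  | zero => simp
  | add x y hx hy => rw [map_add, hx, hy, add_zero]
  | tmul v y =>
    rw [AlgebraTensorModule.rTensor_tmul]
    induction v using Finsupp.induction_linear with
    | zero => simp
    | add f g hf hg => rw [map_add, add_tmul, hf, hg, add_zero]
    | single b w =>
      have : F.hat R W (Finsupp.single b w) =
          (F.bd (Finsupp.single b 1)).sum fun b' a => Finsupp.single b' (a • w) := by
        classical
        ext b'
        rw [hat_single_apply, Finsupp.sum_apply]
        simp only [Finsupp.single_apply, Finsupp.sum]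
        rw [Finset.sum_ite_eq' (F.bd _).support b' fun i => F.bd (Finsupp.single b 1) i • w]
        split_ifs with h
        · rfl
        · rw [Finsupp.notMem_support_iff.1 h, zero_smul]
      rw [this, Finsupp.sum, sum_tmul]
      refine Finset.sum_eq_zero fun b' _ => ?_
      rw [← Finsupp.smul_single, smul_tmul, hmin, tmul_zero]

theorem isMor_lapply (hmin : ∀ b b' (y : Y), F.bd (Finsupp.single b 1) b' • y = 0) (b : β) :
    IsMor ((F.tot X).tensor A Y) ((X.tensor A Y).twist ((-1) ^ F.deg b) (-F.deg b))
      (rT A Y (Finsupp.lapply b)) where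
  comm_d z := by
    rw [tensor_d, show (F.tot X).d = F.diffHat X + F.hat R W from rfl, rT_add,
      F.rT_hat_eq_zero Y hmin, add_zero, rT_rT]
    show _ = ((((-1 : ℤˣ) ^ F.deg b : ℤˣ) : ℤ) • rT A Y X.d) (rT A Y (Finsupp.lapply b) z)
    rw [LinearMap.smul_apply, rT_rT, ← Int.cast_smul_eq_zsmul R, ← rT_smul]
    refine rT_congr (fun v => ?_) z
    simp only [LinearMap.comp_apply, LinearMap.smul_apply, Finsupp.lapply_apply, diffHat_apply,
      Int.cast_smul_eq_zsmul]
  comm_π n z := by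
    rw [tensor_π, tot_π]
    show _ = rT A Y (X.π (n + -F.deg b)) _
    rw [rT_rT, rT_rT]
    exact rT_congr (fun v => by simp [projHat_apply, sub_eq_add_neg]) z

theorem isMor_lsingle (hmin : ∀ b b' (y : Y), F.bd (Finsupp.single b 1) b' • y = 0) (b : β) :
    IsMor ((X.tensor A Y).twist ((-1) ^ F.deg b) (-F.deg b)) ((F.tot X).tensor A Y)
      (rT A Y (Finsupp.lsingle b)) where
  comm_d z := by
    rw [tensor_d, show (F.tot X).d = F.diffHat X + F.hat R W from rfl, rT_add,
      F.rT_hat_eq_zero Y hmin, add_zero, rT_rT]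
    show rT A Y (Finsupp.lsingle b)
      (((((-1 : ℤˣ) ^ F.deg b : ℤˣ) : ℤ) • rT A Y X.d) z) = _
    rw [LinearMap.smul_apply, map_zsmul, rT_rT, ← Int.cast_smul_eq_zsmul R, ← rT_smul]
    refine rT_congr (fun w => ?_) z
    simp only [LinearMap.comp_apply, LinearMap.smul_apply, Finsupp.lsingle_apply, diffHat_single,
      Int.cast_smul_eq_zsmul, Finsupp.smul_single]
  comm_π n z := by
    rw [tensor_π, tot_π]
    show rT A Y (Finsupp.lsingle b) (rT A Y (X.π (n + -F.deg b)) z) = _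
    rw [rT_rT, rT_rT]
    exact rT_congr (fun w => by simp [projHat_single, sub_eq_add_neg]) z

theorem rT_lapply_lsingle [DecidableEq β] (b b' : β) (z : W ⊗[A] Y) :
    rT A Y (Finsupp.lapply (R := R) b) (rT A Y (Finsupp.lsingle (R := R) b') z) =
      if b = b' then z else 0 := by
  rw [rT_rT]
  split_ifs with h
  · subst h; exact rT_eq_self (fun w => by simp) z
  · exact rT_eq_zero (fun w => by simp [Ne.symm h]) z

theorem sum_length_le_length_tot
    (hmin : ∀ b b' (y : Y), F.bd (Finsupp.single b 1) b' • y = 0) (n : ℤ) (s : Finset β) :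
    ∑ b ∈ s, Module.length R ((X.tensor A Y).H (n - F.deg b)) ≤
      Module.length R (((F.tot X).tensor A Y).H n) := by
  classical
  have h1 : ∑ b ∈ s, Module.length R ((X.tensor A Y).H (n - F.deg b)) =
      Module.length R (∀ b : s, ((X.tensor A Y).twist ((-1) ^ F.deg b.1) (-F.deg b.1)).H n) := by
    rw [Module.length_pi_of_fintype, ← Finset.sum_coe_sort]
    exact Finset.sum_congr rfl fun b _ => ((X.tensor A Y).length_twist_H _ (by ring)).symm
  rw [h1]
  let i : (∀ b : s, ((X.tensor A Y).twist ((-1) ^ F.deg b.1) (-F.deg b.1)).H n) →ₗ[R]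
      ((F.tot X).tensor A Y).H n :=
    ∑ b : s, (F.isMor_lsingle X Y hmin b.1).hmap n ∘ₗ LinearMap.proj b
  let p : ((F.tot X).tensor A Y).H n →ₗ[R]
      (∀ b : s, ((X.tensor A Y).twist ((-1) ^ F.deg b.1) (-F.deg b.1)).H n) :=
    LinearMap.pi fun b => (F.isMor_lapply X Y hmin b.1).hmap n
  refine Module.length_le_of_injective i (Function.LeftInverse.injective (g := p) fun x => ?_)
  ext b
  simp only [i, p, LinearMap.pi_apply, LinearMap.sum_apply, LinearMap.comp_apply,
    LinearMap.proj_apply, map_sum]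
  rw [Finset.sum_eq_single b]
  · obtain ⟨z, hz, hzx⟩ := cls_surj _ (x b)
    rw [← hzx, IsMor.hmap_cls, IsMor.hmap_cls, cls_eq_cls, rT_lapply_lsingle, if_pos rfl, sub_self]
    exact zero_mem _
  · intro b' _ hb
    obtain ⟨z, hz, hzx⟩ := cls_surj _ (x b')
    rw [← hzx, IsMor.hmap_cls, IsMor.hmap_cls, cls_eq_zero, rT_lapply_lsingle, if_neg]
    · exact zero_mem _
    · exact fun h => hb (Subtype.ext h.symm)
  · simp

theorem exists_sum_lsingle_lapply (z : (β →₀ W) ⊗[A] Y) : ∃ s : Finset β, ∀ t, s ⊆ t →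
    ∑ b ∈ t, rT A Y (Finsupp.lsingle (R := R) b) (rT A Y (Finsupp.lapply (R := R) b) z) = z := by
  classical
  induction z with
  | zero => exact ⟨∅, by simp⟩
  | add x y hx hy =>
    obtain ⟨s, hs⟩ := hx
    obtain ⟨s', hs'⟩ := hy
    refine ⟨s ∪ s', fun t ht => ?_⟩
    simp only [map_add, Finset.sum_add_distrib]
    rw [hs t (Finset.union_subset_left ht), hs' t (Finset.union_subset_right ht)]
  | tmul v y =>
    refine ⟨v.support, fun t ht => ?_⟩
    simp only [AlgebraTensorModule.rTensor_tmul, Finsupp.lapply_apply, Finsupp.lsingle_apply]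
    rw [← sum_tmul]
    congr 1
    ext b
    rw [Finsupp.finsetSum_apply]
    simp only [Finsupp.single_apply, Finset.sum_ite_eq']
    split_ifs with h
    · rfl
    · exact (Finsupp.notMem_support_iff.1 fun hb => h (ht hb)).symm

theorem length_tot_ne_top
    (hmin : ∀ b b' (y : Y), F.bd (Finsupp.single b 1) b' • y = 0)
    (hfin : ∀ k, {b | F.deg b = k}.Finite) {l : ℤ} (hl : ∀ n < l, ∀ w, X.π n w = 0)
    (hX : ∀ n, Module.length R ((X.tensor A Y).H n) ≠ ⊤) (n : ℤ) :
    Module.length R (((F.tot X).tensor A Y).H n) ≠ ⊤ := by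
  classical
  have hs : {b | (F.deg b : ℤ) ≤ n - l}.Finite := by
    refine ((Finset.range ((n - l).toNat + 1)).finite_toSet.biUnion fun k _ => hfin k).subset ?_
    intro b hb
    simp only [Set.mem_ofPred_eq, Set.mem_iUnion, Finset.coe_range, Set.mem_Iio] at hb ⊢
    exact ⟨F.deg b, by omega, rfl⟩
  have hπ : ∀ b, b ∉ hs.toFinset → ∀ z : (β →₀ W) ⊗[A] Y, ((F.tot X).tensor A Y).π n z = z →
      rT A Y (Finsupp.lapply (R := R) b) z = 0 := by
    intro b hb z hz
    rw [Set.Finite.mem_toFinset, Set.mem_ofPred_eq] at hb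
    rw [← hz, tensor_π, tot_π, rT_rT]
    exact rT_eq_zero (fun v => by
      rw [LinearMap.comp_apply, Finsupp.lapply_apply, projHat_apply, hl _ (by omega)]) z
  let p : ((F.tot X).tensor A Y).H n →ₗ[R]
      (∀ b : hs.toFinset, ((X.tensor A Y).twist ((-1) ^ F.deg b.1) (-F.deg b.1)).H n) :=
    LinearMap.pi fun b => (F.isMor_lapply X Y hmin b.1).hmap n
  have hp : Function.Injective p := by
    rw [injective_iff_map_eq_zero]
    intro x hx
    obtain ⟨z, hz, rfl⟩ := cls_surj _ x
    have hzπ := (((F.tot X).tensor A Y).mem_Z.1 hz).1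
    obtain ⟨t, ht⟩ := exists_sum_lsingle_lapply (R := R) Y z
    rw [cls_eq_zero, ← ht (t ∪ hs.toFinset) Finset.subset_union_left]
    refine sum_mem fun b _ => ?_
    by_cases hb : b ∈ hs.toFinset
    · have h3 := congrFun hx ⟨b, hb⟩
      simp only [p, LinearMap.pi_apply, IsMor.hmap_cls, Pi.zero_apply, cls_eq_zero] at h3
      exact (F.isMor_lsingle X Y hmin b).mem_B h3
    · rw [hπ b hb z hzπ, map_zero]; exact zero_mem _
  refine ne_top_of_le_ne_top ?_ (Module.length_le_of_injective p hp)
  rw [Module.length_pi_of_fintype]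
  refine WithTop.sum_ne_top.2 fun b _ => ?_
  rw [(X.tensor A Y).length_twist_H _ rfl]
  exact hX _

end Minimal

end BasedComplex

/-- A free resolution of `M`, with chosen bases. -/
structure FreeRes (R : Type u) [CommRing R] (M : Type u) [AddCommGroup M] [Module R M] where
  /-- the bases -/
  ι : ℕ → Type u
  /-- the augmentation -/
  ε : (ι 0 →₀ R) →ₗ[R] M
  /-- the differentials -/
  g : ∀ n, (ι (n + 1) →₀ R) →ₗ[R] (ι n →₀ R)
  surjective : Function.Surjective ε
  exact_zero : Function.Exact (g 0) ε
  exact_succ : ∀ n, Function.Exact (g (n + 1)) (g n)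

namespace FreeRes

section

variable {R : Type u} [CommRing R] {M : Type u} [AddCommGroup M] [Module R M]

theorem exists_of_step (Q : ∀ ι : Type u, Submodule R (ι →₀ R) → Prop)
    (hQ : ∀ ι K, Q ι K → ∃ (κ : Type u) (g : (κ →₀ R) →ₗ[R] (ι →₀ R)),
      LinearMap.range g = K ∧ Q κ (LinearMap.ker g))
    {ι : Type u} (ε : (ι →₀ R) →ₗ[R] M) (hε : Function.Surjective ε)
    (h0 : Q ι (LinearMap.ker ε)) :
    ∃ F : FreeRes R M, (∀ n, Q (F.ι (n + 1)) (LinearMap.ker (F.g n))) ∧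
      Q (F.ι 0) (LinearMap.ker F.ε) := by
  choose! κ g hg hQ' using hQ
  let St := {p : Σ ι : Type u, Submodule R (ι →₀ R) // Q p.1 p.2}
  let next : St → St := fun p => ⟨⟨κ p.1.1 p.1.2, LinearMap.ker (g p.1.1 p.1.2)⟩, hQ' _ _ p.2⟩
  let st : ℕ → St := fun n => Nat.rec ⟨⟨ι, LinearMap.ker ε⟩, h0⟩ (fun _ p => next p) n
  have hr : ∀ n, LinearMap.range (g (st n).1.1 (st n).1.2) = (st n).1.2 :=
    fun n => hg _ _ (st n).2
  refine ⟨⟨fun n => (st n).1.1, ε, fun n => g (st n).1.1 (st n).1.2, hε, ?_, fun n => ?_⟩,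
    fun n => (st (n + 1)).2, h0⟩
  · exact LinearMap.exact_iff.2 (hr 0).symm
  · exact LinearMap.exact_iff.2 (hr (n + 1)).symm

variable (R M) in
theorem exists_freeRes : Nonempty (FreeRes R M) := by
  obtain ⟨F, -⟩ := exists_of_step (M := M) (fun (ι : Type u) (_ : Submodule R (ι →₀ R)) => True)
    (fun ι K _ => ⟨K, Finsupp.linearCombination R (Subtype.val : K → ι →₀ R), by
      rw [Finsupp.range_linearCombination, Subtype.range_coe_subtype]
      exact Submodule.span_eq K, trivial⟩)
    (Finsupp.linearCombination R (id : M → M)) (Finsupp.linearCombination_id_surjective R M) trivial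
  exact ⟨F⟩

/-- The free resolution of the first syzygy. -/
noncomputable def shift (F : FreeRes R M) : FreeRes R (LinearMap.ker F.ε) where
  ι n := F.ι (n + 1)
  ε := (F.g 0).codRestrict _ fun x => F.exact_zero.apply_apply_eq_zero x
  g n := F.g (n + 1)
  surjective := fun ⟨x, hx⟩ => by
    obtain ⟨y, hy⟩ := (F.exact_zero x).1 hx
    exact ⟨y, Subtype.ext hy⟩
  exact_zero x := by
    rw [← F.exact_succ 0 x]
    exact ⟨fun h => congrArg Subtype.val h, fun h => Subtype.ext h⟩
  exact_succ n := F.exact_succ (n + 1)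

variable (F : FreeRes R M)

/-- The inclusion of a component. -/
noncomputable def emb (n : ℕ) : (F.ι n →₀ R) →ₗ[R] ((Σ n, F.ι n) →₀ R) :=
  Finsupp.lmapDomain R R (Sigma.mk n)

/-- The projection to a component. -/
noncomputable def comp (n : ℕ) : ((Σ n, F.ι n) →₀ R) →ₗ[R] (F.ι n →₀ R) :=
  Finsupp.lcomapDomain (Sigma.mk n) sigma_mk_injective

theorem comp_apply (n : ℕ) (x : (Σ n, F.ι n) →₀ R) (i : F.ι n) : F.comp n x i = x ⟨n, i⟩ := rfl

theorem emb_single (n : ℕ) (i : F.ι n) (r : R) :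
    F.emb n (Finsupp.single i r) = Finsupp.single ⟨n, i⟩ r := by
  simp [emb]

theorem comp_emb (n : ℕ) (x : F.ι n →₀ R) : F.comp n (F.emb n x) = x := by
  ext i
  exact Finsupp.mapDomain_apply sigma_mk_injective _ _

theorem emb_apply_of_ne {m : ℕ} (x : F.ι m →₀ R) {b : Σ n, F.ι n} (h : m ≠ b.1) :
    F.emb m x b = 0 :=
  Finsupp.mapDomain_of_notMem_range _ _ (by rintro ⟨i, rfl⟩; exact h rfl)

theorem comp_emb_of_ne {m n : ℕ} (h : m ≠ n) (x : F.ι m →₀ R) : F.comp n (F.emb m x) = 0 := by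
  ext i
  exact F.emb_apply_of_ne x h

theorem ext_comp {x y : (Σ n, F.ι n) →₀ R} (h : ∀ n, F.comp n x = F.comp n y) : x = y := by
  ext ⟨n, i⟩
  exact DFunLike.congr_fun (h n) i

/-- The differential on basis elements. -/
noncomputable def bdFun : (Σ n, F.ι n) → ((Σ n, F.ι n) →₀ R)
  | ⟨0, _⟩ => 0
  | ⟨n + 1, i⟩ => F.emb n (F.g n (Finsupp.single i 1))

/-- The differential of the total free module. -/
noncomputable def bd : ((Σ n, F.ι n) →₀ R) →ₗ[R] ((Σ n, F.ι n) →₀ R) :=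
  Finsupp.linearCombination R F.bdFun

theorem bd_emb_zero (x : F.ι 0 →₀ R) : F.bd (F.emb 0 x) = 0 := by
  induction x using Finsupp.induction_linear with
  | zero => simp
  | add x y hx hy => rw [map_add, map_add, hx, hy, add_zero]
  | single i r => rw [emb_single, bd, Finsupp.linearCombination_single, bdFun, smul_zero]

theorem bd_emb_succ (n : ℕ) (x : F.ι (n + 1) →₀ R) :
    F.bd (F.emb (n + 1) x) = F.emb n (F.g n x) := by
  induction x using Finsupp.induction_linear with
  | zero => simp
  | add x y hx hy => simp only [map_add, hx, hy]
  | single i r =>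
    rw [emb_single, bd, Finsupp.linearCombination_single, bdFun, ← map_smul, ← map_smul,
      Finsupp.smul_single, smul_eq_mul, mul_one]

theorem induction_emb {p : ((Σ n, F.ι n) →₀ R) → Prop} (h0 : p 0)
    (hadd : ∀ x y, p x → p y → p (x + y)) (hemb : ∀ n x, p (F.emb n x)) (x) : p x := by
  induction x using Finsupp.induction_linear with
  | zero => exact h0
  | add x y hx hy => exact hadd x y hx hy
  | single b r => obtain ⟨n, i⟩ := b; rw [← emb_single]; exact hemb n _

theorem comp_bd (n : ℕ) (x : (Σ n, F.ι n) →₀ R) :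
    F.comp n (F.bd x) = F.g n (F.comp (n + 1) x) := by
  induction x using F.induction_emb with
  | h0 => simp
  | hadd x y hx hy => simp only [map_add, hx, hy]
  | hemb m x =>
    cases m with
    | zero => rw [bd_emb_zero, comp_emb_of_ne _ (by simp), map_zero, map_zero]
    | succ m =>
      rw [bd_emb_succ]
      rcases eq_or_ne m n with rfl | h
      · rw [comp_emb, comp_emb]
      · rw [comp_emb_of_ne _ h, comp_emb_of_ne _ (by omega), map_zero]

/-- The augmentation of the total free module. -/
noncomputable def aug : ((Σ n, F.ι n) →₀ R) →ₗ[R] M := F.ε ∘ₗ F.comp 0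

/-- The total complex of a free resolution. -/
noncomputable def based : BasedComplex R (Σ n, F.ι n) where
  deg b := b.1
  bd := F.bd
  bd_bd x := F.ext_comp fun n => by
    rw [comp_bd, comp_bd, (F.exact_succ n).apply_apply_eq_zero, map_zero]
  deg_eq := by
    rintro ⟨n, i⟩ b' h
    rw [bd, Finsupp.linearCombination_single, one_smul] at h
    cases n with
    | zero => exact absurd rfl h
    | succ n =>
      by_contra hn
      exact h (F.emb_apply_of_ne _ (by simpa using hn))

theorem aug_surjective : Function.Surjective F.aug :=
  F.surjective.comp fun x => ⟨F.emb 0 x, F.comp_emb 0 x⟩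

theorem aug_bd (x) : F.aug (F.based.bd x) = 0 := by
  show F.ε (F.comp 0 (F.bd x)) = 0
  rw [comp_bd, F.exact_zero.apply_apply_eq_zero]

theorem aug_single (b : Σ n, F.ι n) (h : F.based.deg b ≠ 0) : F.aug (Finsupp.single b 1) = 0 := by
  obtain ⟨n, i⟩ := b
  show F.ε (F.comp 0 _) = 0
  rw [← emb_single, F.comp_emb_of_ne (m := n) h, map_zero]

theorem exists_bd_eq {x : (Σ n, F.ι n) →₀ R} (h : ∀ n, ∃ y, F.g n y = F.comp n x) :
    ∃ y, F.bd y = x := by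
  choose y hy using h
  have hx : x ∈ Submodule.span R (Set.range fun n => F.emb n (F.comp n x)) := by
    have hs : x = ∑ n ∈ x.support.image Sigma.fst, F.emb n (F.comp n x) := by
      refine F.ext_comp fun m => ?_
      rw [map_sum, Finset.sum_eq_single m (fun n _ hn => F.comp_emb_of_ne hn _), comp_emb]
      · intro hm
        rw [comp_emb]
        ext i
        rw [comp_apply]
        by_contra hi
        exact hm (Finset.mem_image_of_mem Sigma.fst (a := (⟨m, i⟩ : Σ n, F.ι n))
          (Finsupp.mem_support_iff.2 hi))
    have h := sum_mem (t := x.support.image Sigma.fst)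
      (S := Submodule.span R (Set.range fun n => F.emb n (F.comp n x)))
      fun n _ => Submodule.subset_span (Set.mem_range_self n)
    rwa [← hs] at h
  have : Submodule.span R (Set.range fun n => F.emb n (F.comp n x)) ≤ LinearMap.range F.bd := by
    rw [Submodule.span_le]
    rintro _ ⟨n, rfl⟩
    exact (⟨F.emb (n + 1) (y n), by rw [bd_emb_succ, hy]⟩ : ∃ z, F.bd z = _)
  exact this hx

theorem exact_bd : Function.Exact F.based.bd (F.based.bd.prod F.aug) := by
  intro x
  constructor
  · intro h
    obtain ⟨h1, h2⟩ := Prod.ext_iff.1 h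
    refine F.exists_bd_eq fun n => ?_
    cases n with
    | zero => exact (F.exact_zero _).1 h2
    | succ n =>
      refine (F.exact_succ n _).1 ?_
      rw [← comp_bd]
      exact (congrArg (F.comp n) h1).trans (map_zero _)
  · rintro ⟨y, rfl⟩
    exact Prod.ext (F.based.bd_bd y) (F.aug_bd y)

theorem based_bd_single_mem {I : Ideal R} (h : ∀ n x i, F.g n x i ∈ I) (b b' : Σ n, F.ι n) :
    F.based.bd (Finsupp.single b 1) b' ∈ I := by
  obtain ⟨n, i⟩ := b
  obtain ⟨m, j⟩ := b'
  show F.comp m (F.bd _) j ∈ I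
  rw [comp_bd]
  exact h _ _ _

theorem finite_deg (h : ∀ n, Finite (F.ι n)) (k : ℕ) : {b | F.based.deg b = k}.Finite := by
  have := h k
  refine (Set.finite_range (Sigma.mk k : F.ι k → Σ n, F.ι n)).subset ?_
  rintro ⟨n, i⟩ hb
  obtain rfl : n = k := hb
  exact ⟨i, rfl⟩

end

section Minimal

variable {A : Type u} [CommRing A] [IsLocalRing A]

theorem exists_minimal_cover {P : Type u} [AddCommGroup P] [Module A P] {K : Submodule A P}
    (hK : K.FG) : ∃ (κ : Type u) (g : (κ →₀ A) →ₗ[A] P), Finite κ ∧ LinearMap.range g = K ∧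
      ∀ v ∈ LinearMap.ker g, ∀ i, v i ∈ maximalIdeal A := by
  classical
  refine ⟨K.generators, Finsupp.linearCombination A (Subtype.val : K.generators → P),
    hK.finite_generators, ?_, ?_⟩
  · rw [Finsupp.range_linearCombination, Subtype.range_coe, K.span_generators]
  · intro v hv i
    by_contra hi
    have hu : IsUnit (v i) := by simpa using hi
    have hfin := hK.finite_generators
    have hmem : (i : P) ∈ Submodule.span A (K.generators \ {i.1}) := by
      rw [LinearMap.mem_ker, Finsupp.linearCombination_apply, Finsupp.sum,
        ← Finset.add_sum_erase _ _ (Finsupp.mem_support_iff.2 hu.ne_zero)] at hv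
      rw [← Submodule.smul_mem_iff_of_isUnit _ hu, eq_neg_of_add_eq_zero_left hv]
      refine neg_mem (sum_mem fun j hj => Submodule.smul_mem _ _ (Submodule.subset_span ?_))
      exact ⟨j.2, fun h => (Finset.mem_erase.1 hj).1 (Subtype.ext h)⟩
    have hspan : Submodule.span A (K.generators \ {i.1}) = K := by
      refine le_antisymm ?_ ?_
      · conv_rhs => rw [← K.span_generators]
        exact Submodule.span_mono Set.sdiff_subset
      · conv_lhs => rw [← K.span_generators]
        rw [Submodule.span_le]
        intro x hx
        by_cases hxi : x = i
        · rw [hxi]; exact hmem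
        · exact Submodule.subset_span ⟨hx, hxi⟩
    have h1 := Submodule.spanFinrank_span_le_ncard_of_finite (R := A)
      (hfin.subset (Set.sdiff_subset (t := {i.1})))
    rw [hspan, ← hK.generators_ncard] at h1
    have := Set.ncard_sdiff_singleton_lt_of_mem i.2 hfin
    omega

theorem exists_minimal [IsNoetherianRing A] (M : Type u) [AddCommGroup M] [Module A M] [Module.Finite A M] :
    ∃ F : FreeRes A M, (∀ n, Finite (F.ι n)) ∧ ∀ n x i, F.g n x i ∈ maximalIdeal A := by
  obtain ⟨ι, ε, hι, hε, hm⟩ := exists_minimal_cover (K := (⊤ : Submodule A M)) Module.Finite.fg_top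
  obtain ⟨F, hF, hF0⟩ := exists_of_step
    (fun (ι : Type u) (K : Submodule A (ι →₀ A)) => Finite ι ∧ ∀ v ∈ K, ∀ i, v i ∈ maximalIdeal A)
    (fun ι K ⟨hι, _⟩ => by
      obtain ⟨κ, g, hκ, hg, hm⟩ := exists_minimal_cover (IsNoetherian.noetherian K)
      exact ⟨κ, g, hg, hκ, hm⟩)
    ε (LinearMap.range_eq_top.1 hε) ⟨hι, hm⟩
  refine ⟨F, fun n => ?_, fun n x i => ?_⟩
  · cases n with
    | zero => exact hF0.1
    | succ n => exact (hF n).1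
  · cases n with
    | zero => exact hF0.2 _ (F.exact_zero.apply_apply_eq_zero x) i
    | succ n => exact (hF n).2 _ ((F.exact_succ n).apply_apply_eq_zero x) i

end Minimal

end FreeRes

section TorVanish

open MonoidalCategory

variable {A : Type u} [CommRing A] {P : ℕ → Type u} [∀ n, AddCommGroup (P n)]
  [∀ n, Module A (P n)] {d : ∀ n, P (n + 1) →ₗ[A] P n} {N : Type u} [AddCommGroup N] [Module A N]
  {ε : P 0 →ₗ[A] N}

theorem exists_projectiveResolution [∀ n, Module.Projective A (P n)] (hε : Function.Surjective ε)
    (h0 : Function.Exact (d 0) ε) (hd : ∀ n, Function.Exact (d (n + 1)) (d n)) :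
    ∃ Q : ProjectiveResolution (ModuleCat.of A N),
      Q.complex = ChainComplex.of (fun n => ModuleCat.of A (P n)) (fun n => ModuleCat.ofHom (d n))
        (fun n => by
          rw [← ModuleCat.ofHom_comp, (hd n).linearMap_comp_eq_zero]; rfl) := by
  set C := ChainComplex.of (fun n => ModuleCat.of A (P n)) (fun n => ModuleCat.ofHom (d n))
        (fun n => by
          rw [← ModuleCat.ofHom_comp, (hd n).linearMap_comp_eq_zero]; rfl) with hC
  have hCd : ∀ n, C.d (n + 1) n = ModuleCat.ofHom (d n) := fun n =>
    ChainComplex.of_d (fun n => ModuleCat.of A (P n)) (fun n => ModuleCat.ofHom (d n)) n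
  have hε0 : C.d 1 0 ≫ (ModuleCat.ofHom ε : C.X 0 ⟶ _) = 0 := by
    rw [hCd 0]
    exact ModuleCat.hom_ext h0.linearMap_comp_eq_zero
  have hproj : ∀ n, Projective (C.X n) := fun n =>
    (IsProjective.iff_projective (P n)).1 inferInstance
  refine ⟨{ complex := C
            projective := hproj
            π := (ChainComplex.toSingle₀Equiv _ _).symm ⟨ModuleCat.ofHom ε, hε0⟩
            quasiIso := ⟨fun n => ?_⟩ }, rfl⟩
  cases n with
  | zero =>
    rw [ChainComplex.quasiIsoAt₀_iff, ShortComplex.quasiIso_iff_of_zeros']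
    · refine (ShortComplex.exact_and_epi_g_iff_of_iso
        (S₂ := ShortComplex.mk (C.d 1 0) (ModuleCat.ofHom ε : C.X 0 ⟶ _) hε0) ?_).2 ⟨?_, ?_⟩
      · exact ShortComplex.isoMk (Iso.refl _) (Iso.refl _) (Iso.refl _)
          ((Category.id_comp _).trans (Category.comp_id _).symm)
          ((Category.id_comp _).trans (Category.comp_id _).symm)
      · rw [ShortComplex.ShortExact.moduleCat_exact_iff_function_exact]
        simp only [hCd 0]
        exact h0
      · exact (ModuleCat.epi_iff_surjective _).2 hε
    all_goals rfl
  | succ n =>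
    rw [quasiIsoAt_iff_exactAt' _ _ (ChainComplex.exactAt_succ_single_obj _ _),
      HomologicalComplex.exactAt_iff' _ (n + 1 + 1) (n + 1) n (by simp) (by simp),
      ShortComplex.ShortExact.moduleCat_exact_iff_function_exact]
    simp only [HomologicalComplex.shortComplexFunctor'_obj_f,
      HomologicalComplex.shortComplexFunctor'_obj_g, hCd]
    exact hd n

theorem torVanish_iff [∀ n, Module.Projective A (P n)] (hε : Function.Surjective ε)
    (h0 : Function.Exact (d 0) ε) (hd : ∀ n, Function.Exact (d (n + 1)) (d n))
    (M : Type u) [AddCommGroup M] [Module A M] (n : ℕ) :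
    TorVanish A (n + 1) M N ↔
      Function.Exact ((d (n + 1)).lTensor M) ((d n).lTensor M) := by
  obtain ⟨Q, hQ⟩ := exists_projectiveResolution hε h0 hd
  have e := Q.isoLeftDerivedObj ((tensoringLeft (ModuleCat.{u} A)).obj (ModuleCat.of A M)) (n + 1)
  rw [hQ] at e
  have h1 : TorVanish A (n + 1) M N ↔ Limits.IsZero
      (((Tor (ModuleCat.{u} A) (n + 1)).obj (ModuleCat.of A M)).obj (ModuleCat.of A N)) :=
    ModuleCat.isZero_iff_subsingleton.symm
  rw [h1]
  change Limits.IsZero ((((tensoringLeft (ModuleCat.{u} A)).obj (ModuleCat.of A M)).leftDerived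
    (n + 1)).obj (ModuleCat.of A N)) ↔ _
  rw [e.isZero_iff]
  change Limits.IsZero (HomologicalComplex.homology _ _) ↔ _
  rw [← HomologicalComplex.exactAt_iff_isZero_homology,
    HomologicalComplex.exactAt_iff' _ (n + 1 + 1) (n + 1) n (by simp) (by simp),
      ShortComplex.ShortExact.moduleCat_exact_iff_function_exact]
  simp only [HomologicalComplex.shortComplexFunctor'_obj_f,
      HomologicalComplex.shortComplexFunctor'_obj_g, Functor.mapHomologicalComplex_obj_d,
      ChainComplex.of_d]
  rfl

end TorVanish

namespace GradedDiff

open TensorProduct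

section Coker

variable {R : Type*} [CommRing R] {W : Type*} [AddCommGroup W] [Module R W] (X : GradedDiff R W)

/-- The homogeneous component of degree `n`. -/
abbrev piece (n : ℤ) : Submodule R W := LinearMap.range (X.π n)

/-- The projection onto a homogeneous component. -/
abbrev toPiece (n : ℤ) : W →ₗ[R] X.piece n := (X.π n).rangeRestrict

theorem mem_piece {n : ℤ} {w : W} : w ∈ X.piece n ↔ X.π n w = w :=
  ⟨by rintro ⟨u, rfl⟩; exact X.π_same n u, fun h => ⟨w, h⟩⟩

theorem toPiece_coe {n : ℤ} (w : X.piece n) : X.toPiece n w = w :=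
  Subtype.ext (X.mem_piece.1 w.2)

/-- The cokernel of the differential ending in degree `n`. -/
abbrev coker (n : ℤ) : Type _ := W ⧸ (LinearMap.ker (X.π n) ⊔ X.B n)

theorem π_of_mem_B {n : ℤ} {w : W} (h : w ∈ X.B n) : X.π n w = w := (X.mem_Z.1 (X.B_le_Z n h)).1

theorem mem_ker_sup_B {n : ℤ} {w : W} : w ∈ LinearMap.ker (X.π n) ⊔ X.B n ↔ X.π n w ∈ X.B n := by
  constructor
  · intro h
    obtain ⟨a, ha, b, hb, rfl⟩ := Submodule.mem_sup.1 h
    rw [map_add, LinearMap.mem_ker.1 ha, zero_add, X.π_of_mem_B hb]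
    exact hb
  · intro h
    refine Submodule.mem_sup.2 ⟨w - X.π n w, ?_, X.π n w, h, sub_add_cancel _ _⟩
    rw [LinearMap.mem_ker, map_sub, X.π_same, sub_self]

theorem d_mem_piece {m n : ℤ} (h : m = n + 1) {w : W} (hw : X.π m w = w) : X.d w ∈ X.piece n := by
  rw [mem_piece, ← X.d_π h, hw]

theorem d_π_mem_B {m n : ℤ} (h : m = n + 1) (w : W) : X.d (X.π m w) ∈ X.B n := by
  subst h; exact ⟨w, rfl⟩

/-- The projection of a homogeneous component onto the cokernel. -/
def pieceToCoker (n : ℤ) : X.piece n →ₗ[R] X.coker n := Submodule.mkQ _ ∘ₗ Submodule.subtype _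

theorem pieceToCoker_surjective (n : ℤ) : Function.Surjective (X.pieceToCoker n) := by
  intro x
  obtain ⟨w, rfl⟩ := Submodule.mkQ_surjective _ x
  refine ⟨X.toPiece n w, ?_⟩
  refine (Submodule.Quotient.eq _).2 (X.mem_ker_sup_B.2 ?_)
  show X.π n (X.π n w - w) ∈ _
  rw [map_sub, X.π_same, sub_self]
  exact zero_mem _

theorem pieceToCoker_eq_zero {n : ℤ} {w : X.piece n} : X.pieceToCoker n w = 0 ↔ (w : W) ∈ X.B n := by
  refine (Submodule.Quotient.mk_eq_zero _).trans (X.mem_ker_sup_B.trans ?_)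
  show X.π n (w : W) ∈ _ ↔ _
  rw [X.mem_piece.1 w.2]

/-- The map from the cokernel induced by the differential. -/
def cokerToPiece {m n : ℤ} (h : m = n + 1) : X.coker m →ₗ[R] X.piece n :=
  Submodule.liftQ _ (LinearMap.codRestrict _ (X.d ∘ₗ X.π m)
    fun w => X.d_mem_piece h (X.π_same m w)) (by
      intro w hw
      rw [LinearMap.mem_ker, ← Submodule.coe_eq_zero]
      obtain ⟨u, -, hu⟩ := X.mem_B.1 (X.mem_ker_sup_B.1 hw)
      show X.d (X.π m w) = 0
      rw [← hu, X.d_d])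

theorem cokerToPiece_injective {m n : ℤ} (h : m = n + 1) (hX : X.ExactAt m) :
    Function.Injective (X.cokerToPiece h) := by
  rw [injective_iff_map_eq_zero]
  intro x hx
  obtain ⟨w, rfl⟩ := Submodule.mkQ_surjective _ x
  refine (Submodule.Quotient.mk_eq_zero _).2 (X.mem_ker_sup_B.2 (hX (X.mem_Z.2 ⟨X.π_same _ _, ?_⟩)))
  exact congrArg Subtype.val hx

theorem cokerToPiece_exact {m n : ℤ} (h : m = n + 1) :
    Function.Exact (X.cokerToPiece h) (X.pieceToCoker n) := by
  subst h
  intro w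
  rw [pieceToCoker_eq_zero]
  constructor
  · rintro ⟨u, hu⟩
    exact ⟨Submodule.Quotient.mk u, Subtype.ext hu⟩
  · rintro ⟨x, rfl⟩
    obtain ⟨u, rfl⟩ := Submodule.mkQ_surjective _ x
    exact X.d_π_mem_B rfl u

section ConeCoker

variable {s : ℤ} {q : W →ₗ[R] W} {hd : ∀ w, q (X.d w) = X.d (q w)}
    {hπ : ∀ n w, q (X.π (n + s + 1) w) = X.π n (q w)}

variable (hd hπ) in
/-- The inclusion of the cokernel of `X` in that of the cone. -/
def cokerInl (n : ℤ) : X.coker n →ₗ[R] (X.cone s q hd hπ).coker n :=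
  Submodule.mapQ _ _ (LinearMap.inl R W W) (by
    intro w hw
    obtain ⟨u, hu, hw⟩ := X.mem_B.1 (X.mem_ker_sup_B.1 hw)
    rw [Submodule.mem_comap, mem_ker_sup_B]
    refine mem_B _ |>.2 ⟨(u, 0), ?_, ?_⟩
    · rw [cone_π_apply]; simp [hu]
    · rw [cone_π_apply, cone_d_apply]; simp [hw])

variable (hd hπ) in
/-- The projection of the cokernel of the cone to that of the shift of `X`. -/
def cokerSnd (n : ℤ) : (X.cone s q hd hπ).coker n →ₗ[R] X.coker (n + s) :=
  Submodule.mapQ _ _ (LinearMap.snd R W W) (by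
    intro w hw
    obtain ⟨u, hu, hw⟩ := (mem_B _).1 ((mem_ker_sup_B _).1 hw)
    rw [Submodule.mem_comap, mem_ker_sup_B]
    rw [cone_π_apply, cone_d_apply] at hw
    rw [cone_π_apply] at hu
    refine (mem_B _).2 ⟨-u.2, ?_, ?_⟩
    · rw [map_neg]
      have := congrArg Prod.snd hu
      simp only at this
      rw [show n + s + 1 = n + 1 + s by ring, this]
    · rw [map_neg]
      exact congrArg Prod.snd hw)

theorem cokerInl_injective {n : ℤ} (hX : X.ExactAt (n + s + 1)) :
    Function.Injective (X.cokerInl hd hπ n) := by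
  rw [injective_iff_map_eq_zero]
  intro x hx
  obtain ⟨w, rfl⟩ := Submodule.mkQ_surjective _ x
  obtain ⟨u, hu, hw⟩ := (mem_B _).1 ((mem_ker_sup_B _).1 ((Submodule.Quotient.mk_eq_zero _).1 hx))
  rw [cone_π_apply] at hu hw
  rw [cone_d_apply] at hw
  have h1 := congrArg Prod.fst hw
  have h2 := congrArg Prod.snd hw
  have h3 := congrArg Prod.snd hu
  have h4 := congrArg Prod.fst hu
  simp only [LinearMap.inl_apply, map_zero, neg_eq_zero] at h1 h2 h3 h4
  obtain ⟨v, hv, hvu⟩ := (mem_B _).1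
    (hX (X.mem_Z.2 ⟨by rw [show n + s + 1 = n + 1 + s by ring]; exact h3, h2⟩))
  refine (Submodule.Quotient.mk_eq_zero _).2 (X.mem_ker_sup_B.2 ?_)
  refine X.mem_B_of_d (u := u.1 + q v) ?_ (X.π_same _ _)
  rw [map_add, ← hd, hvu]
  exact h1

theorem cokerInl_exact (n : ℤ) :
    Function.Exact (X.cokerInl hd hπ n) (X.cokerSnd hd hπ n) := by
  intro x
  constructor
  · intro hx
    obtain ⟨w, rfl⟩ := Submodule.mkQ_surjective _ x
    obtain ⟨u, hu, hw⟩ := (mem_B _).1 ((mem_ker_sup_B _).1 ((Submodule.Quotient.mk_eq_zero _).1 hx))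
    refine ⟨Submodule.Quotient.mk (w.1 + q u), ?_⟩
    refine (Submodule.Quotient.eq _).2 ((mem_ker_sup_B _).2 ?_)
    refine mem_B_of_d _ (u := (0, u)) ?_ (π_same _ _ _)
    rw [cone_d_apply, cone_π_apply]
    simp only [LinearMap.inl_apply, map_zero, zero_add, Prod.fst_sub, Prod.snd_sub,
      add_sub_cancel_left, zero_sub, map_neg, ← hπ]
    rw [hu, hw]
    rfl
  · rintro ⟨y, rfl⟩
    obtain ⟨w, rfl⟩ := Submodule.mkQ_surjective _ y
    refine (Submodule.Quotient.mk_eq_zero _).2 ?_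
    exact zero_mem _

theorem cokerSnd_surjective (n : ℤ) : Function.Surjective (X.cokerSnd hd hπ n) := by
  intro x
  obtain ⟨w, rfl⟩ := Submodule.mkQ_surjective _ x
  exact ⟨Submodule.Quotient.mk (0, w), rfl⟩

theorem cone_exactAt {n : ℤ} (h1 : X.ExactAt n) (h2 : X.ExactAt (n + s)) :
    (X.cone s q hd hπ).ExactAt n := by
  intro w hw
  obtain ⟨hw1, hw2⟩ := (mem_Z _).1 hw
  rw [cone_π_apply] at hw1
  rw [cone_d_apply] at hw2
  have e1 : X.d w.1 + q w.2 = 0 := congrArg Prod.fst hw2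
  have e2 : -X.d w.2 = 0 := congrArg Prod.snd hw2
  obtain ⟨v, hv, hvw⟩ := (mem_B _).1
    (h2 (X.mem_Z.2 ⟨congrArg Prod.snd hw1, neg_eq_zero.1 e2⟩))
  have hz : w.1 + q v ∈ X.Z n := X.mem_Z.2 ⟨by
    rw [map_add, ← hπ, hv]; congr 1; exact congrArg Prod.fst hw1, by
    rw [map_add, ← hd, hvw, e1]⟩
  obtain ⟨v', hv', hvw'⟩ := (mem_B _).1 (h1 hz)
  refine mem_B_of_d _ (u := (v', -v)) ?_ ((mem_Z _).1 hw).1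
  rw [cone_d_apply]
  ext <;> simp [hvw, hvw']

end ConeCoker

end Coker

section Retract

variable (A : Type*) [CommRing A] {R : Type*} [CommRing R] [Algebra A R]
variable {W : Type*} [AddCommGroup W] [Module R W] [Module A W] [IsScalarTower A R W]
variable (X : GradedDiff R W)

theorem projective_piece [Module.Projective A W] (n : ℤ) : Module.Projective A (X.piece n) :=
  Module.Projective.of_split ((X.piece n).subtype.restrictScalars A)
    ((X.toPiece n).restrictScalars A) (LinearMap.ext fun w => X.toPiece_coe w)

theorem flat_piece [Module.Flat A W] (n : ℤ) : Module.Flat A (X.piece n) :=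
  Module.Flat.of_retract ((X.piece n).subtype.restrictScalars A)
    ((X.toPiece n).restrictScalars A) (LinearMap.ext fun w => X.toPiece_coe w)

end Retract

section TorVanish

variable (A : Type u) [CommRing A] {R : Type u} [CommRing R] [Algebra A R]
variable {W : Type u} [AddCommGroup W] [Module R W] [Module A W] [IsScalarTower A R W]
variable (X : GradedDiff R W)

/-- The differential between homogeneous components. -/
def pieceD {m n : ℤ} (h : m = n + 1) : X.piece m →ₗ[A] X.piece n :=
  ((X.d ∘ₗ (X.piece m).subtype).codRestrict (X.piece n)
    fun w => X.d_mem_piece h (X.mem_piece.1 w.2)).restrictScalars A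

theorem exact_pieceD {l m n : ℤ} (h : l = m + 1) (h' : m = n + 1) (hX : X.ExactAt m) :
    Function.Exact (X.pieceD A h) (X.pieceD A h') := by
  subst h
  intro w
  constructor
  · intro hw
    obtain ⟨u, hu, huw⟩ := X.mem_B.1 (hX (X.mem_Z.2 ⟨X.mem_piece.1 w.2, congrArg Subtype.val hw⟩))
    exact ⟨⟨u, X.mem_piece.2 hu⟩, Subtype.ext huw⟩
  · rintro ⟨u, rfl⟩
    exact Subtype.ext (X.d_d _)

section

variable (M : Type u) [AddCommGroup M] [Module A M]

/-- The inclusion of the tensor product of a homogeneous component. -/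
noncomputable def tensorIn (n : ℤ) : M ⊗[A] X.piece n →ₗ[A] W ⊗[A] M :=
  (TensorProduct.comm A M W).toLinearMap ∘ₗ
    ((X.piece n).subtype.restrictScalars A).lTensor M

/-- The projection to the tensor product of a homogeneous component. -/
noncomputable def tensorOut (n : ℤ) : W ⊗[A] M →ₗ[A] M ⊗[A] X.piece n :=
  ((X.toPiece n).restrictScalars A).lTensor M ∘ₗ (TensorProduct.comm A W M).toLinearMap

theorem tensorOut_tensorIn (n : ℤ) (z : M ⊗[A] X.piece n) :
    X.tensorOut A M n (X.tensorIn A M n z) = z := by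
  induction z with
  | zero => simp
  | add x y hx hy => rw [map_add, map_add, hx, hy]
  | tmul m w => simp [tensorOut, tensorIn, toPiece_coe]

theorem tensorIn_tensorOut (n : ℤ) (z : W ⊗[A] M) :
    X.tensorIn A M n (X.tensorOut A M n z) = (X.tensor A M).π n z := by
  rw [tensor_π]
  induction z with
  | zero => simp
  | add x y hx hy => simp only [map_add, hx, hy]
  | tmul m w => simp [tensorOut, tensorIn]

theorem tensorIn_pieceD {m n : ℤ} (h : m = n + 1) (z : M ⊗[A] X.piece m) :
    X.tensorIn A M n ((X.pieceD A h).lTensor M z) = (X.tensor A M).d (X.tensorIn A M m z) := by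
  rw [tensor_d]
  induction z with
  | zero => simp
  | add x y hx hy => simp only [map_add, hx, hy]
  | tmul m w => simp [tensorIn, pieceD]

theorem exact_lTensor_pieceD_iff {l m n : ℤ} (h : l = m + 1) (h' : m = n + 1) :
    Function.Exact ((X.pieceD A h).lTensor M) ((X.pieceD A h').lTensor M) ↔
      (X.tensor A M).ExactAt m := by
  subst h
  constructor
  · intro hE z hz
    obtain ⟨hz1, hz2⟩ := (mem_Z _).1 hz
    rw [← tensorIn_tensorOut] at hz1
    have h0 : (X.pieceD A h').lTensor M (X.tensorOut A M m z) = 0 := by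
      rw [← X.tensorOut_tensorIn A M n ((X.pieceD A h').lTensor M _), tensorIn_pieceD, hz1, hz2,
        map_zero]
    obtain ⟨u, hu⟩ := (hE _).1 h0
    refine mem_B_of_d _ (u := X.tensorIn A M (m + 1) u) ?_ ((mem_Z _).1 hz).1
    rw [← X.tensorIn_pieceD A M rfl, hu, hz1]
  · intro hE z
    constructor
    · intro hz
      have hm : X.tensorIn A M m z ∈ (X.tensor A M).Z m := by
        rw [mem_Z, ← tensorIn_tensorOut, tensorOut_tensorIn, ← X.tensorIn_pieceD A M h', hz,
          map_zero]
        exact ⟨rfl, rfl⟩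
      obtain ⟨u, hu, huz⟩ := (mem_B _).1 (hE hm)
      refine ⟨X.tensorOut A M (m + 1) u, ?_⟩
      rw [← X.tensorOut_tensorIn A M m z, ← huz, ← X.tensorOut_tensorIn A M m
        ((X.pieceD A rfl).lTensor M _), tensorIn_pieceD, tensorIn_tensorOut, hu]
    · rintro ⟨u, rfl⟩
      rw [← X.tensorOut_tensorIn A M n ((X.pieceD A h').lTensor M _), tensorIn_pieceD,
        tensorIn_pieceD, d_d, map_zero]

/-- Computation of `Tor` by a graded differential module. -/
theorem torVanish_iff_exactAt [Module.Projective A W] (hX : ∀ n ≥ 1, X.ExactAt n)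
    {N : Type u} [AddCommGroup N] [Module A N] (e : X.coker 0 ≃ₗ[A] N) (n : ℕ) :
    TorVanish A (n + 1) M N ↔ (X.tensor A M).ExactAt (n + 1) := by
  have hP : ∀ n : ℕ, Module.Projective A (X.piece n) := fun n => X.projective_piece A n
  have h := torVanish_iff (A := A) (P := fun n : ℕ => X.piece n)
    (d := fun n => X.pieceD A (m := ((n + 1 : ℕ) : ℤ)) (n := n) (by push_cast; rfl)) (N := N)
    (ε := e.toLinearMap ∘ₗ (X.pieceToCoker 0).restrictScalars A)
    (e.surjective.comp (X.pieceToCoker_surjective 0)) ?_ ?_ M n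
  · rw [h]
    exact X.exact_lTensor_pieceD_iff A M (m := n + 1) _ rfl
  · intro w
    refine Iff.trans ?_ (X.cokerToPiece_exact (m := ((0 + 1 : ℕ) : ℤ)) (n := ((0 : ℕ) : ℤ)) rfl w
      |>.trans ?_)
    · exact e.map_eq_zero_iff
    · constructor
      · rintro ⟨x, rfl⟩
        obtain ⟨v, rfl⟩ := Submodule.mkQ_surjective _ x
        exact ⟨X.toPiece _ v, rfl⟩
      · rintro ⟨v, rfl⟩
        exact ⟨Submodule.Quotient.mk v, Subtype.ext (congrArg X.d (X.mem_piece.1 v.2))⟩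
  · intro n
    exact X.exact_pieceD A _ _ (hX _ (by push_cast; omega))

end

end TorVanish

end GradedDiff

/-! ## Flat dimension -/

open TensorProduct

theorem FlatDimLE.of_linearEquiv {A : Type u} [CommRing A] {n : ℕ} {M N : Type u} [AddCommGroup M]
    [Module A M] [AddCommGroup N] [Module A N] (e : M ≃ₗ[A] N) (h : FlatDimLE A n M) :
    FlatDimLE A n N := by
  cases n with
  | zero =>
    have : Module.Flat A M := h
    exact Module.Flat.of_linearEquiv e.symm
  | succ n =>
    obtain ⟨F, _, _, hF, f, hf, hk⟩ := h
    refine ⟨F, _, _, hF, e.toLinearMap ∘ₗ f, e.surjective.comp hf, ?_⟩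
    rwa [LinearEquiv.ker_comp]

theorem FlatDimLE.of_exact {A : Type u} [CommRing A] {n : ℕ} {K F M : Type u} [AddCommGroup K]
    [Module A K] [AddCommGroup F] [Module A F] [AddCommGroup M] [Module A M] [Module.Flat A F]
    {f : K →ₗ[A] F} {g : F →ₗ[A] M} (hf : Function.Injective f) (he : Function.Exact f g)
    (hg : Function.Surjective g) (h : FlatDimLE A n K) : FlatDimLE A (n + 1) M := by
  refine ⟨F, _, _, ‹_›, g, hg, h.of_linearEquiv ?_⟩
  exact (LinearEquiv.ofInjective f hf).trans
    (LinearEquiv.ofEq _ _ (LinearMap.exact_iff.1 he).symm)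

theorem Submodule.flat_quotient {A W : Type*} [CommRing A] [AddCommGroup W] [Module A W]
    [Module.Flat A W] (K : Submodule A W)
    (h : ∀ I : Ideal A, I.FG → K ⊓ I • (⊤ : Submodule A W) ≤ I • K) : Module.Flat A (W ⧸ K) := by
  rw [Module.Flat.iff_lift_lsmul_comp_subtype_injective]
  intro I hI
  rw [injective_iff_map_eq_zero]
  intro t ht
  obtain ⟨t, rfl⟩ := LinearMap.lTensor_surjective I K.mkQ_surjective t
  have key : ∀ s : I ⊗[A] W, TensorProduct.lift ((LinearMap.lsmul A (W ⧸ K)).comp I.subtype)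
      (K.mkQ.lTensor I s) = K.mkQ (TensorProduct.lift ((LinearMap.lsmul A W).comp I.subtype) s) := by
    intro s
    induction s with
    | zero => simp
    | add x y hx hy => simp only [map_add, hx, hy]
    | tmul a w => simp
  rw [key, Submodule.mkQ_apply, Submodule.Quotient.mk_eq_zero] at ht
  have hmem : TensorProduct.lift ((LinearMap.lsmul A W).comp I.subtype) t ∈
      I • (⊤ : Submodule A W) := by
    clear ht
    induction t with
    | zero => simp
    | add x y hx hy => rw [map_add]; exact add_mem hx hy
    | tmul a w => simpa using Submodule.smul_mem_smul a.2 Submodule.mem_top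
  have hIK : ∃ s : I ⊗[A] K, TensorProduct.lift ((LinearMap.lsmul A W).comp I.subtype)
      (K.subtype.lTensor I s) = TensorProduct.lift ((LinearMap.lsmul A W).comp I.subtype) t := by
    have := h I hI ⟨ht, hmem⟩
    revert this
    generalize TensorProduct.lift ((LinearMap.lsmul A W).comp I.subtype) t = w
    intro hw
    induction hw using Submodule.smul_induction_on' with
    | smul a ha k hk => exact ⟨⟨a, ha⟩ ⊗ₜ ⟨k, hk⟩, by simp⟩
    | add x _ y _ hx hy =>
      obtain ⟨s, hs⟩ := hx
      obtain ⟨s', hs'⟩ := hy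
      exact ⟨s + s', by rw [map_add, map_add, hs, hs']⟩
  obtain ⟨s, hs⟩ := hIK
  have := Module.Flat.iff_lift_lsmul_comp_subtype_injective.1 (inferInstance : Module.Flat A W) hI hs
  rw [← this, ← LinearMap.comp_apply, ← LinearMap.lTensor_comp,
    show K.mkQ ∘ₗ K.subtype = 0 from LinearMap.ext fun k => by simp, LinearMap.lTensor_zero]
  rfl

namespace GradedDiff

section FlatDim

theorem tmul_one_eq_zero_iff {A : Type*} [CommRing A] {W : Type*} [AddCommGroup W] [Module A W]
    (I : Ideal A) (w : W) :
    (w ⊗ₜ[A] (1 : A ⧸ I)) = 0 ↔ w ∈ I • (⊤ : Submodule A W) := by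
  rw [← (TensorProduct.tensorQuotEquivQuotSMul W I).map_eq_zero_iff,
    ← Submodule.Quotient.mk_eq_zero]
  have := TensorProduct.tensorQuotEquivQuotSMul_tmul_mk I w 1
  simp only [one_smul, map_one] at this
  rw [← this]

theorem exists_tmul_one_eq {A : Type*} [CommRing A] {W : Type*} [AddCommGroup W] [Module A W]
    (I : Ideal A) (z : W ⊗[A] (A ⧸ I)) : ∃ w : W, w ⊗ₜ[A] (1 : A ⧸ I) = z := by
  obtain ⟨w, hw⟩ := Submodule.Quotient.mk_surjective _ (TensorProduct.tensorQuotEquivQuotSMul W I z)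
  refine ⟨w, (TensorProduct.tensorQuotEquivQuotSMul W I).injective ?_⟩
  rw [← hw]
  simpa using TensorProduct.tensorQuotEquivQuotSMul_tmul_mk I w 1

theorem map_mem_smul {A : Type*} [CommRing A] {W W' : Type*} [AddCommGroup W] [Module A W]
    [AddCommGroup W'] [Module A W'] (f : W →ₗ[A] W') {I : Ideal A} {K : Submodule A W'}
    (hK : ∀ w, f w ∈ K) {w : W} (hw : w ∈ I • (⊤ : Submodule A W)) : f w ∈ I • K := by
  have h1 : f w ∈ (I • (⊤ : Submodule A W)).map f := Submodule.mem_map_of_mem hw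
  rw [Submodule.map_smul''] at h1
  refine Submodule.smul_mono le_rfl ?_ h1
  rintro _ ⟨v, -, rfl⟩
  exact hK v

variable {A : Type u} [CommRing A] {R : Type u} [CommRing R] [Algebra A R]
variable {W : Type u} [AddCommGroup W] [Module R W] [Module A W] [IsScalarTower A R W]
variable (X : GradedDiff R W)

theorem flat_coker [Module.Flat A W] (j : ℤ)
    (h : ∀ I : Ideal A, (X.tensor A (A ⧸ I)).ExactAt (j + 1)) : Module.Flat A (X.coker j) := by
  have key := Submodule.flat_quotient
    ((LinearMap.ker (X.π j) ⊔ X.B j).restrictScalars A) fun I _ k ⟨hk, hkI⟩ => ?_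
  · exact Module.Flat.of_linearEquiv
      (Submodule.Quotient.restrictScalarsEquiv A (LinearMap.ker (X.π j) ⊔ X.B j)).symm
  have hk' : X.π j k ∈ X.B j := X.mem_ker_sup_B.1 hk
  obtain ⟨u, hu, huk⟩ := X.mem_B.1 hk'
  have h1 : X.π j k ∈ I • (⊤ : Submodule A W) :=
    map_mem_smul ((X.π j).restrictScalars A) (fun _ => Submodule.mem_top) hkI
  have hz : u ⊗ₜ[A] (1 : A ⧸ I) ∈ (X.tensor A (A ⧸ I)).Z (j + 1) := by
    rw [GradedDiff.mem_Z, tensor_π, tensor_d]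
    refine ⟨?_, ?_⟩
    · show X.π (j + 1) u ⊗ₜ[A] (1 : A ⧸ I) = _
      rw [hu]
    · show X.d u ⊗ₜ[A] (1 : A ⧸ I) = 0
      rw [huk, tmul_one_eq_zero_iff]; exact h1
  obtain ⟨z, -, hz⟩ := (GradedDiff.mem_B _).1 (h I hz)
  obtain ⟨v, rfl⟩ := exists_tmul_one_eq I z
  have h2 : u - X.d v ∈ I • (⊤ : Submodule A W) := by
    rw [← tmul_one_eq_zero_iff, TensorProduct.sub_tmul, ← hz]
    exact sub_self _
  have h3 := map_mem_smul (K := (X.B j).restrictScalars A) ((X.d ∘ₗ X.π (j + 1)).restrictScalars A)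
    (fun w => ⟨w, rfl⟩) h2
  have h4 : X.d (X.π (j + 1) (u - X.d v)) = X.π j k := by
    rw [map_sub, hu, ← X.d_π (m := j + 1 + 1) rfl, map_sub, X.d_d, sub_zero, huk]
  have h5 := map_mem_smul (K := (LinearMap.ker (X.π j)).restrictScalars A)
    ((LinearMap.id - X.π j).restrictScalars A) (fun w => by simp [X.π_same]) hkI
  have h6 : k = (k - X.π j k) + X.π j k := by abel
  rw [h6]
  refine add_mem (Submodule.smul_mono le_rfl (fun w hw => ?_) h5)
    (Submodule.smul_mono le_rfl (fun w hw => ?_) (h4 ▸ h3))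
  · exact Submodule.mem_sup_left (S := LinearMap.ker (X.π j)) hw
  · exact Submodule.mem_sup_right (T := X.B j) hw

theorem flatDimLE_coker [Module.Flat A W] (i : ℕ) : ∀ (j : ℤ) (_ : ∀ n > j, X.ExactAt n)
    (_ : ∀ I : Ideal A, (X.tensor A (A ⧸ I)).ExactAt (j + i + 1)), FlatDimLE A i (X.coker j) := by
  induction i with
  | zero =>
    intro j _ h
    exact X.flat_coker j (by simpa using h)
  | succ i ih =>
    intro j hX h
    have := ih (j + 1) (fun n hn => hX n (by lia)) (by convert h using 3; push_cast; ring)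
    have := X.flat_piece A j
    exact FlatDimLE.of_exact (f := (X.cokerToPiece rfl).restrictScalars A)
      (g := (X.pieceToCoker j).restrictScalars A) (X.cokerToPiece_injective rfl (hX _ (by lia)))
      (X.cokerToPiece_exact rfl) (X.pieceToCoker_surjective j) ‹_›

end FlatDim
end GradedDiff

/-! ## Lengths of the homology of a tensor product -/

open TensorProduct

namespace GradedDiff

section Hl

variable {A : Type*} [CommRing A] {R : Type*} [CommRing R] [Algebra A R]
variable {W : Type*} [AddCommGroup W] [Module R W] [Module A W] [IsScalarTower A R W]
variable (X : GradedDiff R W)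

/-- The length of the homology of `X ⊗ Y` in degree `n`. -/
noncomputable def hl (A : Type*) [CommRing A] [Algebra A R] [Module A W] [IsScalarTower A R W]
    (Y : Type*) [AddCommGroup Y] [Module A Y] (n : ℤ) : ℕ∞ :=
  Module.length R ((X.tensor A Y).H n)

theorem hl_eq_zero_iff {Y : Type*} [AddCommGroup Y] [Module A Y] {n : ℤ} :
    X.hl A Y n = 0 ↔ (X.tensor A Y).ExactAt n := by
  rw [hl, Module.length_eq_zero_iff, subsingleton_H_iff]

theorem hl_eq_zero_of_flat {Y : Type*} [AddCommGroup Y] [Module A Y] [Module.Flat A Y] {n : ℤ}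
    (h : X.ExactAt n) : X.hl A Y n = 0 :=
  X.hl_eq_zero_iff.2 (h.tensor Y)

variable {Y₁ Y₂ Y₃ : Type*} [AddCommGroup Y₁] [AddCommGroup Y₂] [AddCommGroup Y₃]
  [Module A Y₁] [Module A Y₂] [Module A Y₃]

section Exact

variable {f : Y₁ →ₗ[A] Y₂} {g : Y₂ →ₗ[A] Y₃} [Module.Flat A W]

theorem hl_le_add_middle (hf : Function.Injective f) (he : Function.Exact f g)
    (hg : Function.Surjective g) (n : ℤ) : X.hl A Y₂ n ≤ X.hl A Y₁ n + X.hl A Y₃ n :=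
  Module.length_le_add_of_exact (X.tensor_exact₂ hf he hg n)

theorem hl_le_add_right (hf : Function.Injective f) (he : Function.Exact f g)
    (hg : Function.Surjective g) (n : ℤ) :
    X.hl A Y₃ (n + 1) ≤ X.hl A Y₂ (n + 1) + X.hl A Y₁ n := by
  obtain ⟨δ, h1, h2⟩ := X.exists_tensor_connecting hf he hg n
  exact Module.length_le_add_of_exact h1

theorem hl_le_add_left (hf : Function.Injective f) (he : Function.Exact f g)
    (hg : Function.Surjective g) (n : ℤ) :
    X.hl A Y₁ n ≤ X.hl A Y₃ (n + 1) + X.hl A Y₂ n := by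
  obtain ⟨δ, h1, h2⟩ := X.exists_tensor_connecting hf he hg n
  exact Module.length_le_add_of_exact h2

theorem hl_le_of_linearEquiv (e : Y₁ ≃ₗ[A] Y₂) (n : ℤ) : X.hl A Y₁ n ≤ X.hl A Y₂ n := by
  have h := X.hl_le_add_middle (Submodule.subtype_injective (⊥ : Submodule A Y₁))
    (g := e.toLinearMap) (fun x => by simp) e.surjective n
  rwa [(X.hl_eq_zero_iff (Y := (⊥ : Submodule A Y₁))).2 (fun z _ => ?_), zero_add] at h
  rw [Subsingleton.elim z 0]
  exact zero_mem _

theorem hl_congr (e : Y₁ ≃ₗ[A] Y₂) (n : ℤ) : X.hl A Y₁ n = X.hl A Y₂ n :=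
  le_antisymm (X.hl_le_of_linearEquiv e n) (X.hl_le_of_linearEquiv e.symm n)

end Exact

theorem hl_eq_zero_of_flatDimLE {A : Type u} [CommRing A] [Algebra A R] [Module A W]
    [IsScalarTower A R W] [Module.Flat A W] {n₁ : ℤ} (hX : ∀ n ≥ n₁, X.ExactAt n) (j : ℕ) :
    ∀ (Y : Type u) [AddCommGroup Y] [Module A Y] (_ : FlatDimLE A j Y) (n : ℤ),
      n₁ + j ≤ n → X.hl A Y n = 0 := by
  induction j with
  | zero =>
    intro Y _ _ hY n hn
    have : Module.Flat A Y := hY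
    exact X.hl_eq_zero_of_flat (hX n (by lia))
  | succ j ih =>
    intro Y _ _ hY n hn
    obtain ⟨F, _, _, hF, f, hf, hk⟩ := hY
    have h := X.hl_le_add_right (Submodule.subtype_injective (LinearMap.ker f))
      (LinearMap.exact_subtype_ker_map f) hf (n - 1)
    rw [sub_add_cancel, X.hl_eq_zero_of_flat (Y := F) (hX n (by push_cast at hn; lia)),
      ih _ hk (n - 1) (by push_cast at hn; lia), zero_add] at h
    exact nonpos_iff_eq_zero.1 h

section Syzygy

variable {W' : Type*} [AddCommGroup W'] [Module A W'] [Module.Flat A W'] (T : GradedDiff A W')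
variable [Module.Flat A W]

theorem hl_coker_le_succ {j n : ℤ} (hT : T.ExactAt (j + 1)) (hX : X.ExactAt (n + 1)) :
    X.hl A (T.coker j) (n + 1) ≤ X.hl A (T.coker (j + 1)) n := by
  have := T.flat_piece A j
  have h := X.hl_le_add_right (T.cokerToPiece_injective rfl hT) (T.cokerToPiece_exact rfl)
    (T.pieceToCoker_surjective j) n
  rwa [X.hl_eq_zero_of_flat (Y := T.piece j) hX, zero_add] at h

theorem hl_coker_succ_le {j n : ℤ} (hT : T.ExactAt (j + 1)) (hX : X.ExactAt n) :
    X.hl A (T.coker (j + 1)) n ≤ X.hl A (T.coker j) (n + 1) := by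
  have := T.flat_piece A j
  have h := X.hl_le_add_left (T.cokerToPiece_injective rfl hT) (T.cokerToPiece_exact rfl)
    (T.pieceToCoker_surjective j) n
  rwa [X.hl_eq_zero_of_flat (Y := T.piece j) hX, add_zero] at h

theorem hl_coker_zero_eq {n₁ : ℤ} (hX : ∀ n ≥ n₁, X.ExactAt n)
    (hT : ∀ n ≥ 1, T.ExactAt n) (s : ℕ) :
    ∀ n ≥ n₁, X.hl A (T.coker s) n = X.hl A (T.coker 0) (n + s) := by
  induction s with
  | zero => intro n _; simp
  | succ s ih =>
    intro n hn
    have h1 := X.hl_coker_le_succ T (j := s) (n := n) (hT _ (by lia)) (hX _ (by lia))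
    have h2 := X.hl_coker_succ_le T (j := s) (n := n) (hT _ (by lia)) (hX _ (by lia))
    have h3 := ih (n + 1) (by lia)
    push_cast
    rw [← show n + 1 + (s : ℤ) = n + ((s : ℤ) + 1) by ring, ← h3]
    exact le_antisymm h2 h1

variable {s : ℕ} {q : W' →ₗ[A] W'} {hd : ∀ w, q (T.d w) = T.d (q w)}
    {hπ : ∀ n w, q (T.π (n + s + 1) w) = T.π n (q w)}

theorem hl_coker_le_cone {n₁ : ℤ} (hX : ∀ n ≥ n₁, X.ExactAt n)
    (hT : ∀ n ≥ 1, T.ExactAt n) {n : ℤ} (hn : n₁ ≤ n) :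
    X.hl A (T.coker 0) (n + (s + 1)) ≤
      X.hl A (T.coker 0) n + X.hl A ((T.cone s q hd hπ).coker 0) (n + 1) := by
  have h1 := X.hl_coker_zero_eq T hX hT s (n + 1) (by lia)
  have h2 := X.hl_le_add_right (T.cokerInl_injective (hd := hd) (hπ := hπ) (n := 0)
    (hT _ (by lia))) (T.cokerInl_exact 0) (T.cokerSnd_surjective 0) n
  rw [zero_add, h1, show n + 1 + (s : ℤ) = n + (s + 1) by ring] at h2
  rwa [add_comm (X.hl A _ n)]

theorem hl_cone_ne_top {n₁ : ℤ} (hX : ∀ n ≥ n₁, X.ExactAt n)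
    (hT : ∀ n ≥ 1, T.ExactAt n)
    (h : ∀ n ≥ n₁, X.hl A (T.coker 0) n ≠ ⊤) :
    ∀ n ≥ n₁, X.hl A ((T.cone s q hd hπ).coker 0) n ≠ ⊤ := by
  intro n hn
  have h2 := X.hl_le_add_middle (T.cokerInl_injective (hd := hd) (hπ := hπ) (n := 0)
    (hT _ (by lia))) (T.cokerInl_exact 0) (T.cokerSnd_surjective 0) n
  rw [zero_add, X.hl_coker_zero_eq T hX hT s n hn] at h2
  exact ne_top_of_le_ne_top (WithTop.add_ne_top.2 ⟨h n hn, h _ (by lia)⟩) h2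

end Syzygy

end Hl

end GradedDiff

/-! ## Noetherian modules with prescribed support and Koszul cones -/

open TensorProduct

/-- A noetherian module on which every element of `I` is nilpotent. -/
structure IsNoethSupp {R : Type*} [CommRing R] (I : Ideal R) (P : Type*) [AddCommGroup P]
    [Module R P] : Prop where
  isNoetherian : IsNoetherian R P
  le_radical : I ≤ (Module.annihilator R P).radical

namespace IsNoethSupp

variable {R : Type*} [CommRing R] {I : Ideal R}
variable {P P' P'' : Type*} [AddCommGroup P] [Module R P] [AddCommGroup P'] [Module R P']
  [AddCommGroup P''] [Module R P'']

theorem of_subsingleton [Subsingleton P] : IsNoethSupp I P where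
  isNoetherian := inferInstance
  le_radical := by
    rw [Module.annihilator_eq_top_iff.2 inferInstance, Ideal.radical_top]; exact le_top

theorem of_injective (h : IsNoethSupp I P) {f : P' →ₗ[R] P} (hf : Function.Injective f) :
    IsNoethSupp I P' where
  isNoetherian := have := h.isNoetherian; isNoetherian_of_injective f hf
  le_radical := h.le_radical.trans (Ideal.radical_mono (f.annihilator_le_of_injective hf))

theorem of_exact (h : IsNoethSupp I P) (h'' : IsNoethSupp I P'') {f : P →ₗ[R] P'}
    {g : P' →ₗ[R] P''} (he : Function.Exact f g) : IsNoethSupp I P' where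
  isNoetherian :=
    have := h.isNoetherian
    have := h''.isNoetherian
    isNoetherian_of_range_eq_ker f g (LinearMap.exact_iff.1 he).symm
  le_radical r hr := by
    obtain ⟨a, ha⟩ := h.le_radical hr
    obtain ⟨b, hb⟩ := h''.le_radical hr
    refine ⟨a + b, Module.mem_annihilator.2 fun x => ?_⟩
    obtain ⟨y, hy⟩ := (he (r ^ b • x)).1 (by rw [map_smul, Module.mem_annihilator.1 hb])
    rw [pow_add, mul_smul, ← hy, ← map_smul, Module.mem_annihilator.1 ha, map_zero]

theorem isFiniteLength (h : IsNoethSupp I P) [hI : I.IsMaximal] : Module.length R P ≠ ⊤ := by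
  have := h.isNoetherian
  have hR : IsNoetherian R (R ⧸ Module.annihilator R P) := by
    obtain ⟨s, hs⟩ := (inferInstance : Module.Finite R P).fg_top
    let f : R →ₗ[R] (s → P) := LinearMap.pi fun p => LinearMap.toSpanSingleton R P p.1
    have hf : LinearMap.ker f = Module.annihilator R P := by
      ext r
      rw [← Submodule.annihilator_top, ← hs, Submodule.mem_annihilator_span]
      simp [f, funext_iff]
    rw [← hf]
    exact isNoetherian_of_injective (Submodule.liftQ _ f le_rfl)
      (LinearMap.ker_eq_bot.1 (Submodule.ker_liftQ_eq_bot _ _ _ le_rfl))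
  have hR' : IsNoetherianRing (R ⧸ Module.annihilator R P) :=
    isNoetherian_of_tower R hR
  have : Ring.KrullDimLE 0 (R ⧸ Module.annihilator R P) := by
    refine Ring.krullDimLE_zero_iff.2 fun p hp => ?_
    have hq : I = p.comap (Ideal.Quotient.mk _) := by
      refine hI.eq_of_le (Ideal.IsPrime.ne_top inferInstance) fun r hr => ?_
      obtain ⟨a, ha⟩ := h.le_radical hr
      refine hp.mem_of_pow_mem a ?_
      rw [← map_pow, Ideal.Quotient.eq_zero_iff_mem.2 ha]
      exact zero_mem _
    have := Ideal.map_eq_top_or_isMaximal_of_surjective (Ideal.Quotient.mk (Module.annihilator R P))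
      Ideal.Quotient.mk_surjective hI
    rw [hq, Ideal.map_comap_of_surjective _ Ideal.Quotient.mk_surjective] at this
    exact this.resolve_left hp.ne_top
  have : IsArtinianRing (R ⧸ Module.annihilator R P) :=
    IsNoetherianRing.isArtinianRing_of_krullDimLE_zero
  let := Module.quotientAnnihilator (R := R) (M := P)
  have : IsScalarTower R (R ⧸ Module.annihilator R P) P :=
    Module.IsTorsionBySet.isScalarTower (Module.isTorsionBySet_annihilator R P)
  have : Module.Finite (R ⧸ Module.annihilator R P) P := Module.Finite.of_restrictScalars_finite R _ _
  have : IsArtinian R P :=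
    isArtinian_of_surjective_algebraMap (R := R ⧸ Module.annihilator R P)
      Ideal.Quotient.mk_surjective
  exact Module.length_ne_top_iff.2 (isFiniteLength_iff_isNoetherian_isArtinian.2 ⟨‹_›, this⟩)

end IsNoethSupp

theorem IsNoethSupp.subsingleton_of_smul {R B : Type*} [CommRing R] [CommRing B] [IsLocalRing B]
    {φ : R →+* B} (hφ : Function.Surjective φ) {P : Type*} [AddCommGroup P] [Module R P]
    (h : IsNoethSupp (RingHom.ker φ) P) {x : R} (hx : φ x ∈ maximalIdeal B)
    (hP : ∀ p : P, ∃ p' : P, x • p' = p) : Subsingleton P := by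
  have := h.isNoetherian
  obtain ⟨r, hr, hrP⟩ := Submodule.exists_sub_one_mem_and_smul_eq_zero_of_fg_of_le_smul
    (Ideal.span {x}) (⊤ : Submodule R P) Module.Finite.fg_top (by
      rintro p -
      obtain ⟨p', rfl⟩ := hP p
      exact Submodule.smul_mem_smul (Ideal.mem_span_singleton_self x) Submodule.mem_top)
  have hu : IsUnit (φ r) := by
    by_contra hn
    obtain ⟨c, hc⟩ := Ideal.mem_span_singleton'.1 hr
    refine (maximalIdeal.isMaximal B).ne_top ((Ideal.eq_top_iff_one _).2 ?_)
    have h1 : φ r - φ (c * x) ∈ maximalIdeal B :=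
      sub_mem ((mem_maximalIdeal _).2 hn) (by rw [map_mul]; exact Ideal.mul_mem_left _ _ hx)
    rwa [hc, map_sub, map_one, sub_sub_cancel] at h1
  obtain ⟨b, hb⟩ := hu.exists_right_inv
  obtain ⟨r', rfl⟩ := hφ b
  obtain ⟨a, ha⟩ := h.le_radical (show 1 - r * r' ∈ RingHom.ker φ by
    rw [RingHom.mem_ker, map_sub, map_mul, hb, map_one, sub_self])
  have key : ∀ (p : P) (n : ℕ), (1 - r * r') ^ n • p = p := by
    intro p n
    induction n with
    | zero => simp
    | succ n ih =>
      rw [pow_succ, mul_smul, sub_smul, one_smul, mul_smul, hrP _ Submodule.mem_top, sub_zero, ih]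
  refine subsingleton_of_forall_eq 0 fun p => ?_
  rw [← key p a, Module.mem_annihilator.1 ha]

namespace GradedDiff

section Koszul

variable {A : Type u} [CommRing A] {R : Type u} [CommRing R] [Algebra A R]

section Single

variable {W : Type u} [AddCommGroup W] [Module R W] [Module A W] [IsScalarTower A R W]
variable (X : GradedDiff R W)

/-- The cone of the multiplication by a scalar. -/
abbrev scalarCone (x : R) : GradedDiff R (W × W) :=
  X.cone (-1) (x • LinearMap.id) (fun w => by simp) (fun n w => by simp)

variable (Y : Type*) [AddCommGroup Y] [Module A Y]

theorem rT_smul_id (x : R) (z : W ⊗[A] Y) : rT A Y (x • LinearMap.id : W →ₗ[R] W) z = x • z := by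
  rw [rT_smul, rT_eq_self (fun _ => rfl)]

variable {Y}

theorem scalarCone_exact {x : R} {n : ℤ} (h : (X.tensor A Y).ExactAt n)
    (h' : (X.tensor A Y).ExactAt (n - 1)) : ((X.scalarCone x).tensor A Y).ExactAt n := by
  rw [← subsingleton_H_iff] at h ⊢
  rw [← ((X.tensor A Y).twist_exactAt (-1) (show n + -1 = n - 1 by ring)),
    ← subsingleton_H_iff] at h'
  exact (cone_tensor_exact Y X n).subsingleton

theorem smul_mem_B_scalarCone (x : R) {n : ℤ} {z : (W × W) ⊗[A] Y}
    (hz : z ∈ ((X.scalarCone x).tensor A Y).Z n) :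
    x • z ∈ ((X.scalarCone x).tensor A Y).B n := by
  let i : W × W →ₗ[R] W × W := LinearMap.inr R W W ∘ₗ LinearMap.fst R W W
  have hi : ∀ w : W × W, (X.scalarCone x).d (i w) + i ((X.scalarCone x).d w) = x • w := by
    intro w
    rw [cone_d_apply, cone_d_apply]
    ext <;> simp [i]
  have h0 := ((mem_Z _).1 hz).2
  refine mem_B_of_d _ (u := rT A Y i z) ?_ ?_
  · have h1 : rT A Y (X.scalarCone x).d (rT A Y i z) + rT A Y i (rT A Y (X.scalarCone x).d z) =
        x • z := by
      rw [rT_rT, rT_rT, ← rT_add, ← rT_smul_id]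
      exact rT_congr hi z
    rw [tensor_d] at h0
    rwa [h0, map_zero, add_zero] at h1
  · rw [map_smul, ((mem_Z _).1 hz).1]

theorem isNoethSupp_scalarCone {I : Ideal R} {x : R}
    (h : ∀ n, IsNoethSupp I ((X.tensor A Y).H n)) (n : ℤ) :
    IsNoethSupp (Ideal.span {x} ⊔ I) (((X.scalarCone x).tensor A Y).H n) := by
  have h1 : IsNoethSupp I (((X.tensor A Y).twist (-1) (-1)).H n) :=
    (h (n + -1)).of_injective
      (f := ((X.tensor A Y).nonempty_twist_H_equiv (-1) rfl).some.toLinearMap)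
      (LinearEquiv.injective _)
  have h2 := (h n).of_exact h1 (cone_tensor_exact (A := A) (hd := fun w => by simp)
    (hπ := fun n w => by simp) Y X (q := x • LinearMap.id) n)
  refine ⟨h2.isNoetherian, sup_le ?_ h2.le_radical⟩
  rw [Ideal.span_singleton_le_iff_mem]
  refine Ideal.le_radical (Module.mem_annihilator.2 fun p => ?_)
  obtain ⟨z, hz, rfl⟩ := cls_surj _ p
  rw [smul_cls, cls_eq_zero]
  exact X.smul_mem_B_scalarCone x hz

theorem exactAt_of_scalarCone {B : Type*} [CommRing B] [IsLocalRing B] {φ : R →+* B}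
    (hφ : Function.Surjective φ) {x : R} (hx : φ x ∈ maximalIdeal B) {n : ℤ}
    (h : IsNoethSupp (RingHom.ker φ) ((X.tensor A Y).H n))
    (hn : ((X.scalarCone x).tensor A Y).ExactAt n) : (X.tensor A Y).ExactAt n := by
  rw [← subsingleton_H_iff]
  refine h.subsingleton_of_smul hφ hx fun p => ?_
  obtain ⟨z, hz, rfl⟩ := cls_surj _ p
  obtain ⟨v, hv, hvz⟩ := (mem_B _).1 (hn ((X.isMor_cone_inl Y).mem_Z hz))
  have h1 := congrArg (rT A Y (LinearMap.fst R W W)) hvz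
  rw [cone_tensor_d, rT_rT (LinearMap.fst R W W), rT_eq_self (f := LinearMap.fst R W W ∘ₗ _)
    (fun _ => rfl), rT_smul_id] at h1
  have hsnd : IsMor ((X.scalarCone x).tensor A Y) ((X.tensor A Y).twist (-1) (-1))
      (rT A Y (LinearMap.snd R W W)) := X.isMor_cone_snd Y
  have hZ : rT A Y (LinearMap.snd R W W) v ∈ (X.tensor A Y).Z n := by
    rw [GradedDiff.mem_Z]
    constructor
    · have h2 := hsnd.comm_π (n + 1) v
      rw [hv] at h2
      have h5 : ((X.tensor A Y).twist (-1) (-1)).π (n + 1) = (X.tensor A Y).π n :=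
        congrArg (X.tensor A Y).π (add_neg_cancel_right n 1)
      rw [h5] at h2
      exact h2.symm
    · have h2 := hsnd.comm_d v
      rw [hvz, rT_rT, rT_eq_zero (fun _ => by simp)] at h2
      have h3 : (0 : W ⊗[A] Y) = ((-1 : ℤ) • (X.tensor A Y).d) (rT A Y (LinearMap.snd R W W) v) := h2
      rw [neg_one_zsmul, LinearMap.neg_apply, eq_comm, neg_eq_zero] at h3
      exact h3
  refine ⟨cls _ _ hZ, ?_⟩
  rw [smul_cls, cls_eq_cls, ← h1, sub_add_cancel_right]
  refine neg_mem (mem_B_of_d _ (u := rT A Y (LinearMap.fst R W W) v) rfl ?_)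
  have h4 : rT A Y X.d (rT A Y (LinearMap.fst R W W) v) =
    z - x • rT A Y (LinearMap.snd R W W) v := by rw [← h1, add_sub_cancel_right]
  show (X.tensor A Y).π n (rT A Y X.d (rT A Y (LinearMap.fst R W W) v)) = _
  rw [h4, map_sub, map_smul, ((mem_Z _).1 hz).1, ((mem_Z _).1 hZ).1]

end Single

theorem flat_finsupp (A : Type*) [CommRing A] (β : Type*) (W : Type*) [AddCommGroup W] [Module A W]
    [Module.Flat A W] : Module.Flat A (β →₀ W) := by
  classical exact .of_linearEquiv (finsuppLEquivDirectSum A W β)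

theorem flat_prod (A : Type*) [CommRing A] (W : Type*) [AddCommGroup W] [Module A W]
    [Module.Flat A W] : Module.Flat A (W × W) :=
  have := flat_finsupp A (Fin 2) W
  .of_linearEquiv ((LinearEquiv.finTwoArrow A W).symm ≪≫ₗ
    (Finsupp.linearEquivFunOnFinite A W (Fin 2)).symm)

/-- The properties of an iterated cone of multiplications by the elements of a list. -/
theorem exists_koszul {B : Type*} [CommRing B] [IsLocalRing B] {φ : R →+* B}
    (hφ : Function.Surjective φ) (l : List R) (hl : ∀ x ∈ l, φ x ∈ maximalIdeal B)
    {W : Type u} [AddCommGroup W] [Module R W] [Module A W] [IsScalarTower A R W]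
    [Module.Flat A W] (X : GradedDiff R W) (hX : ∀ n < 0, ∀ w, X.π n w = 0) :
    ∃ (W' : Type u) (_ : AddCommGroup W') (_ : Module R W') (_ : Module A W')
      (_ : IsScalarTower A R W') (_ : Module.Flat A W') (X' : GradedDiff R W'),
      (∀ n < 0, ∀ w, X'.π n w = 0) ∧
      ∀ (Y : Type u) [AddCommGroup Y] [Module A Y],
        (∀ m, (∀ n ≥ m, (X.tensor A Y).ExactAt n) →
          ∀ n ≥ m + l.length, (X'.tensor A Y).ExactAt n) ∧
        ((∀ n, IsNoethSupp (RingHom.ker φ) ((X.tensor A Y).H n)) →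
          (∀ n, IsNoethSupp (Ideal.span {x | x ∈ l} ⊔ RingHom.ker φ) ((X'.tensor A Y).H n)) ∧
          ∀ n, (X'.tensor A Y).ExactAt n → (X.tensor A Y).ExactAt n) := by
  induction l with
  | nil =>
    refine ⟨W, _, _, _, _, ‹_›, X, hX, fun Y _ _ => ⟨fun m h n hn => h n (by simpa using hn), fun h =>
      ⟨fun n => ?_, fun n h => h⟩⟩⟩
    simpa using h n
  | cons x l ih =>
    obtain ⟨W', _, _, _, _, _, X', hX', h⟩ := ih fun y hy => hl y (List.mem_cons_of_mem _ hy)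
    refine ⟨W' × W', _, _, _, inferInstance, ?_, X'.scalarCone x, ?_, fun Y _ _ => ?_⟩
    · exact flat_prod A W'
    · intro n hn w
      rw [cone_π_apply, hX' n hn, hX' _ (by lia)]; rfl
    · obtain ⟨h1, h2⟩ := h Y
      refine ⟨fun m hm n hn => ?_, fun hN => ⟨fun n => ?_, fun n hn => ?_⟩⟩
      · simp only [List.length_cons, Nat.cast_add, Nat.cast_one] at hn
        exact X'.scalarCone_exact (h1 m hm n (by lia)) (h1 m hm _ (by lia))
      · have h3 := X'.isNoethSupp_scalarCone (x := x) (h2 hN).1 n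
        rw [← sup_assoc, ← Ideal.span_union] at h3
        convert h3 using 3
        ext y; simp
      · refine (h2 hN).2 n (X'.exactAt_of_scalarCone hφ (hl x List.mem_cons_self) ?_ hn)
        exact ⟨((h2 hN).1 n).isNoetherian, le_sup_right.trans ((h2 hN).1 n).le_radical⟩

end Koszul

end GradedDiff

/-! ## The graded differential module of a free resolution -/

open TensorProduct

namespace FreeRes

variable {R : Type u} [CommRing R] {M : Type u} [AddCommGroup M] [Module R M] (F : FreeRes R M)

/-- The projections onto the components. -/
noncomputable def proj : ℤ → ((Σ n, F.ι n) →₀ R) →ₗ[R] ((Σ n, F.ι n) →₀ R)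
  | Int.ofNat k => F.emb k ∘ₗ F.comp k
  | Int.negSucc _ => 0

theorem proj_natCast (k : ℕ) (x) : F.proj k x = F.emb k (F.comp k x) := rfl

theorem proj_of_neg {n : ℤ} (hn : n < 0) (x) : F.proj n x = 0 := by
  obtain ⟨k, rfl⟩ := Int.eq_negSucc_of_lt_zero hn
  rfl

theorem comp_proj (k : ℕ) (n : ℤ) (x) : F.comp k (F.proj n x) = if n = k then F.comp k x else 0 := by
  obtain hn | hn := lt_or_ge n 0
  · rw [proj_of_neg _ hn, if_neg (by lia), map_zero]
  · obtain ⟨m, rfl⟩ := Int.eq_ofNat_of_zero_le hn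
    rw [proj_natCast]
    split_ifs with h
    · obtain rfl := Nat.cast_injective h
      exact F.comp_emb _ _
    · exact F.comp_emb_of_ne (fun hne => h (by rw [hne])) _

/-- A free resolution as a graded differential module. -/
noncomputable def graded : GradedDiff R ((Σ n, F.ι n) →₀ R) where
  d := F.bd
  π := F.proj
  d_d := F.based.bd_bd
  π_same n x := F.ext_comp fun k => by rw [comp_proj, comp_proj]; split_ifs <;> rfl
  π_ne m n x h := F.ext_comp fun k => by
    rw [comp_proj, comp_proj, map_zero]
    split_ifs with h1 h2
    · exact absurd (h1.trans h2.symm) h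
    · rfl
    · rfl
  exists_sum_π x := by
    refine ⟨x.support.image fun b => (b.1 : ℤ), F.ext_comp fun k => ?_⟩
    rw [map_sum, Finset.sum_congr rfl fun n _ => F.comp_proj k n x, Finset.sum_ite_eq']
    split_ifs with h
    · rfl
    · ext i
      by_contra hi
      exact h (Finset.mem_image.2 ⟨⟨k, i⟩, Finsupp.mem_support_iff.2 (Ne.symm hi), rfl⟩)
  d_π_succ n x := F.ext_comp fun k => by
    rw [comp_bd, comp_proj, comp_proj, comp_bd]
    push_cast
    split_ifs with h1 h2 h2
    · rfl
    · lia
    · lia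
    · rw [map_zero]

theorem aug_proj_zero (x) : F.aug (F.graded.π 0 x) = F.aug x := by
  show F.ε (F.comp 0 (F.proj 0 x)) = F.ε (F.comp 0 x)
  rw [comp_proj]; rfl

theorem exists_graded_d {x} (h : F.graded.d x = 0) (h' : F.aug x = 0) : ∃ y, F.graded.d y = x :=
  (F.exact_bd x).1 (Prod.ext h h')

theorem graded_exactAt {n : ℤ} (hn : 1 ≤ n) : F.graded.ExactAt n := by
  intro x hx
  rw [GradedDiff.mem_Z] at hx
  obtain ⟨y, hy⟩ := F.exists_graded_d hx.2 (by
    rw [← aug_proj_zero, F.graded.π_eq_zero_of_ne hx.1 (by lia), map_zero])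
  exact F.graded.mem_B_of_d hy hx.1

theorem graded_d_proj_zero (x) : F.graded.d (F.graded.π 0 x) = 0 := F.bd_emb_zero _

theorem aug_eq_zero_iff {x} : F.aug x = 0 ↔ F.graded.π 0 x ∈ F.graded.B 0 := by
  rw [← aug_proj_zero]
  constructor
  · intro h
    obtain ⟨y, hy⟩ := F.exists_graded_d (F.graded_d_proj_zero x) h
    exact F.graded.mem_B_of_d hy (F.graded.π_same _ _)
  · intro h
    obtain ⟨y, -, hy⟩ := F.graded.mem_B.1 h
    rw [← hy]
    exact F.aug_bd y

/-- The cokernel of a free resolution. -/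
noncomputable def cokerEquiv : F.graded.coker 0 ≃ₗ[R] M :=
  Submodule.quotEquivOfEq _ _ (by
    ext x
    rw [F.graded.mem_ker_sup_B, LinearMap.mem_ker, aug_eq_zero_iff]) ≪≫ₗ
  F.aug.quotKerEquivOfSurjective F.aug_surjective

theorem isNoethSupp_graded_H {I : Ideal R} (h : IsNoethSupp I M) (n : ℤ) :
    IsNoethSupp I (F.graded.H n) := by
  obtain hn | rfl | hn : n < 0 ∨ n = 0 ∨ 1 ≤ n := by lia
  · have : Subsingleton (F.graded.H n) := F.graded.subsingleton_H_iff.2 fun x hx => by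
      rw [← ((F.graded.mem_Z).1 hx).1]
      show F.proj n x ∈ _
      rw [F.proj_of_neg hn]
      exact zero_mem _
    exact .of_subsingleton
  · refine h.of_injective (f := Submodule.liftQ _ (F.aug ∘ₗ Submodule.subtype _) ?_) ?_
    · intro x hx
      show F.aug x = 0
      have hx' : (x : (Σ n, F.ι n) →₀ R) ∈ F.graded.B 0 := hx
      rwa [aug_eq_zero_iff, F.graded.π_of_mem_B hx']
    · rw [← LinearMap.ker_eq_bot, Submodule.ker_liftQ_eq_bot]
      intro x hx
      have hx' : F.aug x = 0 := hx
      rw [aug_eq_zero_iff, (F.graded.mem_Z.1 x.2).1] at hx'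
      exact hx'
  · have := F.graded.subsingleton_H_iff.2 (F.graded_exactAt hn)
    exact .of_subsingleton

end FreeRes

namespace GradedDiff

variable {A : Type u} [CommRing A] {R : Type u} [CommRing R] [Algebra A R]
variable {W : Type u} [AddCommGroup W] [Module R W] [Module A W] [IsScalarTower A R W]
variable (X : GradedDiff R W) {I : Ideal R}

variable (A) in
theorem isNoethSupp_tensor_self {n : ℤ} (h : IsNoethSupp I (X.H n)) :
    IsNoethSupp I ((X.tensor A A).H n) := by
  have hmor : IsMor (X.tensor A A) X (AlgebraTensorModule.rid A R W).toLinearMap :=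
    { comm_d := fun z => by
        rw [tensor_d]
        induction z with
        | zero => simp
        | add x y hx hy => simp only [map_add, hx, hy]
        | tmul w a =>
          show _ = X.d (a • w)
          rw [X.d.map_smul_of_tower]; rfl
      comm_π := fun n z => by
        rw [tensor_π]
        induction z with
        | zero => simp
        | add x y hx hy => simp only [map_add, hx, hy]
        | tmul w a =>
          show _ = X.π n (a • w)
          rw [(X.π n).map_smul_of_tower]; rfl }
  refine h.of_injective (f := hmor.hmap n) ?_
  rw [← LinearMap.ker_eq_bot, LinearMap.ker_eq_bot']
  intro p hp
  obtain ⟨z, hz, rfl⟩ := cls_surj _ p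
  rw [hmor.hmap_cls, cls_eq_zero] at hp
  rw [cls_eq_zero]
  obtain ⟨u, -, huz⟩ := X.mem_B.1 hp
  refine mem_B_of_d _ (u := (AlgebraTensorModule.rid A R W).symm u) ?_ ((mem_Z _).1 hz).1
  apply (AlgebraTensorModule.rid A R W).injective
  have h1 := hmor.comm_d ((AlgebraTensorModule.rid A R W).symm u)
  simp only [LinearEquiv.coe_coe, LinearEquiv.apply_symm_apply] at h1
  rw [h1, huz]; rfl

theorem isNoethSupp_tensor_pi [Module.Flat A W] (h : ∀ n, IsNoethSupp I (X.H n)) (m : ℕ) (n : ℤ) :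
    IsNoethSupp I ((X.tensor A (Fin m → A)).H n) := by
  induction m with
  | zero =>
    have : Subsingleton ((X.tensor A (Fin 0 → A)).H n) := by
      refine (subsingleton_H_iff _).2 fun x _ => ?_
      rw [Subsingleton.elim x 0]
      exact zero_mem _
    exact .of_subsingleton
  | succ m ih =>
    let g : (Fin (m + 1) → A) →ₗ[A] (Fin m → A) := LinearMap.funLeft A A Fin.succ
    let f : A →ₗ[A] (Fin (m + 1) → A) := LinearMap.single A (fun _ => A) 0
    refine (X.isNoethSupp_tensor_self A (h n)).of_exact ih (X.tensor_exact₂ (f := f) (g := g) ?_ ?_ ?_ n)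
    · exact Pi.single_injective (M := fun _ => A) 0
    · intro v
      constructor
      · intro hv
        refine ⟨v 0, ?_⟩
        ext i
        refine Fin.cases ?_ (fun j => ?_) i
        · simp [f]
        · have : v j.succ = 0 := congrFun hv j
          simp [f, this]
      · rintro ⟨a, rfl⟩
        ext i
        simp [f, g, LinearMap.funLeft_apply]
    · exact LinearMap.funLeft_surjective_of_injective A A _ (Fin.succ_injective m)

theorem isNoethSupp_tensor [IsNoetherianRing A] [Module.Flat A W] (hX : ∀ n < 0, ∀ w, X.π n w = 0)
    (h : ∀ n, IsNoethSupp I (X.H n)) (n : ℤ) (Y : Type u) [AddCommGroup Y] [Module A Y]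
    [Module.Finite A Y] : IsNoethSupp I ((X.tensor A Y).H n) := by
  obtain ⟨k, hk⟩ : ∃ k : ℕ, n < k := ⟨(n + 1).toNat, by lia⟩
  induction k generalizing n Y with
  | zero =>
    have : Subsingleton ((X.tensor A Y).H n) := (subsingleton_H_iff _).2 fun x hx => by
      rw [← ((mem_Z _).1 hx).1, tensor_π, rT_eq_zero (hX n (by simpa using hk))]
      exact zero_mem _
    exact .of_subsingleton
  | succ k ih =>
    obtain ⟨m, g, hg⟩ := Module.Finite.exists_fin' A Y
    obtain ⟨n, rfl⟩ : ∃ n', n = n' + 1 := ⟨n - 1, by ring⟩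
    obtain ⟨δ, hδ, -⟩ := X.exists_tensor_connecting (LinearMap.ker g).subtype_injective
      (LinearMap.exact_subtype_ker_map g) hg n
    exact (X.isNoethSupp_tensor_pi h m (n + 1)).of_exact (ih n _ (by push_cast at hk; lia)) hδ

end GradedDiff

/-! ## Reduction to the residue field -/

open TensorProduct

section CyclicModules

variable {A : Type*} [CommRing A] {I J : Ideal A} {x : A}

/-- The multiplication by `x` between cyclic modules. -/
def mulQuot (x : A) (h : J ≤ Submodule.comap (LinearMap.lsmul A A x) I) : (A ⧸ J) →ₗ[A] A ⧸ I :=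
  Submodule.mapQ J I (LinearMap.lsmul A A x) h

theorem mulQuot_injective (h : J = Submodule.comap (LinearMap.lsmul A A x) I) :
    Function.Injective (mulQuot x h.le) := by
  rw [← LinearMap.ker_eq_bot, LinearMap.ker_eq_bot']
  intro y hy
  obtain ⟨a, rfl⟩ := Submodule.mkQ_surjective J y
  have hy' : Submodule.Quotient.mk (p := I) (x • a) = 0 := hy
  rw [Submodule.Quotient.mk_eq_zero] at hy'
  refine (Submodule.Quotient.mk_eq_zero J).2 ?_
  rw [h]; exact hy'

theorem mulQuot_exact (h : J ≤ Submodule.comap (LinearMap.lsmul A A x) I) :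
    Function.Exact (mulQuot x h)
      (Submodule.factor (le_sup_left : I ≤ I ⊔ Ideal.span {x})) := by
  intro y
  obtain ⟨a, rfl⟩ := Submodule.mkQ_surjective I y
  have h1 : Submodule.factor (le_sup_left : I ≤ I ⊔ Ideal.span {x}) (Submodule.mkQ I a) = 0 ↔
    a ∈ I ⊔ Ideal.span {x} := Submodule.Quotient.mk_eq_zero _
  rw [h1]
  constructor
  · intro ha
    obtain ⟨i, hi, b, hb, rfl⟩ := Submodule.mem_sup.1 ha
    obtain ⟨c, rfl⟩ := Ideal.mem_span_singleton.1 hb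
    refine ⟨Submodule.Quotient.mk c, ?_⟩
    refine (Submodule.Quotient.eq I).2 ?_
    show x • c - _ ∈ I
    simpa using hi
  · rintro ⟨z, hz⟩
    obtain ⟨c, rfl⟩ := Submodule.mkQ_surjective J z
    have h2 : x • c - a ∈ I := (Submodule.Quotient.eq I).1 hz
    rw [← sub_sub_cancel (x • c) a]
    exact sub_mem (Submodule.mem_sup_right (Ideal.mem_span_singleton.2 (dvd_mul_right x c)))
      (Submodule.mem_sup_left h2)

end CyclicModules

theorem GradedDiff.exactAt_tensor_quotient {A : Type u} [CommRing A] [IsLocalRing A]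
    [IsNoetherianRing A] {R : Type u} [CommRing R] [Algebra A R]
    {W : Type u} [AddCommGroup W] [Module R W] [Module A W] [IsScalarTower A R W]
    [Module.Flat A W] (X : GradedDiff R W) {B : Type*} [CommRing B] [IsLocalRing B] {φ : R →+* B}
    (hφ : Function.Surjective φ)
    (hloc : ∀ x ∈ maximalIdeal A, φ (algebraMap A R x) ∈ maximalIdeal B) {n : ℤ}
    (hN : ∀ I : Ideal A, IsNoethSupp (RingHom.ker φ) ((X.tensor A (A ⧸ I)).H n))
    (hk : (X.tensor A (A ⧸ maximalIdeal A)).ExactAt n) (I : Ideal A) :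
    (X.tensor A (A ⧸ I)).ExactAt n := by
  induction I using IsNoetherian.induction with
  | hgt I ih =>
  by_cases htop : I = ⊤
  · subst htop
    intro z _
    have : Subsingleton (A ⧸ (⊤ : Ideal A)) := Ideal.Quotient.subsingleton_iff.2 rfl
    rw [Subsingleton.elim z 0]
    exact zero_mem _
  by_cases hm : I = maximalIdeal A
  · rw [hm]; exact hk
  obtain ⟨x, hx, hxI⟩ := Set.exists_of_ssubset (SetLike.coe_ssubset_coe.2 (lt_of_le_of_ne (le_maximalIdeal htop) hm))
  have hlt : I < I ⊔ Ideal.span {x} := lt_of_le_of_ne le_sup_left fun h => hxI (by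
    rw [h]; exact Submodule.mem_sup_right (Ideal.mem_span_singleton_self x))
  have hle : I ≤ Submodule.comap (LinearMap.lsmul A A x) I := fun a ha => Ideal.mul_mem_left I x ha
  obtain h | h := hle.eq_or_lt
  · rw [← subsingleton_H_iff]
    refine (hN I).subsingleton_of_smul hφ (hloc x hx) fun p => ?_
    have hex := X.tensor_exact₂ (mulQuot_injective h) (mulQuot_exact hle)
      (Submodule.factor_surjective _) n
    have := (subsingleton_H_iff _).2 (ih _ hlt)
    obtain ⟨p', rfl⟩ := (hex p).1 (Subsingleton.elim _ _)
    obtain ⟨z, hz, rfl⟩ := cls_surj _ p'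
    refine ⟨cls _ z hz, ?_⟩
    rw [smul_cls, IsMor.hmap_cls, cls_eq_cls]
    have key : ∀ z : W ⊗[A] (A ⧸ I), algebraMap A R x • z =
        AlgebraTensorModule.lTensor R W (mulQuot x h.le) z := by
      intro z
      induction z with
      | zero => simp
      | add y z hy hz => rw [smul_add, map_add, hy, hz]
      | tmul w a =>
        obtain ⟨a, rfl⟩ := Submodule.mkQ_surjective I a
        rw [algebraMap_smul, ← TensorProduct.tmul_smul]
        rfl
    rw [key z, sub_self]
    exact zero_mem _
  · rw [← X.hl_eq_zero_iff]
    have h1 := X.hl_le_add_middle (mulQuot_injective (x := x) (I := I) rfl) (mulQuot_exact le_rfl)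
      (Submodule.factor_surjective _) n
    rw [X.hl_eq_zero_iff.2 (ih _ h), X.hl_eq_zero_iff.2 (ih _ hlt), add_zero] at h1
    exact le_antisymm h1 zero_le

/-! ## Convolution of growth sequences -/

theorem eventually_eq_zero_of_growth {β t w : ℕ → ℕ∞} {n₁ a d P D : ℕ} (hP : 1 ≤ P)
    (hsum : ∀ (n : ℕ) (S : Finset ℕ), (∀ j ∈ S, j ≤ n) → ∑ j ∈ S, β (n - j) * t j ≤ w n)
    (hβ : ∀ s : ℕ, ((s.choose d : ℕ) : ℕ∞) ≤ β (a + s * P))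
    (hw : ∀ n ≥ n₁, w n ≤ ((D * (n + 1) ^ d : ℕ) : ℕ∞)) : ∃ m, ∀ j ≥ m, t j = 0 := by
  by_contra! hcon
  have hinf : {j | t j ≠ 0}.Infinite := Set.infinite_of_forall_exists_gt fun m => by
    obtain ⟨j, hj, hj'⟩ := hcon (m + 1)
    exact ⟨j, hj', hj⟩
  obtain ⟨ρ, hρ⟩ : ∃ ρ : Fin P, {j | t j ≠ 0 ∧ j % P = ρ}.Infinite := by
    by_contra! hfin
    refine hinf ((Set.finite_iUnion hfin).subset fun j hj => ?_)
    exact Set.mem_iUnion.2 ⟨⟨j % P, Nat.mod_lt _ hP⟩, hj, rfl⟩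
  obtain ⟨S, hS, hcard⟩ := hρ.exists_subset_card_eq (d.factorial * D * (1 + P) ^ d + 1)
  obtain ⟨J, hJ, hJS⟩ : ∃ J, J % P = ρ ∧ ∀ j ∈ S, j ≤ J := by
    obtain ⟨J, hJ, hJ'⟩ := hρ.exists_gt (S.sup id)
    exact ⟨J, hJ.2, fun j hj => (Finset.le_sup (f := id) hj).trans hJ'.le⟩
  set e := J + a + d * P + n₁ with he
  set n := J + a + (d + e) * P with hn
  have hnn : n₁ ≤ n := by nlinarith
  have h1 : ∀ j ∈ S, (((d + e).choose d : ℕ) : ℕ∞) ≤ β (n - j) * t j := by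
    intro j hj
    obtain ⟨hj0, hjρ⟩ := hS hj
    have hjJ := hJS j hj
    obtain ⟨c, hc⟩ : P ∣ J - j := (Nat.modEq_iff_dvd' hjJ).1 (hjρ.trans hJ.symm)
    have hnj : n - j = a + (d + e + c) * P := by
      have : J = j + P * c := by lia
      rw [hn, this]
      have : j + P * c + a + (d + e) * P = a + (d + e + c) * P + j := by ring
      rw [this, Nat.add_sub_cancel]
    rw [hnj]
    calc (((d + e).choose d : ℕ) : ℕ∞) ≤ ((d + e + c).choose d : ℕ) := by
          exact_mod_cast Nat.choose_le_choose d (by lia)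
      _ ≤ β (a + (d + e + c) * P) * 1 := by rw [mul_one]; exact hβ _
      _ ≤ _ := by gcongr; exact Order.one_le_iff_ne_zero.2 hj0
  have h2 : S.card * (d + e).choose d ≤ D * (n + 1) ^ d := by
    have := (Finset.sum_le_sum h1).trans ((hsum n S fun j hj => (hJS j hj).trans (by lia)).trans
      (hw n hnn))
    rw [Finset.sum_const, nsmul_eq_mul] at this
    exact_mod_cast this
  have h3 : (e + 1) ^ d ≤ (d + e).choose d * d.factorial := by
    rw [mul_comm, ← Nat.descFactorial_eq_factorial_mul_choose]
    refine le_trans (le_of_eq ?_) (Nat.pow_sub_le_descFactorial (d + e) d)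
    congr 1; lia
  have h4 : n + 1 ≤ (e + 1) * (1 + P) := by rw [hn]; nlinarith
  have h5 : S.card * (e + 1) ^ d ≤ d.factorial * D * (1 + P) ^ d * (e + 1) ^ d := by
    calc S.card * (e + 1) ^ d ≤ S.card * ((d + e).choose d * d.factorial) := by gcongr
      _ = S.card * (d + e).choose d * d.factorial := by ring
      _ ≤ D * (n + 1) ^ d * d.factorial := by gcongr
      _ ≤ D * ((e + 1) * (1 + P)) ^ d * d.factorial := by gcongr
      _ = _ := by rw [mul_pow]; ring
  have h6 := Nat.le_of_mul_le_mul_right h5 (by positivity)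
  lia

/-! ## The growth dichotomy and test modules -/

open TensorProduct

/-- Every complex that is bounded to the right and has finite homology with coefficients in the
residue field either has bounded homology with coefficients in the residue field, or the
sequence `β` grows at least as fast as the lengths of these homology modules. -/
def GrowthDichotomy (A : Type u) [CommRing A] [IsLocalRing A] (β : ℕ → ℕ) : Prop :=
  ∀ (R W : Type u) [CommRing R] [Algebra A R] [AddCommGroup W] [Module R W] [Module A W]
    [IsScalarTower A R W] [Module.Flat A W] (X : GradedDiff R W) (n₁ : ℤ),
    (∀ n ≥ n₁, X.ExactAt n) → (∀ n, X.hl A (A ⧸ maximalIdeal A) n ≠ ⊤) →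
    (∃ n₂, ∀ n ≥ n₂, X.hl A (A ⧸ maximalIdeal A) n = 0) ∨
      ∃ n₂ a d P D : ℕ, 1 ≤ P ∧ (∀ s, s.choose d ≤ β (a + s * P)) ∧
        ∀ n : ℕ, n₂ ≤ n → X.hl A (A ⧸ maximalIdeal A) n ≤ ((D * (n + 1) ^ d : ℕ) : ℕ∞)

/-- Eventual vanishing on the residue field for a complex with controlled homology. -/
theorem GrowthDichotomy.eventually_eq_zero {A : Type u} [CommRing A] [IsLocalRing A]
    {M : Type u} [AddCommGroup M] [Module A M] {F : FreeRes A M}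
    (hG : GrowthDichotomy A fun n => Nat.card (F.ι n)) (hfin : ∀ n, Finite (F.ι n))
    (hmin : ∀ n x i, F.g n x i ∈ maximalIdeal A) (hne : Nonempty (Σ n, F.ι n))
    {R W : Type u} [CommRing R] [Algebra A R] [AddCommGroup W] [Module R W] [Module A W]
    [IsScalarTower A R W] [Module.Flat A W] (X : GradedDiff R W)
    (hX : ∀ n < 0, ∀ w, X.π n w = 0) (hlen : ∀ n, X.hl A (A ⧸ maximalIdeal A) n ≠ ⊤)
    {m : ℤ} (hM : ∀ n ≥ m, (X.tensor A M).ExactAt n) :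
    ∃ n₂ : ℕ, ∀ n : ℕ, n₂ ≤ n → X.hl A (A ⧸ maximalIdeal A) n = 0 := by
  have hmin' : ∀ b b' (y : A ⧸ maximalIdeal A), F.based.bd (Finsupp.single b 1) b' • y = 0 := by
    intro b b' y
    obtain ⟨a, rfl⟩ := Ideal.Quotient.mk_surjective y
    rw [Algebra.smul_def, Ideal.Quotient.algebraMap_eq,
      Ideal.Quotient.eq_zero_iff_mem.2 (F.based_bd_single_mem hmin b b'), zero_mul]
  have := GradedDiff.flat_finsupp A (Σ n, F.ι n) W
  have hsum := F.based.sum_length_le_length_tot X (A ⧸ maximalIdeal A) hmin'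
  obtain ⟨n₂, h⟩ | ⟨n₂, a, d, P, D, hP, hβ, hw⟩ := hG R _ (F.based.tot X) m
    (fun n hn => F.based.tot_exactAt X F.aug F.exact_bd hX F.aug_bd F.aug_single F.aug_surjective
      (hM n hn))
    (F.based.length_tot_ne_top X _ hmin' (F.finite_deg hfin) hX hlen)
  · obtain ⟨b⟩ := hne
    refine ⟨n₂.toNat, fun n hn => ?_⟩
    have h1 := hsum (n + F.based.deg b) {b}
    rw [Finset.sum_singleton, add_sub_cancel_right] at h1
    exact le_antisymm (h1.trans (h _ (by lia)).le) zero_le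
  · have := fun n => Fintype.ofFinite (F.ι n)
    refine eventually_eq_zero_of_growth (β := fun n => (Nat.card (F.ι n) : ℕ∞))
      (t := fun n => X.hl A (A ⧸ maximalIdeal A) n)
      (w := fun n => (F.based.tot X).hl A (A ⧸ maximalIdeal A) n) hP (fun n S hS => ?_)
      (fun s => by exact_mod_cast hβ s) hw
    refine le_trans (le_of_eq ?_) (hsum n ((S.image fun j => n - j).sigma fun i => Finset.univ))
    rw [Finset.sum_sigma, Finset.sum_image fun j hj j' hj' h => by
      have := hS j hj
      have := hS j' hj'
      have h' : n - j = n - j' := h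
      lia]
    refine Finset.sum_congr rfl fun j hj => ?_
    have hc : ((n : ℤ) - (n - j : ℕ)) = j := by have := hS j hj; lia
    have hd : ∀ x : F.ι (n - j), F.based.deg ⟨n - j, x⟩ = n - j := fun _ => rfl
    have hs : ∀ x ∈ (Finset.univ : Finset (F.ι (n - j))), Module.length R
        ((X.tensor A (A ⧸ maximalIdeal A)).H ((n : ℤ) - F.based.deg ⟨n - j, x⟩)) =
        X.hl A (A ⧸ maximalIdeal A) j := fun x _ => by
      rw [hd, hc]; rfl
    rw [Finset.sum_congr rfl hs, Finset.sum_const, Finset.card_univ, nsmul_eq_mul,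
      Nat.card_eq_fintype_card]

theorem torVanish_of_subsingleton {A : Type u} [CommRing A] {M : Type u} [AddCommGroup M]
    [Module A M] [Subsingleton M] (N : Type u) [AddCommGroup N] [Module A N]
    (n : ℕ) : TorVanish A (n + 1) M N := by
  obtain ⟨G⟩ := FreeRes.exists_freeRes A N
  rw [G.graded.torVanish_iff_exactAt A M (fun n hn => G.graded_exactAt hn) G.cokerEquiv n]
  intro z _
  rw [Subsingleton.elim z 0]
  exact zero_mem _

section

variable {A : Type u} [CommRing A] [IsLocalRing A] [IsNoetherianRing A]
  {M : Type u} [AddCommGroup M] [Module A M]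

theorem IsCapitalTestModule.isTestModule [Module.Finite A M] (hM : IsCapitalTestModule A M)
    (hG : ∀ F : FreeRes A M, (∀ n, Finite (F.ι n)) →
      GrowthDichotomy A fun n => Nat.card (F.ι n)) : IsTestModule A M := by
  intro B _ _ _ _ hAB N _ _ _ _ hN ⟨i₀, hi₀⟩
  let R := MvPolynomial B A
  let φ : R →ₐ[A] B := MvPolynomial.aeval id
  have hφ : Function.Surjective φ := fun b => ⟨MvPolynomial.X b, MvPolynomial.aeval_X id b⟩
  let _ : Module R N := Module.compHom N φ.toRingHom
  have hsmul : ∀ (r : R) (x : N), r • x = φ r • x := fun _ _ => rfl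
  have : IsScalarTower A R N := ⟨fun a r x => by
    rw [hsmul, hsmul, map_smul, smul_assoc]⟩
  have hN' : IsNoethSupp (RingHom.ker φ.toRingHom) N := by
    constructor
    · have hNB : IsNoetherian B N := inferInstance
      rw [isNoetherian_iff'] at hNB ⊢
      refine OrderEmbedding.wellFoundedGT (β := Submodule B N)
        ⟨⟨fun p => { p with smul_mem' := fun b x hx => ?_ }, ?_⟩, ?_⟩
      · obtain ⟨r, rfl⟩ := hφ b
        exact p.smul_mem r hx
      · intro p q h
        exact SetLike.coe_injective (congrArg (fun s : Submodule B N => (s : Set N)) h)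
      · rfl
    · refine fun r hr => Ideal.le_radical (Module.mem_annihilator.2 fun x => ?_)
      have hr' : φ r = 0 := hr
      rw [hsmul, hr', zero_smul]
  obtain ⟨G⟩ := FreeRes.exists_freeRes R N
  have hproj : Module.Projective A ((Σ n, G.ι n) →₀ R) := inferInstance
  have hneg : ∀ n < 0, ∀ w, G.graded.π n w = 0 := fun n hn w => G.proj_of_neg hn w
  have hex : ∀ n ≥ 1, G.graded.ExactAt n := fun n hn => G.graded_exactAt hn
  have hnoeth : ∀ (n : ℤ) (Y : Type u) [AddCommGroup Y] [Module A Y] [Module.Finite A Y],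
      IsNoethSupp (RingHom.ker φ.toRingHom) ((G.graded.tensor A Y).H n) := fun n Y _ _ _ =>
    G.graded.isNoethSupp_tensor hneg (G.isNoethSupp_graded_H hN') n Y
  have hloc : ∀ x ∈ maximalIdeal A, φ.toRingHom (algebraMap A R x) ∈ maximalIdeal B := by
    intro x hx
    have : φ.toRingHom (algebraMap A R x) = algebraMap A B x := φ.commutes x
    rw [this]
    exact ((IsLocalRing.local_hom_TFAE (algebraMap A B)).out 0 2 :
      IsLocalHom (algebraMap A B) ↔ (maximalIdeal A).map (algebraMap A B) ≤ maximalIdeal B).1 hAB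
        (Ideal.mem_map_of_mem _ hx)
  have hMex : ∀ n ≥ (i₀ : ℤ) + 1, (G.graded.tensor A M).ExactAt n := by
    intro n hn
    obtain ⟨k, rfl⟩ : ∃ k : ℕ, n = k + 1 := ⟨(n - 1).toNat, by lia⟩
    exact (G.graded.torVanish_iff_exactAt A M hex (G.cokerEquiv.restrictScalars A) k).1
      (hi₀ _ (by lia))
  obtain ⟨n₂, hn₂⟩ : ∃ n₂ : ℕ, ∀ n : ℕ, n₂ ≤ n →
      (G.graded.tensor A (A ⧸ maximalIdeal A)).ExactAt n := by
    obtain ⟨F, hfin, hmin⟩ := FreeRes.exists_minimal (A := A) M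
    obtain hne | hne := isEmpty_or_nonempty (Σ n, F.ι n)
    · have : Subsingleton M := F.aug_surjective.subsingleton
      obtain ⟨j, hj⟩ := hM (A ⧸ maximalIdeal A) inferInstance ⟨1, fun i hi => by
        obtain ⟨i, rfl⟩ := Nat.exists_eq_add_of_le' hi
        exact torVanish_of_subsingleton _ i⟩
      exact ⟨1 + j, fun n hn => G.graded.hl_eq_zero_iff.1
        (G.graded.hl_eq_zero_of_flatDimLE hex j _ hj n (by lia))⟩
    · obtain ⟨S, hS⟩ := (maximalIdeal B).fg_of_isNoetherianRing
      obtain ⟨σ, hσ⟩ := hφ.hasRightInverse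
      obtain ⟨W', _, _, _, _, _, C, hCneg, hC⟩ := GradedDiff.exists_koszul (A := A)
        (φ := φ.toRingHom) hφ (S.toList.map σ) (fun x hx => by
          obtain ⟨s, hs, rfl⟩ := List.mem_map.1 hx
          have : φ.toRingHom (σ s) = s := hσ s
          rw [this, ← hS]
          exact Ideal.subset_span (Finset.mem_toList.1 hs)) G.graded hneg
      have hmax : Ideal.span {x | x ∈ S.toList.map σ} ⊔ RingHom.ker φ.toRingHom =
          (maximalIdeal B).comap φ.toRingHom := by
        rw [← Ideal.comap_map_of_surjective' φ.toRingHom hφ, Ideal.map_span, ← hS]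
        congr 2
        ext x
        simp only [List.mem_map, Finset.mem_toList, Set.mem_image, Set.mem_ofPred_eq,
          Finset.mem_coe]
        constructor
        · rintro ⟨_, ⟨s, hs, rfl⟩, rfl⟩
          have : φ.toRingHom (σ s) = s := hσ s
          rwa [this]
        · exact fun hx => ⟨_, ⟨x, hx, rfl⟩, hσ x⟩
      have hmax' : (Ideal.span {x | x ∈ S.toList.map σ} ⊔ RingHom.ker φ.toRingHom).IsMaximal := by
        rw [hmax]
        exact Ideal.comap_isMaximal_of_surjective _ hφ
      obtain ⟨hk1, hk2⟩ := (hC (A ⧸ maximalIdeal A)).2 fun n => hnoeth n _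
      obtain ⟨n₂, hn₂⟩ := (hG F hfin).eventually_eq_zero hfin hmin hne C hCneg
        (fun n => (hk1 n).isFiniteLength) ((hC M).1 _ hMex)
      exact ⟨n₂, fun n hn => hk2 n (C.hl_eq_zero_iff.1 (hn₂ n hn))⟩
  have hq := fun I => G.graded.exactAt_tensor_quotient hφ hloc (fun J => hnoeth (n₂ + 1 : ℕ) (A ⧸ J))
    (hn₂ (n₂ + 1) (by lia)) I
  refine ⟨n₂, FlatDimLE.of_linearEquiv (G.cokerEquiv.restrictScalars A)
    (G.graded.flatDimLE_coker n₂ 0 (fun n hn => hex n (by lia)) fun I => ?_)⟩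
  rw [zero_add]
  exact_mod_cast hq I

theorem IsTestModule.isCapitalTestModule (h : IsTestModule A M) : IsCapitalTestModule A M :=
  fun N _ _ hN hT => h A ⟨fun _ h => h⟩ N hN hT

end

/-! ## Graded modules over a polynomial ring whose variables lower degrees by two -/

/-- A grading of a module over a polynomial ring, such that each variable lowers degrees by `2`. -/
structure GrMod (σ : Type) (A V : Type u) [CommRing A] [AddCommGroup V] [Module A V]
    [Module (MvPolynomial σ A) V] [IsScalarTower A (MvPolynomial σ A) V] where
  /-- The projection on the component of degree `n`. -/
  p : ℤ → V →ₗ[A] V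
  p_same : ∀ n v, p n (p n v) = p n v
  p_ne : ∀ m n v, m ≠ n → p m (p n v) = 0
  X_smul : ∀ (i : σ) n v, (MvPolynomial.X i : MvPolynomial σ A) • p (n + 2) v =
    p n ((MvPolynomial.X i : MvPolynomial σ A) • v)

namespace GrMod

variable {σ : Type} {A V : Type u} [CommRing A] [AddCommGroup V] [Module A V]
  [Module (MvPolynomial σ A) V] [IsScalarTower A (MvPolynomial σ A) V] (G : GrMod σ A V)

theorem mul_smul_p {q q' : MvPolynomial σ A} {r r' : ℕ}
    (h : ∀ n v, q • G.p (n + 2 * r) v = G.p n (q • v))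
    (h' : ∀ n v, q' • G.p (n + 2 * r') v = G.p n (q' • v)) (n : ℤ) (v : V) :
    (q * q') • G.p (n + 2 * (r + r' : ℕ)) v = G.p n ((q * q') • v) := by
  rw [mul_smul, mul_smul, ← h, ← h']
  push_cast
  ring_nf

theorem monomial_smul_p (s : σ →₀ ℕ) (a : A) (n : ℤ) (v : V) :
    MvPolynomial.monomial s a • G.p (n + 2 * s.degree) v =
      G.p n (MvPolynomial.monomial s a • v) := by
  have hC : ∀ (a : A) (v : V), (MvPolynomial.C a : MvPolynomial σ A) • v = a • v := fun a v => by
    rw [← MvPolynomial.algebraMap_eq, algebraMap_smul]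
  have hpow : ∀ (i : σ) (k : ℕ) (n : ℤ) (v : V),
      (MvPolynomial.X i ^ k : MvPolynomial σ A) • G.p (n + 2 * k) v =
        G.p n ((MvPolynomial.X i ^ k : MvPolynomial σ A) • v) := by
    intro i k
    induction k with
    | zero => simp
    | succ k ih =>
      rw [pow_succ]
      exact G.mul_smul_p ih (r' := 1) (by simpa using G.X_smul i)
  have hone : ∀ (n : ℤ) (v : V), MvPolynomial.monomial s (1 : A) • G.p (n + 2 * s.degree) v =
      G.p n (MvPolynomial.monomial s (1 : A) • v) := by
    induction s using Finsupp.induction_linear with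
    | zero => simp
    | add s t hs ht =>
      rw [← mul_one (1 : A), ← MvPolynomial.monomial_mul, map_add]
      exact G.mul_smul_p hs ht
    | single i k =>
      rw [← MvPolynomial.X_pow_eq_monomial, Finsupp.degree_single]
      exact hpow i k
  rw [← mul_one a, ← MvPolynomial.C_mul_monomial, mul_smul, mul_smul, hC, hC, hone, (G.p n).map_smul]

theorem smul_p {q : MvPolynomial σ A} {r : ℕ} (hq : q.IsHomogeneous r) (n : ℤ) (v : V) :
    q • G.p (n + 2 * r) v = G.p n (q • v) := by
  conv_lhs => rw [q.as_sum]
  conv_rhs => rw [q.as_sum]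
  rw [Finset.sum_smul, Finset.sum_smul, map_sum]
  refine Finset.sum_congr rfl fun s hs => ?_
  have hr : s.degree = r := by
    rw [← hq (MvPolynomial.mem_support_iff.1 hs), Finsupp.degree_eq_weight_one]
    rfl
  rw [← G.monomial_smul_p, hr]

/-- A submodule is graded if it contains the components of its elements. -/
def IsGr (U : Submodule (MvPolynomial σ A) V) : Prop := ∀ n, ∀ u ∈ U, G.p n u ∈ U

variable {G}

theorem IsGr.map_smul {U : Submodule (MvPolynomial σ A) V} (h : G.IsGr U)
    {q : MvPolynomial σ A} {r : ℕ} (hq : q.IsHomogeneous r) :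
    G.IsGr (U.map (LinearMap.lsmul _ V q)) := by
  rintro n _ ⟨u, hu, rfl⟩
  exact ⟨G.p (n + 2 * r) u, h _ u hu, by simpa using G.smul_p hq n u⟩

theorem smul_p_eq_zero {q : MvPolynomial σ A} {r : ℕ} (hq : q.IsHomogeneous r) (n : ℤ) {u : V}
    (hu : q • u = 0) : q • G.p n u = 0 := by
  have := G.smul_p hq (n - 2 * r) u
  rwa [hu, map_zero, sub_add_cancel] at this

theorem IsGr.inf_ker {U : Submodule (MvPolynomial σ A) V} (h : G.IsGr U)
    {q : MvPolynomial σ A} {r : ℕ} (hq : q.IsHomogeneous r) :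
    G.IsGr (U ⊓ LinearMap.ker (LinearMap.lsmul _ V q)) := by
  rintro n u ⟨hu, hu'⟩
  exact ⟨h n u hu, smul_p_eq_zero hq n hu'⟩

end GrMod

section Artinian

variable {S V : Type u} [CommRing S] [AddCommGroup V] [Module S V]

theorem isArtinian_induction (P : Submodule S V → Prop) (U₀ : Submodule S V) [IsArtinian S U₀]
    (h : ∀ U ≤ U₀, (∀ U' < U, P U') → P U) {U : Submodule S V} (hU : U ≤ U₀) : P U := by
  have key : ∀ N : Submodule S U₀, P (N.map U₀.subtype) := by
    intro N
    induction N using WellFoundedLT.induction with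
    | ind N ih =>
      refine h _ (Submodule.map_subtype_le _ _) fun U' hU' => ?_
      have hle : U' ≤ U₀ := hU'.le.trans (Submodule.map_subtype_le _ _)
      have heq : (U'.comap U₀.subtype).map U₀.subtype = U' := by
        rw [Submodule.map_comap_subtype, inf_eq_right.2 hle]
      rw [← heq]
      refine ih _ (lt_of_le_of_ne ?_ ?_)
      · rw [← Submodule.comap_map_eq_of_injective U₀.injective_subtype N]
        exact Submodule.comap_mono hU'.le
      · rintro rfl
        exact hU'.ne heq.symm
  have := key (U.comap U₀.subtype)
  rwa [Submodule.map_comap_subtype, inf_eq_right.2 hU] at this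

theorem exists_forall_eq_of_antitone {U : Submodule S V} [IsArtinian S U] {N : ℕ → Submodule S V}
    (hN : Antitone N) (hU : ∀ k, N k ≤ U) : ∃ m, ∀ k, m ≤ k → N m = N k := by
  obtain ⟨m, hm⟩ := IsArtinian.monotone_stabilizes (R := S) (M := U)
    ⟨fun k => OrderDual.toDual ((N k).comap U.subtype),
      fun i j hij => Submodule.comap_mono (hN hij)⟩
  refine ⟨m, fun k hk => ?_⟩
  have := congrArg (Submodule.map U.subtype) (show (N m).comap U.subtype = (N k).comap U.subtype
    from hm k hk)
  rwa [Submodule.map_comap_subtype, Submodule.map_comap_subtype, inf_eq_right.2 (hU _),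
    inf_eq_right.2 (hU _)] at this

/-- The element `q` maps `Y` onto `Y`. -/
def IsOnto (q : S) (Y : Submodule S V) : Prop := ∀ y ∈ Y, ∃ z ∈ Y, q • z = y

/-- The element `q` is nilpotent on `Y`. -/
def IsNil (q : S) (Y : Submodule S V) : Prop := ∃ k : ℕ, ∀ y ∈ Y, q ^ k • y = 0

theorem IsOnto.mul {q q' : S} {Y : Submodule S V} (h : IsOnto q Y) (h' : IsOnto q' Y) :
    IsOnto (q * q') Y := by
  intro y hy
  obtain ⟨a, ha, rfl⟩ := h y hy
  obtain ⟨b, hb, rfl⟩ := h' a ha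
  exact ⟨b, hb, mul_smul _ _ _⟩

theorem IsOnto.one (Y : Submodule S V) : IsOnto (1 : S) Y := fun y hy => ⟨y, hy, one_smul _ _⟩

theorem IsOnto.pow {q : S} {Y : Submodule S V} (h : IsOnto q Y) (k : ℕ) : IsOnto (q ^ k) Y := by
  induction k with
  | zero => simpa using IsOnto.one Y
  | succ k ih => rw [pow_succ]; exact ih.mul h

theorem IsOnto.prod {ι : Type*} {s : Finset ι} {f : ι → S} {Y : Submodule S V}
    (h : ∀ i ∈ s, IsOnto (f i) Y) : IsOnto (∏ i ∈ s, f i) Y :=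
  Finset.prod_induction f (fun q => IsOnto q Y) (fun _ _ => IsOnto.mul) (IsOnto.one Y) h

theorem IsNil.mul_left {q : S} {Y : Submodule S V} (h : IsNil q Y) (q' : S) :
    IsNil (q' * q) Y := by
  obtain ⟨k, hk⟩ := h
  exact ⟨k, fun y hy => by rw [mul_pow, mul_smul, hk y hy, smul_zero]⟩

theorem IsNil.pow {q : S} {Y : Submodule S V} (h : IsNil q Y) {k : ℕ} (hk : 1 ≤ k) :
    IsNil (q ^ k) Y := by
  obtain ⟨k, rfl⟩ := Nat.exists_eq_add_of_le' hk
  rw [pow_succ]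
  exact h.mul_left _

theorem IsNil.prod {ι : Type*} {s : Finset ι} {f : ι → S} {Y : Submodule S V} {i : ι}
    (hi : i ∈ s) (h : IsNil (f i) Y) : IsNil (∏ i ∈ s, f i) Y := by
  classical
  rw [← Finset.prod_erase_mul s f hi]
  exact h.mul_left _

theorem IsOnto.add_isNil {q q' : S} {Y : Submodule S V} (h : IsOnto q Y) (h' : IsNil q' Y) :
    IsOnto (q + q') Y := by
  obtain ⟨k, hk⟩ := h'
  have key : ∀ j : ℕ, ∀ y ∈ Y, ∃ a ∈ Y, ∃ b ∈ Y, y = (q + q') • a + q' ^ j • b := by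
    intro j
    induction j with
    | zero => exact fun y hy => ⟨0, Y.zero_mem, y, hy, by simp⟩
    | succ j ih =>
      intro y hy
      obtain ⟨a, ha, b, hb, rfl⟩ := ih y hy
      obtain ⟨c, hc, rfl⟩ := h b hb
      refine ⟨a + q' ^ j • c, Y.add_mem ha (Y.smul_mem _ hc), -c, Y.neg_mem hc, ?_⟩
      module
  intro y hy
  obtain ⟨a, ha, b, hb, rfl⟩ := key k y hy
  exact ⟨a, ha, by rw [hk b hb, add_zero]⟩

end Artinian

namespace GrMod

variable {σ : Type} {A V : Type u} [CommRing A] [AddCommGroup V] [Module A V]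
  [Module (MvPolynomial σ A) V] [IsScalarTower A (MvPolynomial σ A) V] {G : GrMod σ A V}

/-- All components of `Y` of large degree vanish. -/
def IsBdd (G : GrMod σ A V) (Y : Submodule (MvPolynomial σ A) V) : Prop :=
  ∃ n₀ : ℤ, ∀ n ≥ n₀, ∀ y ∈ Y, G.p n y = 0

theorem IsBdd.sup {Y Y' : Submodule (MvPolynomial σ A) V} (h : G.IsBdd Y) (h' : G.IsBdd Y') :
    G.IsBdd (Y ⊔ Y') := by
  obtain ⟨m, hm⟩ := h
  obtain ⟨m', hm'⟩ := h'
  refine ⟨max m m', fun n hn y hy => ?_⟩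
  obtain ⟨a, ha, b, hb, rfl⟩ := Submodule.mem_sup.1 hy
  rw [map_add, hm n (le_of_max_le_left hn) a ha, hm' n (le_of_max_le_right hn) b hb, add_zero]

theorem smul_eq_constantCoeff_smul {y : V}
    (hy : ∀ j : σ, (MvPolynomial.X j : MvPolynomial σ A) • y = 0) (q : MvPolynomial σ A) :
    q • y = MvPolynomial.constantCoeff q • y := by
  induction q using MvPolynomial.induction_on with
  | C a => rw [MvPolynomial.constantCoeff_C, ← MvPolynomial.algebraMap_eq, algebraMap_smul]
  | add q q' h h' => rw [add_smul, h, h', map_add, add_smul]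
  | mul_X q j h => rw [mul_smul, hy, smul_zero, map_mul, MvPolynomial.constantCoeff_X, mul_zero,
      zero_smul]

/-- The socle elements of an Artinian graded module have bounded degree. -/
theorem isBdd_socle {Y : Submodule (MvPolynomial σ A) V} [IsArtinian (MvPolynomial σ A) Y]
    (hY : G.IsGr Y) : ∃ n₀ : ℤ, ∀ n ≥ n₀, ∀ y ∈ Y,
      (∀ j : σ, (MvPolynomial.X j : MvPolynomial σ A) • y = 0) → G.p n y = 0 := by
  let N : ℕ → Submodule (MvPolynomial σ A) V := fun t =>
    { carrier := {y | y ∈ Y ∧ (∀ j : σ, (MvPolynomial.X j : MvPolynomial σ A) • y = 0) ∧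
        ∀ n : ℕ, n < t → G.p n y = 0}
      add_mem' := by
        rintro a b ⟨h1, h2, h3⟩ ⟨h1', h2', h3'⟩
        refine ⟨Y.add_mem h1 h1', fun j => by rw [smul_add, h2, h2', add_zero], fun n hn => ?_⟩
        rw [map_add, h3 n hn, h3' n hn, add_zero]
      zero_mem' := ⟨Y.zero_mem, fun _ => smul_zero _, fun n _ => map_zero (G.p n)⟩
      smul_mem' := by
        rintro q a ⟨h1, h2, h3⟩
        refine ⟨Y.smul_mem q h1, fun j => by rw [smul_comm, h2, smul_zero], fun n hn => ?_⟩
        rw [smul_eq_constantCoeff_smul h2, map_smul, h3 n hn, smul_zero] }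
  obtain ⟨m, hm⟩ := exists_forall_eq_of_antitone (U := Y) (N := N)
    (fun i j hij y hy => ⟨hy.1, hy.2.1, fun n hn => hy.2.2 n (hn.trans_le hij)⟩)
    (fun k y hy => hy.1)
  refine ⟨m, fun n hn y hy h0 => ?_⟩
  obtain ⟨k, rfl⟩ : ∃ k : ℕ, n = k := ⟨n.toNat, by omega⟩
  have hmem : G.p k y ∈ N m := by
    refine ⟨hY _ y hy, fun j => smul_p_eq_zero (MvPolynomial.isHomogeneous_X A j) _ (h0 j),
      fun n hn' => G.p_ne _ _ _ (by omega)⟩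
  rw [hm (k + 1) (by omega)] at hmem
  have := hmem.2.2 k (by omega)
  rwa [G.p_same] at this

theorem isBdd_of_isNil [Fintype σ] {Y : Submodule (MvPolynomial σ A) V}
    [IsArtinian (MvPolynomial σ A) Y] (hY : G.IsGr Y)
    (hX : ∀ j : σ, IsNil (MvPolynomial.X j : MvPolynomial σ A) Y) : G.IsBdd Y := by
  classical
  have key : ∀ s : Finset σ, ∃ n₀ : ℤ, ∀ n ≥ n₀, ∀ y ∈ Y,
      (∀ j ∉ s, (MvPolynomial.X j : MvPolynomial σ A) • y = 0) → G.p n y = 0 := by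
    intro s
    induction s using Finset.induction_on with
    | empty => simpa using isBdd_socle hY
    | insert i s _ ih =>
      obtain ⟨n₀, h₀⟩ := ih
      obtain ⟨k, hk⟩ := hX i
      have aux : ∀ k : ℕ, ∃ n₁ : ℤ, ∀ n ≥ n₁, ∀ y ∈ Y,
          (∀ j ∉ insert i s, (MvPolynomial.X j : MvPolynomial σ A) • y = 0) →
          (MvPolynomial.X i ^ k : MvPolynomial σ A) • y = 0 → G.p n y = 0 := by
        intro k
        induction k with
        | zero => exact ⟨0, fun n _ y _ _ h => by rw [pow_zero, one_smul] at h; rw [h, map_zero]⟩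
        | succ k ih =>
          obtain ⟨n₁, h₁⟩ := ih
          refine ⟨max n₀ (n₁ + 2), fun n hn y hy h h' => ?_⟩
          rw [← G.p_same]
          refine h₀ n (le_of_max_le_left hn) _ (hY n y hy) fun j hj => ?_
          by_cases hji : j = i
          · subst hji
            have h2 := G.X_smul j (n - 2) y
            rw [sub_add_cancel] at h2
            rw [h2]
            refine h₁ (n - 2) (by have := le_of_max_le_right hn; omega) _ (Y.smul_mem _ hy)
              (fun j' hj' => by rw [smul_comm, h j' hj', smul_zero]) ?_
            rw [← mul_smul, ← pow_succ, h']
          · exact smul_p_eq_zero (MvPolynomial.isHomogeneous_X A j) n (h j (by simp [hji, hj]))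
      obtain ⟨n₁, h₁⟩ := aux k
      exact ⟨n₁, fun n hn y hy h => h₁ n hn y hy h (hk y hy)⟩
  obtain ⟨n₀, h₀⟩ := key Finset.univ
  exact ⟨n₀, fun n hn y hy => h₀ n hn y hy fun j hj => absurd (Finset.mem_univ j) hj⟩

/-- A graded submodule on which every homogeneous polynomial is onto or nilpotent, some variable
being onto. -/
def IsGood (Y : Submodule (MvPolynomial σ A) V) : Prop :=
  (∀ (q : MvPolynomial σ A) (r : ℕ), q.IsHomogeneous r → IsOnto q Y ∨ IsNil q Y) ∧
    ∃ j : σ, IsOnto (MvPolynomial.X j : MvPolynomial σ A) Y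

/-- Prime avoidance. -/
theorem exists_isOnto (L : Finset (Submodule (MvPolynomial σ A) V)) (hL : ∀ Y ∈ L, IsGood Y) :
    ∃ (q : MvPolynomial σ A) (r : ℕ), 1 ≤ r ∧ q.IsHomogeneous r ∧ ∀ Y ∈ L, IsOnto q Y := by
  classical
  induction L using Finset.strongInduction with
  | H L ih =>
    obtain rfl | ⟨Y₀, hY₀⟩ := L.eq_empty_or_nonempty
    · exact ⟨0, 1, le_rfl, MvPolynomial.isHomogeneous_zero _ _ _, by simp⟩
    obtain hE | ⟨Y₁, hY₁⟩ := (L.erase Y₀).eq_empty_or_nonempty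
    · obtain ⟨j, hj⟩ := (hL Y₀ hY₀).2
      refine ⟨_, 1, le_rfl, MvPolynomial.isHomogeneous_X A j, fun Y hY => ?_⟩
      obtain rfl : Y = Y₀ := by
        by_contra hne
        have := Finset.mem_erase.2 ⟨hne, hY⟩
        simp [hE] at this
      exact hj
    have hchoose : ∀ Y : Submodule (MvPolynomial σ A) V, ∃ (q : MvPolynomial σ A) (r : ℕ),
        Y ∈ L → (1 ≤ r ∧ q.IsHomogeneous r ∧ ∀ Z ∈ L.erase Y, IsOnto q Z) := by
      intro Y
      by_cases hY : Y ∈ L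
      · obtain ⟨q, r, h⟩ := ih _ (Finset.erase_ssubset hY)
          fun Z hZ => hL Z (Finset.mem_of_mem_erase hZ)
        exact ⟨q, r, fun _ => h⟩
      · exact ⟨0, 0, fun h => absurd h hY⟩
    choose f r hf using hchoose
    by_cases hon : ∃ Y ∈ L, IsOnto (f Y) Y
    · obtain ⟨Y, hY, hYon⟩ := hon
      refine ⟨f Y, r Y, (hf Y hY).1, (hf Y hY).2.1, fun Z hZ => ?_⟩
      by_cases hZY : Z = Y
      · rwa [hZY]
      · exact (hf Y hY).2.2 Z (Finset.mem_erase.2 ⟨hZY, hZ⟩)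
    push Not at hon
    have hnil : ∀ Y ∈ L, IsNil (f Y) Y := fun Y hY =>
      ((hL Y hY).1 (f Y) (r Y) (hf Y hY).2.1).resolve_left (hon Y hY)
    have hr : 1 ≤ ∑ Y ∈ L.erase Y₀, r Y :=
      ((hf Y₁ (Finset.mem_of_mem_erase hY₁)).1).trans
        (Finset.single_le_sum (fun _ _ => Nat.zero_le _) hY₁)
    have hr₀ := (hf Y₀ hY₀).1
    refine ⟨f Y₀ ^ (∑ Y ∈ L.erase Y₀, r Y) + (∏ Y ∈ L.erase Y₀, f Y) ^ r Y₀,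
      r Y₀ * ∑ Y ∈ L.erase Y₀, r Y, Nat.mul_pos hr₀ hr, ?_, fun Y hY => ?_⟩
    · refine ((hf Y₀ hY₀).2.1.pow _).add ?_
      rw [mul_comm]
      exact (MvPolynomial.IsHomogeneous.prod _ _ _
        fun Y hY => (hf Y (Finset.mem_of_mem_erase hY)).2.1).pow _
    · by_cases hYY : Y = Y₀
      · subst hYY
        rw [add_comm]
        refine (IsOnto.pow (IsOnto.prod fun Z hZ => ?_) _).add_isNil ((hnil Y hY).pow hr)
        exact (hf Z (Finset.mem_of_mem_erase hZ)).2.2 Y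
          (Finset.mem_erase.2 ⟨(Finset.ne_of_mem_erase hZ).symm, hY⟩)
      · have hY' := Finset.mem_erase.2 ⟨hYY, hY⟩
        exact (((hf Y₀ hY₀).2.2 Y hY').pow _).add_isNil ((IsNil.prod hY' (hnil Y hY)).pow hr₀)

/-- On a graded module that is not a sum of proper graded submodules, every homogeneous
polynomial is onto or nilpotent. -/
theorem isOnto_or_isNil {Y : Submodule (MvPolynomial σ A) V} [IsArtinian (MvPolynomial σ A) Y]
    (hY : G.IsGr Y) (hirr : ∀ Y₁ < Y, ∀ Y₂ < Y, G.IsGr Y₁ → G.IsGr Y₂ → Y₁ ⊔ Y₂ ≠ Y)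
    (q : MvPolynomial σ A) (r : ℕ) (hq : q.IsHomogeneous r) : IsOnto q Y ∨ IsNil q Y := by
  have hle : ∀ k, Y.map (LinearMap.lsmul _ V (q ^ k)) ≤ Y := by
    rintro k _ ⟨y, hy, rfl⟩
    exact Y.smul_mem _ hy
  obtain ⟨m, hm⟩ := exists_forall_eq_of_antitone (U := Y)
    (N := fun k => Y.map (LinearMap.lsmul _ V (q ^ k))) (by
      rintro i j hij _ ⟨y, hy, rfl⟩
      obtain ⟨l, rfl⟩ := Nat.exists_eq_add_of_le hij
      exact ⟨q ^ l • y, Y.smul_mem _ hy, by simp [pow_add, mul_smul, smul_comm (q ^ l)]⟩) hle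
  set l := m + 1
  have hsup : Y.map (LinearMap.lsmul _ V (q ^ l)) ⊔
      (Y ⊓ LinearMap.ker (LinearMap.lsmul _ V (q ^ l))) = Y := by
    refine le_antisymm (sup_le (hle l) inf_le_left) fun y hy => ?_
    have h1 : q ^ l • y ∈ Y.map (LinearMap.lsmul _ V (q ^ (l + l))) := by
      rw [← hm (l + l) (by omega), hm l (by omega)]
      exact ⟨y, hy, rfl⟩
    obtain ⟨y', hy', h2⟩ := h1
    rw [LinearMap.lsmul_apply, pow_add, mul_smul] at h2
    refine Submodule.mem_sup.2 ⟨q ^ l • y', ⟨y', hy', rfl⟩, y - q ^ l • y',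
      ⟨Y.sub_mem hy (Y.smul_mem _ hy'), ?_⟩, by abel⟩
    simp [smul_sub, h2]
  by_contra hcon
  push Not at hcon
  refine hirr _ (lt_of_le_of_ne (hle l) fun h => hcon.1 fun y hy => ?_) _
    (lt_of_le_of_ne inf_le_left fun h => hcon.2 ⟨l, fun y hy => ?_⟩)
    (hY.map_smul (hq.pow l)) (hY.inf_ker (hq.pow l)) hsup
  · rw [← h] at hy
    obtain ⟨y', hy', rfl⟩ := hy
    exact ⟨q ^ m • y', Y.smul_mem _ hy', by
      rw [← mul_smul, ← pow_succ']
      rfl⟩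
  · rw [← h] at hy
    exact hy.2

theorem exists_decomposition [Fintype σ] {U₀ : Submodule (MvPolynomial σ A) V}
    [IsArtinian (MvPolynomial σ A) U₀] {U : Submodule (MvPolynomial σ A) V} (hU : U ≤ U₀)
    (hUG : G.IsGr U) : ∃ (L : Finset (Submodule (MvPolynomial σ A) V))
      (N : Submodule (MvPolynomial σ A) V), (∀ Y ∈ L, IsGood Y) ∧ G.IsBdd N ∧
        U = L.sup id ⊔ N := by
  classical
  refine isArtinian_induction (fun U => G.IsGr U → ∃ (L : Finset (Submodule (MvPolynomial σ A) V))
      (N : Submodule (MvPolynomial σ A) V), (∀ Y ∈ L, IsGood Y) ∧ G.IsBdd N ∧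
        U = L.sup id ⊔ N) U₀ (fun U hU ih hUG => ?_) hU hUG
  have : IsArtinian (MvPolynomial σ A) U := isArtinian_of_le hU
  by_cases hirr : ∀ Y₁ < U, ∀ Y₂ < U, G.IsGr Y₁ → G.IsGr Y₂ → Y₁ ⊔ Y₂ ≠ U
  · have hd := isOnto_or_isNil hUG hirr
    by_cases hj : ∃ j : σ, IsOnto (MvPolynomial.X j : MvPolynomial σ A) U
    · exact ⟨{U}, ⊥, by simpa using ⟨hd, hj⟩, ⟨0, fun n _ y hy => by
        rw [(Submodule.mem_bot _).1 hy, map_zero]⟩, by simp⟩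
    · push Not at hj
      exact ⟨∅, U, by simp, isBdd_of_isNil hUG fun j =>
        (hd _ 1 (MvPolynomial.isHomogeneous_X A j)).resolve_left (hj j), by simp⟩
  · push Not at hirr
    obtain ⟨Y₁, h1, Y₂, h2, hg1, hg2, rfl⟩ := hirr
    obtain ⟨L₁, N₁, hL₁, hN₁, h₁⟩ := ih Y₁ h1 hg1
    obtain ⟨L₂, N₂, hL₂, hN₂, h₂⟩ := ih Y₂ h2 hg2
    refine ⟨L₁ ∪ L₂, N₁ ⊔ N₂, fun Y hY => (Finset.mem_union.1 hY).elim (hL₁ Y) (hL₂ Y),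
      hN₁.sup hN₂, ?_⟩
    rw [Finset.sup_union, sup_sup_sup_comm, ← h₁, ← h₂]

/-- A graded Artinian module has a homogeneous polynomial of positive degree which is onto in
large degrees. -/
theorem exists_onto_in_large_degrees [Fintype σ] {U₀ : Submodule (MvPolynomial σ A) V}
    [IsArtinian (MvPolynomial σ A) U₀] {U : Submodule (MvPolynomial σ A) V} (hU : U ≤ U₀)
    (hUG : G.IsGr U) : ∃ (q : MvPolynomial σ A) (r : ℕ) (n₀ : ℤ), 1 ≤ r ∧ q.IsHomogeneous r ∧
      ∀ n ≥ n₀, ∀ u ∈ U, G.p n u = u → ∃ u' ∈ U, G.p (n + 2 * r) u' = u' ∧ q • u' = u := by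
  obtain ⟨L, N, hL, ⟨n₀, hN⟩, hUL⟩ := exists_decomposition hU hUG
  obtain ⟨q, r, hr, hq, hon⟩ := exists_isOnto L hL
  refine ⟨q, r, n₀, hr, hq, fun n hn u hu hnu => ?_⟩
  have hsup : IsOnto q (L.sup id) := by
    refine Finset.sup_induction (p := fun Y => IsOnto q Y) ?_ ?_ hon
    · intro y hy
      exact ⟨0, Submodule.zero_mem _, by rw [(Submodule.mem_bot _).1 hy, smul_zero]⟩
    · intro Y h Y' h' y hy
      obtain ⟨a, ha, b, hb, rfl⟩ := Submodule.mem_sup.1 hy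
      obtain ⟨a', ha', rfl⟩ := h a ha
      obtain ⟨b', hb', rfl⟩ := h' b hb
      exact ⟨a' + b', Submodule.add_mem_sup ha' hb', smul_add _ _ _⟩
  obtain ⟨a, ha, b, hb, hab⟩ := Submodule.mem_sup.1 (hUL ▸ hu)
  obtain ⟨a', ha', rfl⟩ := hsup a ha
  have ha'U : a' ∈ U := by
    rw [hUL]
    exact Submodule.mem_sup_left ha'
  refine ⟨G.p (n + 2 * r) a', hUG _ _ ha'U, G.p_same _ _, ?_⟩
  rw [G.smul_p hq, ← hnu, ← hab, map_add, hN n hn b hb, add_zero]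

/-- The component of degree `n` of a graded submodule. -/
noncomputable def part (G : GrMod σ A V) (U : Submodule (MvPolynomial σ A) V) (n : ℤ) : Submodule A V :=
  U.restrictScalars A ⊓ LinearMap.range (G.p n)

theorem mem_part {U : Submodule (MvPolynomial σ A) V} {n : ℤ} {u : V} :
    u ∈ G.part U n ↔ u ∈ U ∧ G.p n u = u := by
  refine and_congr_right fun _ => ⟨?_, fun h => ⟨u, h⟩⟩
  rintro ⟨v, rfl⟩
  exact G.p_same n v

theorem length_part_eq {U : Submodule (MvPolynomial σ A) V} {q : MvPolynomial σ A} {r : ℕ}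
    (hq : q.IsHomogeneous r) {n : ℤ} (hon : ∀ u ∈ U, G.p n u = u →
      ∃ u' ∈ U, G.p (n + 2 * r) u' = u' ∧ q • u' = u) :
    Module.length A (G.part U (n + 2 * r)) =
      Module.length A (G.part (U ⊓ LinearMap.ker (LinearMap.lsmul _ V q)) (n + 2 * r)) +
        Module.length A (G.part U n) := by
  have hle : G.part (U ⊓ LinearMap.ker (LinearMap.lsmul _ V q)) (n + 2 * r) ≤
      G.part U (n + 2 * r) := fun u hu => mem_part.2 ⟨(mem_part.1 hu).1.1, (mem_part.1 hu).2⟩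
  have hmap : ∀ u ∈ G.part U (n + 2 * r), (LinearMap.lsmul (MvPolynomial σ A) V q).restrictScalars A
      u ∈ G.part U n := by
    intro u hu
    rw [mem_part] at hu ⊢
    refine ⟨U.smul_mem _ hu.1, ?_⟩
    simp only [LinearMap.coe_restrictScalars, LinearMap.lsmul_apply]
    rw [← G.smul_p hq, hu.2]
  refine Module.length_eq_add_of_exact (Submodule.inclusion hle)
    (((LinearMap.lsmul (MvPolynomial σ A) V q).restrictScalars A).restrict hmap)
    (Submodule.inclusion_injective hle) ?_ ?_
  · rintro ⟨u, hu⟩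
    obtain ⟨u', hu', h1, h2⟩ := hon u (mem_part.1 hu).1 (mem_part.1 hu).2
    exact ⟨⟨u', mem_part.2 ⟨hu', h1⟩⟩, Subtype.ext h2⟩
  · rintro ⟨u, hu⟩
    constructor
    · intro h
      have hu' := mem_part.1 hu
      exact ⟨⟨u, mem_part.2 ⟨⟨hu'.1, congrArg Subtype.val h⟩, hu'.2⟩⟩, rfl⟩
    · rintro ⟨⟨v, hv⟩, h⟩
      obtain rfl : v = u := congrArg Subtype.val h
      exact Subtype.ext (mem_part.1 hv).1.2

end GrMod

/-! ## Artinian homology -/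

section IsArt

variable {S E : Type u} [CommRing S] [AddCommGroup E] [Module S E]

/-- The subquotient `Z / B` is Artinian. -/
def IsArt (B Z : Submodule S E) : Prop :=
  ∀ N : ℕ → Submodule S E, Antitone N → (∀ k, B ≤ N k) → (∀ k, N k ≤ Z) →
    ∃ m, ∀ k, m ≤ k → N m = N k

theorem IsArt.isArtinian {B Z : Submodule S E} (h : IsArt B Z) (hBZ : B ≤ Z) :
    IsArtinian S (Z.map B.mkQ) := by
  rw [← monotone_stabilizes_iff_artinian]
  intro f
  let N : ℕ → Submodule S E := fun k =>
    ((OrderDual.ofDual (f k)).map (Z.map B.mkQ).subtype).comap B.mkQ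
  have hB : ∀ k, B ≤ N k := fun k b hb => by
    rw [Submodule.mem_comap, Submodule.mkQ_apply, (Submodule.Quotient.mk_eq_zero B).2 hb]
    exact Submodule.zero_mem _
  obtain ⟨m, hm⟩ := h N
    (fun i j hij => Submodule.comap_mono (Submodule.map_mono (f.monotone hij))) hB (fun k x hx => by
      obtain ⟨⟨y, z, hz, hzy⟩, hy, hyx⟩ := hx
      have hyx' : B.mkQ z = B.mkQ x := hzy.trans hyx
      have := (Submodule.Quotient.eq B).1 hyx'
      rw [← sub_sub_cancel z x]
      exact Z.sub_mem hz (hBZ this))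
  refine ⟨m, fun k hk => ?_⟩
  have h1 := congrArg (Submodule.map B.mkQ) (hm k hk)
  simp only [N] at h1
  rw [Submodule.map_comap_eq_of_surjective B.mkQ_surjective,
    Submodule.map_comap_eq_of_surjective B.mkQ_surjective] at h1
  exact Submodule.map_injective_of_injective (Submodule.injective_subtype _) h1

/-- If the kernel of a locally nilpotent operator is Artinian, so is the module. -/
theorem IsArt.of_ker {B Z B' Z' : Submodule S E} (h : IsArt B' Z') (hB : B' ≤ B)
    (hBZ' : B' ≤ Z') (χ : S) (hχ : ∀ w ∈ Z, χ • w ∈ B → ∃ z ∈ Z', w - z ∈ B)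
    (hnil : ∀ w ∈ Z, ∃ k : ℕ, χ ^ k • w ∈ B) : IsArt B Z := by
  intro N hN hBN hNZ
  let P : ℕ → ℕ → Submodule S E := fun j k =>
    { carrier := {z | z ∈ Z' ∧ ∃ n ∈ N j, χ ^ (k + 1) • n ∈ B ∧ χ ^ k • n - z ∈ B}
      add_mem' := by
        rintro a b ⟨ha, n, hn, h1, h2⟩ ⟨hb, n', hn', h1', h2'⟩
        refine ⟨Z'.add_mem ha hb, n + n', (N j).add_mem hn hn', ?_, ?_⟩
        · rw [smul_add]
          exact B.add_mem h1 h1'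
        · have := B.add_mem h2 h2'
          rwa [sub_add_sub_comm, ← smul_add] at this
      zero_mem' := ⟨Z'.zero_mem, 0, (N j).zero_mem, by simp, by simp⟩
      smul_mem' := by
        rintro s a ⟨ha, n, hn, h1, h2⟩
        refine ⟨Z'.smul_mem s ha, s • n, (N j).smul_mem s hn, ?_, ?_⟩
        · rw [smul_comm]
          exact B.smul_mem s h1
        · rw [smul_comm, ← smul_sub]
          exact B.smul_mem s h2 }
  have hP : ∀ {j j' k k'}, j ≤ j' → k ≤ k' → P j' k' ≤ P j k := by
    rintro j j' k k' hj hk z ⟨hz, n, hn, h1, h2⟩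
    obtain ⟨l, rfl⟩ := Nat.exists_eq_add_of_le hk
    refine ⟨hz, χ ^ l • n, (N j).smul_mem _ (hN hj hn), ?_, ?_⟩
    · rwa [← mul_smul, ← pow_add, add_right_comm]
    · rwa [← mul_smul, ← pow_add]
  have hPB : ∀ j k, B' ≤ P j k := fun j k b hb =>
    ⟨hBZ' hb, 0, (N j).zero_mem, by simp, by simpa using hB hb⟩
  have hPZ : ∀ j k, P j k ≤ Z' := fun j k z hz => hz.1
  obtain ⟨m, hm⟩ := h (fun k => P k k) (fun i j hij => hP hij hij) (fun k => hPB k k)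
    fun k => hPZ k k
  choose t ht using fun k => h (fun j => P j k) (fun i j hij => hP hij le_rfl)
    (fun j => hPB j k) fun j => hPZ j k
  let b := m + ∑ k ∈ Finset.range m, t k
  have hstab : ∀ j, b ≤ j → ∀ k, P b k ≤ P j k := by
    intro j hj k
    by_cases hk : k < m
    · have hb : t k ≤ b := (Finset.single_le_sum (f := t) (fun _ _ => Nat.zero_le _)
        (Finset.mem_range.2 hk)).trans (Nat.le_add_left _ _)
      rw [← ht k b hb, ht k j (hb.trans hj)]
    · calc P b k ≤ P m m := hP (Nat.le_add_right _ _) (by omega)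
        _ = P (max j k) (max j k) := hm _ (by omega)
        _ ≤ P j k := hP (le_max_left _ _) (le_max_right _ _)
  refine ⟨b, fun j hj => le_antisymm ?_ (hN hj)⟩
  have key : ∀ k : ℕ, ∀ n ∈ N b, χ ^ k • n ∈ B → n ∈ N j := by
    intro k
    induction k with
    | zero => exact fun n _ hn => hBN j (by simpa using hn)
    | succ k ih =>
      intro n hn hk
      obtain ⟨z, hz, hzB⟩ := hχ (χ ^ k • n) (Z.smul_mem _ (hNZ b hn))
        (by rwa [← mul_smul, ← pow_succ'])
      obtain ⟨-, n', hn', -, h2⟩ := hstab j hj k (show z ∈ P b k from ⟨hz, n, hn, hk, hzB⟩)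
      have := ih (n - n') ((N b).sub_mem hn (hN hj hn')) (by
        have := B.sub_mem hzB h2
        rwa [sub_sub_sub_cancel_right, ← smul_sub] at this)
      rw [← sub_add_cancel n n']
      exact (N j).add_mem this hn'
  intro n hn
  obtain ⟨k, hk⟩ := hnil n (hNZ b hn)
  exact key k n hn hk

/-- A homological form of `IsArt.of_ker`. -/
theorem IsArt.of_homology_ker {d : E →ₗ[S] E} (hd : ∀ w, d (d w) = 0) {N : Submodule S E} {χ : S}
    (hdN : ∀ w ∈ N, d w ∈ N) {s : E → E} (hs : ∀ w, χ • s w = w) (hsN : ∀ w ∈ N, s w ∈ N)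
    (hnil : ∀ w : E, ∃ k : ℕ, χ ^ k • w = 0)
    (h : IsArt ((N ⊓ LinearMap.ker (LinearMap.lsmul S E χ)).map d)
      (N ⊓ LinearMap.ker (LinearMap.lsmul S E χ) ⊓ LinearMap.ker d)) :
    IsArt (N.map d) (N ⊓ LinearMap.ker d) := by
  refine h.of_ker (Submodule.map_mono inf_le_left) ?_ χ ?_ ?_
  · rintro _ ⟨w, ⟨hw, hw'⟩, rfl⟩
    refine ⟨⟨hdN w hw, ?_⟩, hd w⟩
    have hw'' : χ • w = 0 := hw'
    simp [← map_smul, hw'']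
  · rintro w ⟨hw, hdw⟩ ⟨v, hv, hvw⟩
    refine ⟨w - d (s v), ⟨⟨N.sub_mem hw (hdN _ (hsN v hv)), ?_⟩, ?_⟩, ?_⟩
    · rw [SetLike.mem_coe, LinearMap.mem_ker, LinearMap.lsmul_apply, smul_sub, ← map_smul, hs, hvw, sub_self]
    · rw [SetLike.mem_coe, LinearMap.mem_ker, map_sub, hd, sub_zero]
      exact hdw
    · rw [sub_sub_cancel]
      exact ⟨s v, hsN v hv, rfl⟩
  · intro w _
    obtain ⟨k, hk⟩ := hnil w
    exact ⟨k, hk ▸ Submodule.zero_mem _⟩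

/-- A finitely generated module killed by a maximal ideal is Artinian. -/
theorem IsArt.of_fg {A : Type u} [CommRing A] [IsLocalRing A] [IsNoetherianRing A] [Algebra A S]
    [Module A E] [IsScalarTower A S E] {B Z : Submodule S E} {N : Submodule A E} (hN : N.FG)
    (hZ : ∀ z ∈ Z, z ∈ N) (h : ∀ a ∈ maximalIdeal A, ∀ z ∈ Z, a • z ∈ B) : IsArt B Z := by
  have := Module.Finite.iff_fg.2 hN
  have : IsNoetherian A (Z.restrictScalars A) := isNoetherian_of_le (t := N) hZ
  let B' : Submodule A E := B.restrictScalars A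
  have hfin : IsNoetherian A ((Z.restrictScalars A).map B'.mkQ) :=
    isNoetherian_of_fg_of_noetherian _
      ((Module.Finite.iff_fg.1 (inferInstance : Module.Finite A (Z.restrictScalars A))).map _)
  have hart : IsArtinian A ((Z.restrictScalars A).map B'.mkQ) := by
    have hsupp : IsNoethSupp (maximalIdeal A) ((Z.restrictScalars A).map B'.mkQ) := by
      refine ⟨hfin, le_trans (fun a ha => ?_) Ideal.le_radical⟩
      rw [Module.mem_annihilator]
      rintro ⟨_, z, hz, rfl⟩
      refine Subtype.ext ?_
      change a • B'.mkQ z = 0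
      rw [← map_smul]
      exact (Submodule.Quotient.mk_eq_zero B').2 (h a ha z hz)
    exact (isFiniteLength_iff_isNoetherian_isArtinian.1
      (Module.length_ne_top_iff.1 hsupp.isFiniteLength)).2
  intro N hN hBN hNZ
  obtain ⟨m, hm⟩ := exists_forall_eq_of_antitone (U := (Z.restrictScalars A).map B'.mkQ)
    (N := fun k => ((N k).restrictScalars A).map B'.mkQ)
    (fun i j hij => Submodule.map_mono (hN hij)) fun k => Submodule.map_mono (hNZ k)
  refine ⟨m, fun k hk => le_antisymm (fun x hx => ?_) (hN hk)⟩
  have hx' : B'.mkQ x ∈ ((N k).restrictScalars A).map B'.mkQ := by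
    rw [← hm k hk]
    exact ⟨x, hx, rfl⟩
  obtain ⟨y, hy, hyx⟩ := hx'
  have := (Submodule.Quotient.eq B').1 hyx
  rw [← sub_sub_cancel y x]
  exact (N k).sub_mem hy (hBN k this)

end IsArt

namespace GradedDiff

open TensorProduct

/-- A complex with an action of a polynomial ring whose variables have degree `-2`. -/
structure IsAct (σ : Type) {A W : Type u} [CommRing A] [AddCommGroup W] [Module A W]
    [Module (MvPolynomial σ A) W] [IsScalarTower A (MvPolynomial σ A) W] (T : GradedDiff A W) :
    Prop where
  d_smul : ∀ (q : MvPolynomial σ A) w, T.d (q • w) = q • T.d w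
  X_smul : ∀ (i : σ) n w, (MvPolynomial.X i : MvPolynomial σ A) • T.π (n + 2) w =
    T.π n ((MvPolynomial.X i : MvPolynomial σ A) • w)

variable {σ : Type} {A W : Type u} [CommRing A] [AddCommGroup W] [Module A W]
  [Module (MvPolynomial σ A) W] [IsScalarTower A (MvPolynomial σ A) W] {T : GradedDiff A W}

/-- Tensoring commutes with the action of the polynomial ring. -/
theorem rT_smul_comm {W' : Type u} [AddCommGroup W'] [Module A W']
    [Module (MvPolynomial σ A) W'] [IsScalarTower A (MvPolynomial σ A) W']
    (M : Type u) [AddCommGroup M] [Module A M] {f g : W →ₗ[A] W'} {q q' : MvPolynomial σ A}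
    (h : ∀ w, f (q • w) = q' • g w) (z : W ⊗[A] M) :
    rT A M f (q • z) = q' • rT A M g z := by
  induction z using TensorProduct.induction_on with
  | zero => simp
  | tmul w m =>
    rw [TensorProduct.smul_tmul', AlgebraTensorModule.rTensor_tmul,
      AlgebraTensorModule.rTensor_tmul, h, TensorProduct.smul_tmul']
  | add x y hx hy => rw [smul_add, map_add, hx, hy, map_add, smul_add]

namespace IsAct

theorem tensor (hT : T.IsAct σ) (M : Type u) [AddCommGroup M] [Module A M] :
    (T.tensor A M).IsAct σ where
  d_smul q w := rT_smul_comm M (hT.d_smul q) w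
  X_smul i n w := (rT_smul_comm M (fun w => (hT.X_smul i n w).symm) w).symm

/-- The differential as a linear map over the polynomial ring. -/
@[simps]
def dS (hT : T.IsAct σ) : W →ₗ[MvPolynomial σ A] W where
  toFun := T.d
  map_add' := map_add _
  map_smul' := hT.d_smul

/-- The quotient by the boundaries is a graded module. -/
noncomputable def grMod (hT : T.IsAct σ) : GrMod σ A (W ⧸ LinearMap.range hT.dS) where
  p n := (Submodule.Quotient.restrictScalarsEquiv A (LinearMap.range hT.dS)).toLinearMap ∘ₗ
    Submodule.mapQ _ _ (T.π n) (by
      rintro _ ⟨w, rfl⟩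
      exact ⟨T.π (n + 1) w, T.d_π rfl w⟩) ∘ₗ
    (Submodule.Quotient.restrictScalarsEquiv A (LinearMap.range hT.dS)).symm.toLinearMap
  p_same n v := by
    obtain ⟨w, rfl⟩ := Submodule.Quotient.mk_surjective _ v
    exact congrArg Submodule.Quotient.mk (T.π_same n w)
  p_ne m n v h := by
    obtain ⟨w, rfl⟩ := Submodule.Quotient.mk_surjective _ v
    exact congrArg Submodule.Quotient.mk (T.π_ne m n w h)
  X_smul i n v := by
    obtain ⟨w, rfl⟩ := Submodule.Quotient.mk_surjective _ v
    exact congrArg Submodule.Quotient.mk (hT.X_smul i n w)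

/-- The homology, as a submodule of the quotient by the boundaries. -/
noncomputable def homology (hT : T.IsAct σ) : Submodule (MvPolynomial σ A) (W ⧸ LinearMap.range hT.dS) :=
  (LinearMap.ker hT.dS).map (LinearMap.range hT.dS).mkQ

theorem isGr_homology (hT : T.IsAct σ) : hT.grMod.IsGr hT.homology := by
  rintro n _ ⟨w, hw, rfl⟩
  refine ⟨T.π n w, ?_, rfl⟩
  have h : T.d w = 0 := hw
  change T.d (T.π n w) = 0
  rw [T.d_π_sub, h, map_zero]

end IsAct

/-- A Tate resolution of the residue field: a resolution by free modules of finite rank with an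
action of a polynomial ring by surjective chain maps of degree `-2`. -/
structure IsTate (σ : Type) [Fintype σ] {A W : Type u} [CommRing A] [IsLocalRing A]
    [AddCommGroup W] [Module A W] [Module (MvPolynomial σ A) W]
    [IsScalarTower A (MvPolynomial σ A) W] (T : GradedDiff A W) : Prop extends T.IsAct σ where
  projective : Module.Projective A W
  π_neg : ∀ n < 0, ∀ w, T.π n w = 0
  fg_piece : ∀ n, (T.piece n).FG
  exactAt : ∀ n ≥ 1, T.ExactAt n
  coker : Nonempty (T.coker 0 ≃ₗ[A] A ⧸ maximalIdeal A)
  exists_pow_smul : ∀ (i : σ) (w : W), ∃ k : ℕ, (MvPolynomial.X i ^ k : MvPolynomial σ A) • w = 0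
  exists_section : ∀ i : σ, ∃ s : W →ₗ[A] W,
    (∀ w, (MvPolynomial.X i : MvPolynomial σ A) • s w = w) ∧
      ∀ j ≠ i, ∀ w, (MvPolynomial.X j : MvPolynomial σ A) • s w =
        s ((MvPolynomial.X j : MvPolynomial σ A) • w)
  exists_retraction : ∃ P : W →ₗ[A] W, (LinearMap.range P).FG ∧ ∃ τ : σ → W →ₗ[A] W,
    ∀ w, w = P w + ∑ i, τ i ((MvPolynomial.X i : MvPolynomial σ A) • w)
  exists_homotopy : ∃ t : Set A, Ideal.span t = maximalIdeal A ∧ ∀ y ∈ t,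
    ∃ h : W →ₗ[MvPolynomial σ A] W, ∀ w, T.d (h w) + h (T.d w) = y • w

namespace IsTate

variable [Fintype σ] [IsLocalRing A]

theorem exists_pow_smul_tensor (hT : T.IsTate σ) (M : Type u) [AddCommGroup M] [Module A M]
    (i : σ) (z : W ⊗[A] M) :
    ∃ k : ℕ, (MvPolynomial.X i ^ k : MvPolynomial σ A) • z = 0 := by
  induction z using TensorProduct.induction_on with
  | zero => exact ⟨0, smul_zero _⟩
  | tmul w m =>
    obtain ⟨k, hk⟩ := hT.exists_pow_smul i w
    exact ⟨k, by rw [TensorProduct.smul_tmul', hk, TensorProduct.zero_tmul]⟩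
  | add x y hx hy =>
    obtain ⟨k, hk⟩ := hx
    obtain ⟨l, hl⟩ := hy
    exact ⟨k + l, by rw [smul_add, pow_add, mul_smul, mul_smul, hl, smul_zero, smul_comm, hk,
      smul_zero, add_zero]⟩

theorem isArt_socle [IsNoetherianRing A] (hT : T.IsTate σ) (M : Type u) [AddCommGroup M] [Module A M]
    [Module.Finite A M] {N : Submodule (MvPolynomial σ A) (W ⊗[A] M)}
    (hN : ∀ z, z ∈ N ↔ ∀ i, (MvPolynomial.X i : MvPolynomial σ A) • z = 0) :
    IsArt (N.map (hT.tensor M).dS) (N ⊓ LinearMap.ker (hT.tensor M).dS) := by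
  obtain ⟨P, hP, τ, hτ⟩ := hT.exists_retraction
  have := Module.Finite.iff_fg.2 hP
  have hfg : (LinearMap.range (rT A M (LinearMap.range P).subtype)).FG :=
    Module.Finite.iff_fg.1 inferInstance
  refine IsArt.of_fg hfg ?_ ?_
  · rintro z ⟨hz, -⟩
    have hz' := (hN z).1 hz
    have key : z = rT A M P z + ∑ i, rT A M (τ i) ((MvPolynomial.X i : MvPolynomial σ A) • z) := by
      clear hz hz'
      induction z using TensorProduct.induction_on with
      | zero => simp
      | tmul w m =>
        simp only [TensorProduct.smul_tmul', AlgebraTensorModule.rTensor_tmul]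
        rw [← TensorProduct.sum_tmul, ← TensorProduct.add_tmul, ← hτ]
      | add x y hx hy =>
        simp only [smul_add, map_add, Finset.sum_add_distrib]
        rw [add_add_add_comm, ← hx, ← hy]
    simp only [hz', map_zero, Finset.sum_const_zero, add_zero] at key
    rw [key]
    refine ⟨rT A M P.rangeRestrict z, ?_⟩
    rw [rT_rT]
    rfl
  · obtain ⟨t, ht, hh⟩ := hT.exists_homotopy
    intro a ha
    rw [← ht] at ha
    induction ha using Submodule.span_induction with
    | mem y hy =>
      rintro z ⟨hz, hdz⟩
      obtain ⟨h, hh⟩ := hh y hy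
      let h' : W →ₗ[A] W := h.restrictScalars A
      have h1 : ∀ z : W ⊗[A] M, rT A M T.d (rT A M h' z) + rT A M h' (rT A M T.d z) = y • z := by
        intro z
        rw [rT_rT, rT_rT, ← rT_add, ← rT_eq_self (f := (LinearMap.id : W →ₗ[A] W)) (fun _ => rfl) (y • z),
          map_smul, ← rT_smul]
        exact rT_congr hh z
      refine ⟨rT A M h' z, (hN _).2 fun i => ?_, ?_⟩
      · rw [← rT_smul_comm (σ := σ) M (f := h') (q := MvPolynomial.X i) (fun w => map_smul h _ w),
          (hN z).1 hz, map_zero]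
      · rw [← h1 z]
        have : rT A M T.d z = 0 := hdz
        rw [this, map_zero, add_zero]
        rfl
    | zero => exact fun z _ => by rw [zero_smul]; exact Submodule.zero_mem _
    | add a b _ _ ha hb =>
      intro z hz
      rw [add_smul]
      exact Submodule.add_mem _ (ha z hz) (hb z hz)
    | smul b a _ ha =>
      intro z hz
      rw [smul_eq_mul, mul_smul, ← algebraMap_smul (MvPolynomial σ A) b]
      exact Submodule.smul_mem _ _ (ha z hz)

/-- The homology of a Tate resolution with coefficients in a finite module is Artinian over the
ring of operators. -/
theorem isArtinian_homology [IsNoetherianRing A] (hT : T.IsTate σ) (M : Type u)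
    [AddCommGroup M] [Module A M]
    [Module.Finite A M] : IsArtinian (MvPolynomial σ A) (hT.tensor M).homology := by
  classical
  let N : Finset σ → Submodule (MvPolynomial σ A) (W ⊗[A] M) := fun s =>
    ⨅ i ∈ s, LinearMap.ker (LinearMap.lsmul (MvPolynomial σ A) (W ⊗[A] M) (MvPolynomial.X i))
  have hN : ∀ s z, z ∈ N s ↔ ∀ i ∈ s, (MvPolynomial.X i : MvPolynomial σ A) • z = 0 := by
    intro s z
    simp [N, Submodule.mem_iInf]
  have hd : ∀ z, (hT.tensor M).dS ((hT.tensor M).dS z) = 0 := (T.tensor A M).d_d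
  have key : ∀ t : Finset σ,
      IsArt ((N tᶜ).map (hT.tensor M).dS) (N tᶜ ⊓ LinearMap.ker (hT.tensor M).dS) := by
    intro t
    induction t using Finset.induction_on with
    | empty => exact hT.isArt_socle M fun z => by simp [hN]
    | insert i t hi ih =>
      obtain ⟨s, hs, hsj⟩ := hT.exists_section i
      refine IsArt.of_homology_ker hd (χ := MvPolynomial.X i) (s := rT A M s) ?_ ?_ ?_
        (hT.exists_pow_smul_tensor M i) ?_
      · intro w hw
        rw [hN] at hw ⊢
        intro j hj
        rw [← map_smul, hw j hj, map_zero]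
      · intro z
        rw [← rT_smul_comm (σ := σ) M (f := LinearMap.id) (q := 1) (g := s)
          (q' := MvPolynomial.X i) (fun w => by rw [hs, one_smul]; rfl), one_smul]
        exact rT_eq_self (fun _ => rfl) z
      · intro z hz
        rw [hN] at hz ⊢
        intro j hj
        have hji : j ≠ i := by
          rintro rfl
          simp at hj
        rw [← rT_smul_comm (σ := σ) M (f := s) (fun w => (hsj j hji w).symm), hz j hj, map_zero]
      · have : N (insert i t)ᶜ ⊓ LinearMap.ker (LinearMap.lsmul (MvPolynomial σ A) (W ⊗[A] M)
            (MvPolynomial.X i)) = N tᶜ := by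
          ext z
          rw [Submodule.mem_inf, hN, hN, LinearMap.mem_ker, LinearMap.lsmul_apply]
          constructor
          · rintro ⟨h, h'⟩ j hj
            by_cases hji : j = i
            · rwa [hji]
            · exact h j (by simpa [hji] using hj)
          · intro h
            exact ⟨fun j hj => h j (by simp at hj ⊢; exact hj.2), h i (by simpa using hi)⟩
        rw [this]
        exact ih
  have := key Finset.univ
  have htop : N (Finset.univ)ᶜ = ⊤ := by simp [N]
  rw [htop, top_inf_eq, Submodule.map_top] at this
  exact this.isArtinian (by rintro _ ⟨w, rfl⟩; exact hd w)

end IsTate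

end GradedDiff

/-! ## Reducing the complexity -/

namespace GradedDiff

open TensorProduct

section ConeComponents

variable {A W : Type u} [CommRing A] [AddCommGroup W] [Module A W] {T : GradedDiff A W}
  {s : ℤ} {q : W →ₗ[A] W} {hd : ∀ w, q (T.d w) = T.d (q w)}
  {hπ : ∀ n w, q (T.π (n + s + 1) w) = T.π n (q w)}
  {M : Type u} [AddCommGroup M] [Module A M]

/-- An element of a tensor product with a direct sum, given by its two components. -/
noncomputable def tpair (x y : W ⊗[A] M) : (W × W) ⊗[A] M :=
  rT A M (LinearMap.inl A W W) x + rT A M (LinearMap.inr A W W) y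

theorem tfst_tpair (x y : W ⊗[A] M) : rT A M (LinearMap.fst A W W) (tpair x y) = x := by
  rw [tpair, map_add, rT_rT, rT_rT, rT_eq_self (fun w => rfl) x, rT_eq_zero (fun w => rfl) y,
    add_zero]

theorem tsnd_tpair (x y : W ⊗[A] M) : rT A M (LinearMap.snd A W W) (tpair x y) = y := by
  rw [tpair, map_add, rT_rT, rT_rT, rT_eq_zero (fun w => rfl) x, rT_eq_self (fun w => rfl) y,
    zero_add]

theorem tpair_ext {z z' : (W × W) ⊗[A] M}
    (h1 : rT A M (LinearMap.fst A W W) z = rT A M (LinearMap.fst A W W) z')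
    (h2 : rT A M (LinearMap.snd A W W) z = rT A M (LinearMap.snd A W W) z') : z = z' := by
  rw [← rT_fst_snd (R := A) M z, ← rT_fst_snd (R := A) M z', h1, h2]

theorem cone_tensor_tfst_d (z : (W × W) ⊗[A] M) :
    rT A M (LinearMap.fst A W W) (((T.cone s q hd hπ).tensor A M).d z) =
      (T.tensor A M).d (rT A M (LinearMap.fst A W W) z) +
        rT A M q (rT A M (LinearMap.snd A W W) z) :=
  cone_tensor_d (X := T) (hd := hd) (hπ := hπ) (Y := M) z

theorem cone_tensor_tsnd_d (z : (W × W) ⊗[A] M) :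
    rT A M (LinearMap.snd A W W) (((T.cone s q hd hπ).tensor A M).d z) =
      -(T.tensor A M).d (rT A M (LinearMap.snd A W W) z) := by
  rw [tensor_d, tensor_d, rT_rT, rT_rT, ← rT_neg]
  exact rT_congr (fun w => rfl) z

theorem cone_tensor_tfst_π (n : ℤ) (z : (W × W) ⊗[A] M) :
    rT A M (LinearMap.fst A W W) (((T.cone s q hd hπ).tensor A M).π n z) =
      (T.tensor A M).π n (rT A M (LinearMap.fst A W W) z) := by
  rw [tensor_π, tensor_π, rT_rT, rT_rT]
  exact rT_congr (fun w => rfl) z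

theorem cone_tensor_tsnd_π (n : ℤ) (z : (W × W) ⊗[A] M) :
    rT A M (LinearMap.snd A W W) (((T.cone s q hd hπ).tensor A M).π n z) =
      (T.tensor A M).π (n + s) (rT A M (LinearMap.snd A W W) z) := by
  rw [tensor_π, tensor_π, rT_rT, rT_rT]
  exact rT_congr (fun w => rfl) z

end ConeComponents

section Stage

variable {σ : Type} {A W V : Type u} [CommRing A] [AddCommGroup W] [Module A W]
  [Module (MvPolynomial σ A) W] [IsScalarTower A (MvPolynomial σ A) W] {T : GradedDiff A W}
  [AddCommGroup V] [Module A V] [Module (MvPolynomial σ A) V]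
  [IsScalarTower A (MvPolynomial σ A) V] {G : GrMod σ A V}
  {U : Submodule (MvPolynomial σ A) V}

/-- A polynomial as an operator. -/
noncomputable def opA (W : Type u) [AddCommGroup W] [Module A W]
    [Module (MvPolynomial σ A) W] [IsScalarTower A (MvPolynomial σ A) W] (q : MvPolynomial σ A) :
    W →ₗ[A] W := (LinearMap.lsmul (MvPolynomial σ A) W q).restrictScalars A

@[simp]
theorem opA_apply (q : MvPolynomial σ A) (w : W) : opA W q w = q • w := rfl

theorem rT_opA (M : Type u) [AddCommGroup M] [Module A M] (q : MvPolynomial σ A)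
    (z : W ⊗[A] M) : rT A M (opA W q) z = q • z := by
  have := rT_smul_comm (σ := σ) M (f := opA W q) (q := 1) (q' := q) (g := LinearMap.id)
    (fun w => by rw [one_smul]; rfl) z
  rwa [one_smul, rT_eq_self (f := (LinearMap.id : W →ₗ[A] W)) (fun _ => rfl)] at this

/-- The grading of a complex with operators. -/
def IsAct.toGrMod (hT : T.IsAct σ) : GrMod σ A W where
  p := T.π
  p_same := T.π_same
  p_ne := T.π_ne
  X_smul := hT.X_smul

theorem IsAct.opA_d (hT : T.IsAct σ) (q : MvPolynomial σ A) (w : W) :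
    opA W q (T.d w) = T.d (opA W q w) := (hT.d_smul q w).symm

theorem IsAct.opA_π (hT : T.IsAct σ) {q : MvPolynomial σ A} {r : ℕ}
    (hq : q.IsHomogeneous (r + 1)) (n : ℤ) (w : W) :
    opA W q (T.π (n + (2 * r + 1 : ℕ) + 1) w) = T.π n (opA W q w) := by
  have := hT.toGrMod.smul_p hq n w
  rw [show n + 2 * ((r + 1 : ℕ) : ℤ) = n + (2 * r + 1 : ℕ) + 1 by push_cast; ring] at this
  exact this

/-- The cone of an operator. -/
noncomputable def IsAct.coneOf (hT : T.IsAct σ) {q : MvPolynomial σ A} {r : ℕ}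
    (hq : q.IsHomogeneous (r + 1)) : GradedDiff A (W × W) :=
  T.cone (2 * r + 1 : ℕ) (opA W q) (hT.opA_d q) (hT.opA_π hq)

theorem IsAct.isAct_coneOf (hT : T.IsAct σ) {q : MvPolynomial σ A} {r : ℕ}
    (hq : q.IsHomogeneous (r + 1)) : (hT.coneOf hq).IsAct σ where
  d_smul p w := by
    rw [coneOf, cone_d_apply, cone_d_apply]
    ext
    · simp only [Prod.smul_fst, Prod.smul_snd, opA_apply, hT.d_smul, smul_add]
      rw [smul_comm]
    · simp only [Prod.smul_snd, hT.d_smul, smul_neg]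
  X_smul i n w := by
    rw [coneOf, cone_π_apply, cone_π_apply]
    ext
    · exact hT.X_smul i n w.1
    · have := hT.X_smul i (n + (2 * r + 1 : ℕ)) w.2
      rw [add_right_comm] at this
      exact this

/-- In large degrees the homology of `T ⊗ M` is the graded module `U`, up to a shift. -/
def IsStage (T : GradedDiff A W) (M : Type u) [AddCommGroup M] [Module A M] (G : GrMod σ A V)
    (U : Submodule (MvPolynomial σ A) V) : Prop :=
  ∃ (hT : T.IsAct σ) (Φ : LinearMap.ker (hT.tensor M).dS →ₗ[MvPolynomial σ A] V) (e n₀ : ℤ),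
    ∀ n ≥ n₀, (∀ z : LinearMap.ker (hT.tensor M).dS, (T.tensor A M).π n (z : W ⊗[A] M) = z →
      (Φ z = 0 ↔ (z : W ⊗[A] M) ∈ (T.tensor A M).B n) ∧ Φ z ∈ U ∧ G.p (n + e) (Φ z) = Φ z) ∧
    ∀ u ∈ U, G.p (n + e) u = u → 
      ∃ z : LinearMap.ker (hT.tensor M).dS, (T.tensor A M).π n (z : W ⊗[A] M) = z ∧ Φ z = u

theorem IsStage.exactAt {M : Type u} [AddCommGroup M] [Module A M] (h : T.IsStage M G U)
    (hU : G.IsBdd U) : ∃ n₀ : ℤ, ∀ n ≥ n₀, (T.tensor A M).ExactAt n := by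
  obtain ⟨hT, Φ, e, n₀, h⟩ := h
  obtain ⟨n₁, hU⟩ := hU
  refine ⟨max n₀ (n₁ - e), fun n hn z hz => ?_⟩
  rw [mem_Z] at hz
  obtain ⟨h1, h2, h3⟩ := (h n (le_of_max_le_left hn)).1 ⟨z, hz.2⟩ hz.1
  refine h1.1 ?_
  rw [← h3]
  exact hU _ (by have := le_of_max_le_right hn; omega) _ h2

theorem isStage_homology (hT : T.IsAct σ) (M : Type u) [AddCommGroup M] [Module A M] :
    T.IsStage M (hT.tensor M).grMod (hT.tensor M).homology := by
  refine ⟨hT, (LinearMap.range (hT.tensor M).dS).mkQ ∘ₗ Submodule.subtype _, 0, 0, fun n _ =>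
    ⟨fun z hz => ⟨?_, ⟨z, z.2, rfl⟩, ?_⟩, ?_⟩⟩
  · refine (Submodule.Quotient.mk_eq_zero _).trans ⟨?_, ?_⟩
    · rintro ⟨u, hu⟩
      exact (T.tensor A M).mem_B_of_d hu hz
    · intro h
      obtain ⟨u, -, hu⟩ := (mem_B _).1 h
      exact ⟨u, hu⟩
  · rw [add_zero]
    exact congrArg Submodule.Quotient.mk hz
  · rintro _ ⟨z, hz, rfl⟩ hp
    rw [add_zero] at hp
    have hz' : (T.tensor A M).d z = 0 := hz
    refine ⟨⟨(T.tensor A M).π n z, ?_⟩, (T.tensor A M).π_same n z, hp⟩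
    change (T.tensor A M).d _ = 0
    rw [d_π_sub, hz', map_zero]

theorem IsStage.cone {M : Type u} [AddCommGroup M] [Module A M] (h : T.IsStage M G U)
    (hT : T.IsAct σ) {q : MvPolynomial σ A} {r : ℕ} (hq : q.IsHomogeneous (r + 1)) {n₁ : ℤ}
    (hon : ∀ n ≥ n₁, ∀ u ∈ U, G.p n u = u →
      ∃ u' ∈ U, G.p (n + 2 * (r + 1 : ℕ)) u' = u' ∧ q • u' = u) :
    (hT.coneOf hq).IsStage M G (U ⊓ LinearMap.ker (LinearMap.lsmul _ V q)) := by
  obtain ⟨_, Φ, e, n₀, h⟩ := h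
  have hC := hT.isAct_coneOf hq
  let fst := rT A M (LinearMap.fst A W W)
  let snd := rT A M (LinearMap.snd A W W)
  have hsnd : ∀ (p : MvPolynomial σ A) z, snd (p • z) = p • snd z := fun p z =>
    rT_smul_comm (σ := σ) M (fun w => rfl) z
  have hd1 : ∀ z, fst (((hT.coneOf hq).tensor A M).d z) =
      (T.tensor A M).d (fst z) + q • snd z := fun z => by
    rw [← rT_opA]
    exact cone_tensor_tfst_d z
  have hd2 : ∀ z, snd (((hT.coneOf hq).tensor A M).d z) = -(T.tensor A M).d (snd z) :=
    fun z => cone_tensor_tsnd_d z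
  have hπ1 : ∀ n z, fst (((hT.coneOf hq).tensor A M).π n z) = (T.tensor A M).π n (fst z) :=
    fun n z => cone_tensor_tfst_π n z
  have hπ2 : ∀ n z, snd (((hT.coneOf hq).tensor A M).π n z) =
    (T.tensor A M).π (n + (2 * r + 1 : ℕ)) (snd z) := fun n z => cone_tensor_tsnd_π n z
  have hqπ : ∀ n (z : W ⊗[A] M), q • (T.tensor A M).π (n + 2 * (r + 1 : ℕ)) z =
    (T.tensor A M).π n (q • z) := fun n z => (hT.tensor M).toGrMod.smul_p hq n z
  have hqd : ∀ z : W ⊗[A] M, (T.tensor A M).d (q • z) = q • (T.tensor A M).d z :=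
    (hT.tensor M).d_smul q
  let Ψ : LinearMap.ker (hC.tensor M).dS →ₗ[MvPolynomial σ A] LinearMap.ker (hT.tensor M).dS :=
    { toFun := fun z => ⟨snd z, by
        have hz : ((hT.coneOf hq).tensor A M).d z = 0 := z.2
        have := hd2 z
        rw [hz, map_zero, eq_comm, neg_eq_zero] at this
        exact this⟩
      map_add' := fun z z' => Subtype.ext (map_add snd _ _)
      map_smul' := fun p z => Subtype.ext (hsnd p z) }
  refine ⟨hC, Φ ∘ₗ Ψ, e + (2 * r + 1 : ℕ), max (n₀ + 1) (n₁ - e), fun n hn => ?_⟩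
  have hn₀ : n₀ + 1 ≤ n := le_of_max_le_left hn
  have hn₁ : n₁ - e ≤ n := le_of_max_le_right hn
  have hs := h (n + (2 * r + 1 : ℕ)) (by omega)
  rw [show n + ((2 * r + 1 : ℕ) : ℤ) + e = n + (e + (2 * r + 1 : ℕ)) by ring] at hs
  have hs' := h (n - 1) (by omega)
  have hs'' := h n (by omega)
  have hs3 := h (n + 2 * (r + 1 : ℕ)) (by omega)
  have e1 : n - 1 + 2 * ((r + 1 : ℕ) : ℤ) = n + (2 * r + 1 : ℕ) := by push_cast; ring
  have e2 : n + ((2 * r + 1 : ℕ) : ℤ) + 1 = n + 2 * ((r + 1 : ℕ) : ℤ) := by push_cast; ring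
  refine ⟨fun z hz => ?_, fun u hu hpu => ?_⟩
  · have hzd : ((hT.coneOf hq).tensor A M).d z = 0 := z.2
    have hz1 : (T.tensor A M).π n (fst z) = fst z := by rw [← hπ1, hz]
    have hz2 : (T.tensor A M).π (n + (2 * r + 1 : ℕ)) (snd z) = snd z := by rw [← hπ2, hz]
    obtain ⟨h1, h2, h3⟩ := hs.1 (Ψ z) hz2
    have hqz : (T.tensor A M).d (fst z) + q • snd z = 0 := by rw [← hd1, hzd, map_zero]
    refine ⟨⟨fun h0 => ?_, fun h0 => ?_⟩, ⟨h2, ?_⟩, h3⟩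
    · obtain ⟨v, hv, hdv⟩ := (mem_B _).1 (h1.1 h0)
      rw [e2] at hv
      have hdv : (T.tensor A M).d v = snd z := hdv
      let x : LinearMap.ker (hT.tensor M).dS := ⟨fst z + q • v, by
        change (T.tensor A M).d _ = 0
        rw [map_add, hqd, hdv, hqz]⟩
      have hx : (T.tensor A M).π n x = x := by
        change (T.tensor A M).π n (fst z + q • v) = fst z + q • v
        rw [map_add, hz1, ← hqπ, hv]
      obtain ⟨-, hx2, hx3⟩ := hs''.1 x hx
      obtain ⟨u', hu', hpu', hqu'⟩ := hon (n + e) (by omega) _ hx2 hx3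
      obtain ⟨y, hy, rfl⟩ := hs3.2 u' hu' (by rwa [add_right_comm])
      have hxy : (T.tensor A M).π n ↑(x - q • y) = ↑(x - q • y) := by
        change (T.tensor A M).π n ((x : W ⊗[A] M) - q • (y : W ⊗[A] M)) = x - q • (y : W ⊗[A] M)
        rw [map_sub, hx, ← hqπ, hy]
      obtain ⟨t, ht, hdt⟩ := (mem_B _).1 ((hs''.1 (x - q • y) hxy).1.1 (by
        rw [map_sub, map_smul, hqu', sub_self]))
      have hdt : (T.tensor A M).d t = fst z + q • v - q • (y : W ⊗[A] M) := hdt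
      have hdy : (T.tensor A M).d y = 0 := y.2
      refine ((hT.coneOf hq).tensor A M).mem_B_of_d (u := tpair t (y - v)) ?_ hz
      refine tpair_ext ((hd1 _).trans ?_) ((hd2 _).trans ?_)
      · rw [show fst (tpair t (y - v)) = t from tfst_tpair _ _,
          show snd (tpair t (y - v)) = y - v from tsnd_tpair _ _, hdt, smul_sub]
        change _ = fst z
        abel
      · rw [show snd (tpair t (y - v)) = y - v from tsnd_tpair _ _, map_sub, hdy, hdv]
        change _ = snd z
        abel
    · obtain ⟨u, -, hu⟩ := (mem_B _).1 h0
      refine h1.2 ((T.tensor A M).mem_B_of_d (u := -snd u) ?_ hz2)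
      rw [map_neg, ← hd2, hu]
      rfl
    · change q • Φ (Ψ z) = 0
      rw [← map_smul]
      have hπq : (T.tensor A M).π (n - 1) ↑(q • Ψ z) = ↑(q • Ψ z) := by
        change (T.tensor A M).π (n - 1) (q • snd z) = q • snd z
        rw [← hqπ, e1, hz2]
      refine (hs'.1 (q • Ψ z) hπq).1.2 ((T.tensor A M).mem_B_of_d (u := -fst z) ?_ hπq)
      rw [map_neg, neg_eq_iff_add_eq_zero]
      exact hqz
  · obtain ⟨y, hy, rfl⟩ := hs.2 u hu.1 hpu
    have hdy : (T.tensor A M).d y = 0 := y.2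
    have hπq : (T.tensor A M).π (n - 1) ↑(q • y) = ↑(q • y) := by
      change (T.tensor A M).π (n - 1) (q • (y : W ⊗[A] M)) = q • (y : W ⊗[A] M)
      rw [← hqπ, e1, hy]
    obtain ⟨x, hx, hdx⟩ := (mem_B _).1 ((hs'.1 (q • y) hπq).1.1 (by
      rw [map_smul]
      exact hu.2))
    have hdx : (T.tensor A M).d x = q • (y : W ⊗[A] M) := hdx
    rw [sub_add_cancel] at hx
    have f1 : fst (tpair (-x) (y : W ⊗[A] M)) = -x := tfst_tpair _ _
    have f2 : snd (tpair (-x) (y : W ⊗[A] M)) = y := tsnd_tpair _ _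
    refine ⟨⟨tpair (-x) y, ?_⟩, ?_, ?_⟩
    · refine tpair_ext ((hd1 _).trans ?_) ((hd2 _).trans ?_)
      · rw [f1, f2, map_neg, hdx, neg_add_cancel, map_zero]
      · rw [f2, hdy, neg_zero, map_zero]
    · refine tpair_ext ((hπ1 _ _).trans ?_) ((hπ2 _ _).trans ?_)
      · change (T.tensor A M).π n (fst _) = fst _
        rw [f1, map_neg, hx]
      · change (T.tensor A M).π _ (snd _) = snd _
        rw [f2, hy]
    · exact congrArg Φ (Subtype.ext f2)

end Stage

end GradedDiff

/-! ## Comparing growth rates -/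

/-- Either `w` vanishes in large degrees, or there is a polynomial upper bound for `w` and a lower
bound of the same degree for `v` along an arithmetic progression. -/
def HasGrowth (v w : ℤ → ℕ∞) : Prop :=
  (∃ n₂, ∀ n ≥ n₂, w n = 0) ∨ ∃ n₂ a d P D : ℕ, 1 ≤ P ∧
    (∀ t : ℕ, (t.choose d : ℕ∞) ≤ v ((a + t * P : ℕ) : ℤ)) ∧
    ∀ n : ℕ, n₂ ≤ n → w n ≤ ((D * (n + 1) ^ d : ℕ) : ℕ∞)

theorem le_of_step {w : ℕ → ℕ∞} {b f : ℕ → ℕ} {N k : ℕ} (hk : 1 ≤ k)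
    (hw : ∀ n ≥ N, w (n + k) ≤ w n + f n) (hb : ∀ n ≥ N, b n + f n ≤ b (n + k))
    (h0 : ∀ n, N ≤ n → n < N + k → w n ≤ b n) : ∀ n ≥ N, w n ≤ b n := by
  intro n
  induction n using Nat.strong_induction_on with
  | _ n ih =>
    intro hn
    by_cases h : n < N + k
    · exact h0 n hn h
    · obtain ⟨m, rfl⟩ : ∃ m, n = m + k := ⟨n - k, by omega⟩
      calc w (m + k) ≤ w m + f m := hw m (by omega)
        _ ≤ b m + f m := by gcongr; exact ih m (by omega) (by omega)
        _ ≤ b (m + k) := by exact_mod_cast hb m (by omega)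

theorem exists_nat_bound {w : ℕ → ℕ∞} {N : ℕ} (h : ∀ n ≥ N, w n ≠ ⊤) (k : ℕ) :
    ∃ C : ℕ, ∀ n, N ≤ n → n < N + k → w n ≤ C := by
  refine ⟨∑ n ∈ Finset.Ico N (N + k), (w n).toNat, fun n h1 h2 => ?_⟩
  rw [← ENat.natCast_toNat (h n h1)]
  exact_mod_cast Finset.single_le_sum (f := fun n => (w n).toNat) (fun _ _ => Nat.zero_le _)
    (Finset.mem_Ico.2 ⟨h1, h2⟩)

theorem HasGrowth.step {v v' w w' : ℤ → ℕ∞} (h : HasGrowth v' w') {k : ℕ} (hk : 1 ≤ k) {n₁ : ℤ}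
    (hv : ∀ n ≥ n₁, v (n + k) = v' (n + k) + v n) (hw : ∀ n ≥ n₁, w (n + k) ≤ w n + w' (n + 1))
    (hwt : ∀ n ≥ n₁, w n ≠ ⊤) (hv1 : ∀ N, ∃ n ≥ N, 1 ≤ v n) : HasGrowth v w := by
  have hmono : ∀ n ≥ n₁, ∀ j : ℕ, v n ≤ v (n + (j * k : ℕ)) := by
    intro n hn j
    induction j with
    | zero => simp
    | succ j ih =>
      refine ih.trans ?_
      rw [show n + (((j + 1) * k : ℕ) : ℤ) = n + (j * k : ℕ) + k by push_cast; ring,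
        hv _ (by omega)]
      exact le_add_self
  obtain ⟨n₂, h⟩ | ⟨n₂, a, d, P, D, hP, hu, hd⟩ := h
  · right
    let N := n₁.toNat + n₂.toNat
    have hN1 : n₁ ≤ N := by omega
    have hN2 : n₂ ≤ N := by omega
    obtain ⟨C, hC⟩ := exists_nat_bound (w := fun n : ℕ => w n) (N := N)
      (fun n hn => hwt n (by omega)) k
    obtain ⟨a, ha, hva⟩ := hv1 N
    obtain ⟨a, rfl⟩ := Int.eq_ofNat_of_zero_le (show 0 ≤ a by omega)
    refine ⟨N, a, 0, k, C, hk, fun t => ?_, ?_⟩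
    · rw [Nat.choose_zero_right, Nat.cast_one]
      exact hva.trans (by exact_mod_cast hmono a (by omega) t)
    · simp only [pow_zero, mul_one]
      refine le_of_step (w := fun n : ℕ => w n) (b := fun _ => C) (f := fun _ => 0) hk
        (fun n hn => ?_) (by simp) hC
      have := hw n (by omega)
      rw [h _ (by omega)] at this
      exact_mod_cast this
  · right
    let N := n₁.toNat + n₂
    have hN1 : n₁ ≤ N := by omega
    have hN2 : n₂ ≤ N := by omega
    obtain ⟨C, hC⟩ := exists_nat_bound (w := fun n : ℕ => w n) (N := N)
      (fun n hn => hwt n (by omega)) k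
    have hNP : N ≤ N * P := Nat.le_mul_of_pos_right N hP
    refine ⟨N, a + N * P, d + 1, k * P, C + D, Nat.mul_pos hk hP, fun t => ?_, ?_⟩
    · induction t with
      | zero => simp
      | succ t ih =>
        obtain ⟨P, rfl⟩ : ∃ p, P = p + 1 := ⟨P - 1, by omega⟩
        let m := a + N * (P + 1) + t * (k * (P + 1)) + P * k
        have hm : n₁ ≤ m := by
          have : N ≤ m := by simp only [m]; omega
          omega
        have h1 : v ((a + N * (P + 1) + t * (k * (P + 1)) : ℕ) : ℤ) ≤ v m := by
          have := hmono ((a + N * (P + 1) + t * (k * (P + 1)) : ℕ) : ℤ) (by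
            have : N ≤ a + N * (P + 1) + t * (k * (P + 1)) := by omega
            omega) P
          exact_mod_cast this
        have h2 := hv m hm
        have e1 : (m : ℤ) + k = ((a + N * (P + 1) + (t + 1) * (k * (P + 1)) : ℕ) : ℤ) := by
          simp only [m]; push_cast; ring
        have e2 : a + N * (P + 1) + (t + 1) * (k * (P + 1)) =
          a + (N + (t + 1) * k) * (P + 1) := by ring
        rw [← e1, h2, e1]
        have h3 := hu (N + (t + 1) * k)
        rw [← e2] at h3
        rw [Nat.choose_succ_succ, Nat.cast_add]
        refine add_le_add (le_trans ?_ h3) (ih.trans h1)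
        exact_mod_cast Nat.choose_le_choose d (by nlinarith)
    · refine le_of_step (w := fun n : ℕ => w n) (b := fun n => (C + D) * (n + 1) ^ (d + 1))
        (f := fun n => D * (n + 2) ^ d) hk (fun n hn => ?_) (fun n _ => ?_) (fun n h1 h2 => ?_)
      · have := hw n (by omega)
        refine le_trans (by exact_mod_cast this) (add_le_add le_rfl ?_)
        have := hd (n + 1) (by omega)
        exact_mod_cast this
      · have h1 : (n + 2) ^ (d + 1) ≤ (n + k + 1) ^ (d + 1) := Nat.pow_le_pow_left (by omega) _
        have h2 : (n + 1) ^ d ≤ (n + 2) ^ d := Nat.pow_le_pow_left (by omega) _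
        have h3 : (n + 1) ^ (d + 1) + (n + 2) ^ d ≤ (n + 2) ^ (d + 1) := by
          rw [pow_succ, pow_succ]; nlinarith
        have h4 := Nat.mul_le_mul_left (C + D) (h3.trans h1)
        have h5 : D * (n + 2) ^ d ≤ (C + D) * (n + 2) ^ d := Nat.mul_le_mul_right _ (by omega)
        rw [mul_add] at h4
        exact le_trans (by omega) h4
      · refine (hC n h1 h2).trans ?_
        have : 1 ≤ (n + 1) ^ (d + 1) := Nat.one_le_pow _ _ (by omega)
        exact_mod_cast le_trans (Nat.le_add_right C D) (Nat.le_mul_of_pos_right _ this)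

namespace GradedDiff

theorem cone_fg_piece {A W : Type u} [CommRing A] [AddCommGroup W] [Module A W] {T : GradedDiff A W}
    (h : ∀ n, (T.piece n).FG) {s : ℤ} {q : W →ₗ[A] W} {hd : ∀ w, q (T.d w) = T.d (q w)}
    {hπ : ∀ n w, q (T.π (n + s + 1) w) = T.π n (q w)} (n : ℤ) :
    ((T.cone s q hd hπ).piece n).FG := by
  have heq : (T.cone s q hd hπ).piece n = (T.piece n).prod (T.piece (n + s)) := ?_
  · rw [heq]
    exact (h n).prod (h (n + s))
  ext w
  rw [mem_piece, cone_π_apply, Submodule.mem_prod, mem_piece, mem_piece, Prod.ext_iff]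

variable {σ : Type} [Fintype σ] {A V : Type u} [CommRing A] [IsLocalRing A] [IsNoetherianRing A]
  [AddCommGroup V] [Module A V] [Module (MvPolynomial σ A) V]
  [IsScalarTower A (MvPolynomial σ A) V] {G : GrMod σ A V}

/-- The complexity of a test module dominates. -/
theorem hasGrowth_of_isStage {M : Type u} [AddCommGroup M] [Module A M]
    (hM : IsCapitalTestModule A M) {R W' : Type u} [CommRing R] [Algebra A R]
    [AddCommGroup W'] [Module R W'] [Module A W'] [IsScalarTower A R W'] [Module.Flat A W']
    (X : GradedDiff R W') {n₁ : ℤ} (hX : ∀ n ≥ n₁, X.ExactAt n)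
    {U₀ : Submodule (MvPolynomial σ A) V} [IsArtinian (MvPolynomial σ A) U₀]
    {U : Submodule (MvPolynomial σ A) V} (hU : U ≤ U₀) (hUG : G.IsGr U) :
    ∀ (W : Type u) [AddCommGroup W] [Module A W] [Module (MvPolynomial σ A) W]
      [IsScalarTower A (MvPolynomial σ A) W] [Module.Projective A W] (T : GradedDiff A W)
      (_ : T.IsAct σ) (_ : ∀ n, (T.piece n).FG) (_ : ∀ n ≥ 1, T.ExactAt n)
      (_ : T.IsStage M G U) (_ : ∀ n ≥ n₁, X.hl A (T.coker 0) n ≠ ⊤),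
      HasGrowth (fun n => Module.length A (G.part U n)) fun n => X.hl A (T.coker 0) n := by
  refine isArtinian_induction (fun U => G.IsGr U →
    ∀ (W : Type u) [AddCommGroup W] [Module A W] [Module (MvPolynomial σ A) W]
      [IsScalarTower A (MvPolynomial σ A) W] [Module.Projective A W] (T : GradedDiff A W)
      (_ : T.IsAct σ) (_ : ∀ n, (T.piece n).FG) (_ : ∀ n ≥ 1, T.ExactAt n)
      (_ : T.IsStage M G U) (_ : ∀ n ≥ n₁, X.hl A (T.coker 0) n ≠ ⊤),
      HasGrowth (fun n => Module.length A (G.part U n)) fun n => X.hl A (T.coker 0) n) U₀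
    (fun U hU ih hUG W _ _ _ _ _ T hT hfg hex hst hne => ?_) hU hUG
  by_cases hbdd : G.IsBdd U
  · left
    obtain ⟨n₀, h₀⟩ := hst.exactAt hbdd
    have : Module.Finite A (T.piece 0) := Module.Finite.iff_fg.2 (hfg 0)
    have hfin : Module.Finite A (T.coker 0) :=
      Module.Finite.of_surjective (T.pieceToCoker 0) (T.pieceToCoker_surjective 0)
    obtain ⟨j, hj⟩ := hM (T.coker 0) hfin ⟨n₀.toNat + 1, fun i hi => by
      obtain ⟨i, rfl⟩ : ∃ i', i = i' + 1 := ⟨i - 1, by omega⟩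
      exact (T.torVanish_iff_exactAt A M hex (LinearEquiv.refl A _) i).2 (h₀ _ (by omega))⟩
    exact ⟨n₁ + j, fun n hn => X.hl_eq_zero_of_flatDimLE hX j _ hj n hn⟩
  · obtain ⟨q, r, m, hr, hq, hon⟩ := GrMod.exists_onto_in_large_degrees hU hUG
    obtain ⟨r, rfl⟩ : ∃ r', r = r' + 1 := ⟨r - 1, by omega⟩
    have hlt : U ⊓ LinearMap.ker (LinearMap.lsmul _ V q) < U := by
      refine lt_of_le_of_ne inf_le_left fun heq => hbdd ⟨m, fun n hn u hu => ?_⟩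
      have hpu : G.p n u ∈ U := hUG n u hu
      obtain ⟨u', hu', -, hqu⟩ := hon n hn _ hpu (G.p_same n u)
      rw [← heq] at hu'
      rw [← hqu]
      exact hu'.2
    have hst' := hst.cone hT hq hon
    have hne' := X.hl_cone_ne_top T hX hex (s := 2 * r + 1) (q := opA W q) (hd := hT.opA_d q)
      (hπ := hT.opA_π hq) hne
    have hG := ih _ hlt (hUG.inf_ker hq) (W × W) (hT.coneOf hq) (hT.isAct_coneOf hq)
      (cone_fg_piece hfg) (fun n hn => cone_exactAt _ (hex n hn) (hex _ (by omega))) hst' hne'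
    refine hG.step (k := 2 * r + 1 + 1) (by omega) (n₁ := max m n₁) (fun n hn => ?_) (fun n hn => ?_)
      (fun n hn => hne n (le_of_max_le_right hn)) fun N => ?_
    · have := GrMod.length_part_eq hq (hon n (le_of_max_le_left hn))
      rwa [show n + 2 * ((r + 1 : ℕ) : ℤ) = n + (2 * r + 1 + 1 : ℕ) by push_cast; ring] at this
    · have := X.hl_coker_le_cone T hX hex (s := 2 * r + 1) (q := opA W q) (hd := hT.opA_d q)
        (hπ := hT.opA_π hq) (le_of_max_le_right hn)
      exact this
    · by_contra hcon
      push Not at hcon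
      refine hbdd ⟨N, fun n hn u hu => ?_⟩
      have h0 := Module.length_eq_zero_iff.1 (Order.lt_one_iff.1 (hcon n hn))
      have hmem : G.p n u ∈ G.part U n := GrMod.mem_part.2 ⟨hUG n u hu, G.p_same n u⟩
      exact congrArg Subtype.val (Subsingleton.elim (⟨_, hmem⟩ : G.part U n) 0)

end GradedDiff

/-! ## Betti numbers and the growth dichotomy -/

namespace GradedDiff

open TensorProduct

section Length

variable {A W : Type u} [CommRing A] [AddCommGroup W] [Module A W] (T : GradedDiff A W)

theorem length_H_le_coker (n : ℤ) : Module.length A (T.H n) ≤ Module.length A (T.coker n) := by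
  let f : T.H n →ₗ[A] T.coker n := Submodule.liftQ _
    ((Submodule.mkQ _) ∘ₗ (T.Z n).subtype) (by
      intro w hw
      exact (Submodule.Quotient.mk_eq_zero _).2 (Submodule.mem_sup_right hw))
  refine Module.length_le_of_injective f ((injective_iff_map_eq_zero f).2 fun x hx => ?_)
  obtain ⟨w, hw, rfl⟩ := T.cls_surj x
  have h : w ∈ LinearMap.ker (T.π n) ⊔ T.B n := (Submodule.Quotient.mk_eq_zero _).1 hx
  rw [cls_eq_zero]
  have h2 := T.mem_ker_sup_B.1 h
  rwa [((mem_Z _).1 hw).1] at h2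

theorem hl_self_le (n : ℤ) : T.hl A A n ≤ Module.length A (T.H n) := by
  let e := TensorProduct.rid A W
  have hmor : IsMor (T.tensor A A) T e.toLinearMap := by
    constructor
    · intro z
      rw [tensor_d]
      induction z using TensorProduct.induction_on with
      | zero => simp
      | add x y hx hy => simp only [map_add, hx, hy]
      | tmul w a => simp [e]
    · intro n z
      rw [tensor_π]
      induction z using TensorProduct.induction_on with
      | zero => simp
      | add x y hx hy => simp only [map_add, hx, hy]
      | tmul w a => simp [e]
  refine Module.length_le_of_injective (hmor.hmap n)
    ((injective_iff_map_eq_zero _).2 fun x hx => ?_)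
  obtain ⟨z, hz, rfl⟩ := (T.tensor A A).cls_surj x
  rw [IsMor.hmap_cls, cls_eq_zero] at hx
  rw [cls_eq_zero]
  obtain ⟨u, -, hu⟩ := (mem_B _).1 hx
  refine (T.tensor A A).mem_B_of_d (u := e.symm u) (e.injective ?_) ((mem_Z _).1 hz).1
  exact (hmor.comm_d _).trans (by simpa using hu)

theorem hl_pi_le [Module.Flat A W] (k : ℕ) (n : ℤ) : T.hl A (Fin k → A) n ≤ k * T.hl A A n := by
  induction k with
  | zero =>
    rw [Nat.cast_zero, zero_mul, nonpos_iff_eq_zero, hl_eq_zero_iff]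
    intro z _
    rw [Subsingleton.elim z 0]
    exact zero_mem _
  | succ k ih =>
    let e : (Fin (k + 1) → A) ≃ₗ[A] A × (Fin k → A) :=
      (Fin.consLinearEquiv A fun _ : Fin (k + 1) => A).symm
    rw [T.hl_congr e n]
    refine (T.hl_le_add_middle LinearMap.inl_injective
      Function.Exact.inl_snd LinearMap.snd_surjective n).trans ?_
    rw [Nat.cast_succ, add_mul, one_mul, add_comm]
    gcongr

end Length

variable {σ : Type} {A W : Type u} [CommRing A]
  [AddCommGroup W] [Module A W] [Module (MvPolynomial σ A) W]
  [IsScalarTower A (MvPolynomial σ A) W] {T : GradedDiff A W}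

theorem IsTate.hl_self_zero_le [Fintype σ] [IsLocalRing A] (hT : T.IsTate σ) : T.hl A A 0 ≤ 1 := by
  refine (T.hl_self_le 0).trans ((T.length_H_le_coker 0).trans ?_)
  rw [hT.coker.some.length_eq]
  have : IsSimpleModule A (A ⧸ maximalIdeal A) :=
    isSimpleModule_iff_isCoatom.2 (maximalIdeal.isMaximal A).out
  exact (Module.length_eq_one A _).le

theorem IsTate.hl_le_card [Fintype σ] [IsLocalRing A] (hT : T.IsTate σ) (n : ℕ) :
    ∀ {M : Type u} [AddCommGroup M] [Module A M] (F : FreeRes A M) (_ : ∀ n, Finite (F.ι n)),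
      T.hl A M n ≤ Nat.card (F.ι n) := by
  have := hT.projective
  induction n with
  | zero =>
    intro M _ _ F hF
    have h := T.hl_le_add_right (Y₁ := LinearMap.ker F.ε) (Y₂ := F.ι 0 →₀ A)
      (f := (LinearMap.ker F.ε).subtype) (g := F.ε) (Submodule.subtype_injective _)
      (LinearMap.exact_subtype_ker_map F.ε) F.surjective (-1)
    have h0 : T.hl A (LinearMap.ker F.ε) (-1) = 0 := by
      rw [hl_eq_zero_iff]
      intro z hz
      have := ((mem_Z _).1 hz).1
      rw [tensor_π, rT_eq_zero (fun w => hT.π_neg (-1) (by norm_num) w)] at this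
      rw [← this]
      exact zero_mem _
    rw [h0, add_zero, neg_add_cancel] at h
    have hfin := hF 0
    let e : (F.ι 0 →₀ A) ≃ₗ[A] (Fin (Nat.card (F.ι 0)) → A) :=
      (Finsupp.domLCongr (Finite.equivFin (F.ι 0))).trans (Finsupp.linearEquivFunOnFinite A A _)
    rw [T.hl_congr e] at h
    refine h.trans ((T.hl_pi_le _ _).trans ?_)
    exact (mul_le_mul_right hT.hl_self_zero_le _).trans (mul_one _).le
  | succ n ih =>
    intro M _ _ F hF
    have h := T.hl_le_add_right (Y₁ := LinearMap.ker F.ε) (Y₂ := F.ι 0 →₀ A)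
      (f := (LinearMap.ker F.ε).subtype) (g := F.ε) (Submodule.subtype_injective _)
      (LinearMap.exact_subtype_ker_map F.ε) F.surjective n
    rw [T.hl_eq_zero_of_flat (Y := F.ι 0 →₀ A) (hT.exactAt _ (by omega)), zero_add] at h
    exact_mod_cast h.trans (ih F.shift fun n => hF (n + 1))

theorem IsAct.length_part_le (hT : T.IsAct σ) (n : ℤ) :
    Module.length A (hT.grMod.part hT.homology n) ≤ Module.length A (T.H n) := by
  let f : T.Z n →ₗ[A] hT.grMod.part hT.homology n :=
    LinearMap.codRestrict _ (((LinearMap.range hT.dS).mkQ.restrictScalars A) ∘ₗ (T.Z n).subtype)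
      fun w => GrMod.mem_part.2 ⟨⟨w, ((mem_Z _).1 w.2).2, rfl⟩,
        congrArg Submodule.Quotient.mk ((mem_Z _).1 w.2).1⟩
  let g : T.H n →ₗ[A] hT.grMod.part hT.homology n := Submodule.liftQ _ f (by
    intro w hw
    obtain ⟨u, -, hu⟩ := (mem_B _).1 (Submodule.mem_comap.1 hw)
    exact Subtype.ext ((Submodule.Quotient.mk_eq_zero _).2 ⟨u, hu⟩))
  refine Module.length_le_of_surjective g ?_
  rintro ⟨v, hv⟩
  obtain ⟨⟨w, hw, rfl⟩, hp⟩ := GrMod.mem_part.1 hv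
  have hw : T.d w = 0 := hw
  refine ⟨T.cls (T.π n w) ((mem_Z _).2 ⟨T.π_same n w, ?_⟩), Subtype.ext hp⟩
  rw [d_π_sub, hw, map_zero]

theorem IsTate.growthDichotomy [Fintype σ] [IsLocalRing A] [IsNoetherianRing A]
    (hT : T.IsTate σ) {M : Type u} [AddCommGroup M] [Module A M] [Module.Finite A M]
    (hM : IsCapitalTestModule A M)
    (F : FreeRes A M) (hF : ∀ n, Finite (F.ι n)) :
    GrowthDichotomy A fun n => Nat.card (F.ι n) := by
  intro R W' _ _ _ _ _ _ _ X n₁ hX hl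
  have := hT.projective
  have := hT.isArtinian_homology M
  have e := hT.coker.some
  have hG := hasGrowth_of_isStage hM X hX le_rfl (hT.tensor M).isGr_homology W T hT.toIsAct
    hT.fg_piece hT.exactAt (isStage_homology hT.toIsAct M) fun n _ => by
      rw [X.hl_congr e n]
      exact hl n
  simp only [X.hl_congr e] at hG
  refine hG.imp id ?_
  rintro ⟨n₂, a, d, P, D, hP, hv, hw⟩
  refine ⟨n₂, a, d, P, D, hP, fun t => ?_, hw⟩
  have h := (hv t).trans (((hT.tensor M).length_part_le _).trans (hT.hl_le_card (a + t * P) F hF))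
  exact_mod_cast h

end GradedDiff

/-! ## Regular local rings -/

theorem IsLocalRing.quotient_of_le {Q : Type*} [CommRing Q] [IsLocalRing Q] {I : Ideal Q}
    (hI : I ≤ maximalIdeal Q) : IsLocalRing (Q ⧸ I) :=
  have : Nontrivial (Q ⧸ I) := Ideal.Quotient.nontrivial_iff.2 fun h =>
    (maximalIdeal.isMaximal Q).ne_top (top_le_iff.1 (h ▸ hI))
  IsLocalRing.of_surjective' (Ideal.Quotient.mk I) Ideal.Quotient.mk_surjective

theorem exists_notMem_sq_minimalPrimes {Q : Type*} [CommRing Q] [IsNoetherianRing Q]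
    [IsLocalRing Q] (h : (1 : WithBot ℕ∞) ≤ ringKrullDim Q) :
    ∃ x ∈ maximalIdeal Q, x ∉ maximalIdeal Q ^ 2 ∧ ∀ p ∈ minimalPrimes Q, x ∉ p := by
  classical
  have hm : ∀ p ∈ minimalPrimes Q, ¬ maximalIdeal Q ≤ p := fun p hp hle => by
    have := hp.1.1
    have : p = maximalIdeal Q := le_antisymm (le_maximalIdeal this.ne_top) hle
    have h0 := Ideal.height_eq_zero_iff.2 hp
    rw [this] at h0
    have := IsLocalRing.maximalIdeal_height_eq_ringKrullDim (R := Q)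
    rw [h0] at this
    rw [← this] at h
    exact absurd h (by decide)
  have hsq : ¬ maximalIdeal Q ≤ maximalIdeal Q ^ 2 := fun hle => by
    have : maximalIdeal Q = ⊥ := by
      refine Submodule.eq_bot_of_le_smul_of_le_jacobson_bot (maximalIdeal Q) _
        (IsNoetherian.noetherian _) ?_ (IsLocalRing.maximalIdeal_le_jacobson _)
      rwa [smul_eq_mul, ← pow_two]
    rw [ringKrullDim_eq_zero_of_isField (IsLocalRing.isField_iff_maximalIdeal_eq.2 this)] at h
    exact absurd h (by decide)
  have hfin : (minimalPrimes Q).Finite := Ideal.finite_minimalPrimes_of_isNoetherianRing Q ⊥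
  have key := (Ideal.subset_union_prime (s := insert (maximalIdeal Q ^ 2) hfin.toFinset)
    (f := id) (maximalIdeal Q ^ 2) (maximalIdeal Q ^ 2) (fun i hi h1 _ => by
      simp only [Finset.mem_insert, Set.Finite.mem_toFinset] at hi
      exact (hi.resolve_left h1).1.1) (I := maximalIdeal Q)).not.2 (by
    rintro ⟨i, hi, hle⟩
    simp only [Finset.mem_insert, Set.Finite.mem_toFinset] at hi
    rcases hi with rfl | hi
    · exact hsq hle
    · exact hm i hi hle)
  obtain ⟨x, hx, hx'⟩ := Set.not_subset.1 key
  simp only [Finset.coe_insert, Set.Finite.coe_toFinset, Set.mem_iUnion, not_exists, id,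
    SetLike.mem_coe] at hx'
  exact ⟨x, hx, hx' _ (Set.mem_insert _ _), fun p hp => hx' p (Set.mem_insert_of_mem _ hp)⟩

/-- A local ring of dimension at least `e` whose maximal ideal is generated by `e` elements is a
domain. -/
theorem isDomain_of_span_eq_maximalIdeal : ∀ (e : ℕ) (Q : Type u) [CommRing Q]
    [IsNoetherianRing Q] [IsLocalRing Q] (s : Finset Q),
    Ideal.span (s : Set Q) = maximalIdeal Q → s.card ≤ e → (e : WithBot ℕ∞) ≤ ringKrullDim Q →
    IsDomain Q := by
  classical
  intro e
  induction e with
  | zero =>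
    intro Q _ _ _ s hs hc _
    rw [Finset.card_eq_zero.1 (Nat.le_zero.1 hc), Finset.coe_empty, Ideal.span_empty] at hs
    exact (IsLocalRing.isField_iff_maximalIdeal_eq.2 hs.symm).isDomain
  | succ e ih =>
    intro Q _ _ _ s hs hc hd
    obtain ⟨x, hxm, hx2, hxp⟩ := exists_notMem_sq_minimalPrimes (Q := Q)
      (le_trans (by exact_mod_cast Nat.le_add_left 1 e) hd)
    have hxs := hxm
    rw [← hs] at hxs
    obtain ⟨a, -, ha⟩ := Submodule.mem_span_finset.1 hxs
    obtain ⟨j, hj, hu⟩ : ∃ j ∈ s, IsUnit (a j) := by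
      by_contra! hne
      refine hx2 (ha ▸ Ideal.sum_mem _ fun i hi => ?_)
      rw [smul_eq_mul, pow_two]
      exact Ideal.mul_mem_mul ((mem_maximalIdeal _).2 (hne i hi)) (hs ▸ Ideal.subset_span hi)
    have hle : Ideal.span {x} ≤ maximalIdeal Q := (Ideal.span_singleton_le_iff_mem _).2 hxm
    have : IsLocalRing (Q ⧸ Ideal.span {x}) := IsLocalRing.quotient_of_le hle
    have hprime : IsDomain (Q ⧸ Ideal.span {x}) := by
      refine ih (Q ⧸ Ideal.span {x}) ((s.erase j).image (Ideal.Quotient.mk _)) ?_ ?_ ?_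
      · rw [← IsLocalRing.map_maximalIdeal_of_surjective (Ideal.Quotient.mk (Ideal.span {x}))
          Ideal.Quotient.mk_surjective, ← hs, Finset.coe_image, ← Ideal.map_span]
        refine le_antisymm (Ideal.map_mono (Ideal.span_mono (Finset.coe_subset.2
          (Finset.erase_subset _ _)))) (Ideal.map_le_iff_le_comap.2 (Ideal.span_le.2 fun i hi => ?_))
        by_cases hij : i = j
        · subst hij
          obtain ⟨v, hv⟩ := hu.exists_left_inv
          have h1 : i = v * x - v * ∑ k ∈ s.erase i, a k • k := by
            rw [← ha, ← Finset.add_sum_erase s _ hj, mul_add, add_sub_cancel_right, smul_eq_mul,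
              ← mul_assoc, hv, one_mul]
          have h2 : Ideal.Quotient.mk (Ideal.span {x}) i =
              - Ideal.Quotient.mk _ (v * ∑ k ∈ s.erase i, a k • k) := by
            conv_lhs => rw [h1]
            rw [map_sub, map_mul _ v x, Ideal.Quotient.eq_zero_iff_mem.2
              (Ideal.mem_span_singleton_self x), mul_zero, zero_sub]
          rw [SetLike.mem_coe, Ideal.mem_comap, h2]
          refine neg_mem (Ideal.mem_map_of_mem _ (Ideal.mul_mem_left _ _ (Ideal.sum_mem _
            fun k hk => ?_)))
          exact Ideal.mul_mem_left _ _ (Ideal.subset_span hk)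
        · exact Ideal.mem_map_of_mem _ (Ideal.subset_span (Finset.mem_coe.2
            (Finset.mem_erase.2 ⟨hij, hi⟩)))
      · refine Finset.card_image_le.trans ?_
        rw [Finset.card_erase_of_mem hj]
        omega
      · have h1 := ringKrullDim_le_ringKrullDim_quotient_add_card ({x} : Finset Q) (by
          rw [IsLocalRing.ringJacobson_eq_maximalIdeal]; simpa using hxm)
        rw [Finset.coe_singleton, Finset.card_singleton] at h1
        have h2 := hd.trans h1
        rw [Nat.cast_add] at h2
        exact ENat.WithBot.add_le_add_natCast_right_iff.mp h2
    have hpr : (Ideal.span {x}).IsPrime := (Ideal.Quotient.isDomain_iff_prime _).1 hprime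
    obtain ⟨p, hp, hpx⟩ := Ideal.exists_minimalPrimes_le (I := ⊥) (J := Ideal.span {x}) bot_le
    have hpp := hp.1.1
    have hp0 : p = ⊥ := by
      refine Submodule.eq_bot_of_le_smul_of_le_jacobson_bot (Ideal.span {x}) _
        (IsNoetherian.noetherian _) (fun y hy => ?_)
        (hle.trans (IsLocalRing.maximalIdeal_le_jacobson _))
      obtain ⟨r, rfl⟩ := Ideal.mem_span_singleton'.1 (hpx hy)
      rw [mul_comm, smul_eq_mul]
      exact Ideal.mul_mem_mul (Ideal.mem_span_singleton_self x)
        ((hpp.mem_or_mem hy).resolve_right (hxp p hp))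
    rw [hp0] at hpp
    exact (IsDomain.of_bot_isPrime Q)

/-- The ideal generated by the first `k` terms of a sequence. -/
def initIdeal {Q : Type*} [CommRing Q] (x : ℕ → Q) (k : ℕ) : Ideal Q :=
  Ideal.span (x '' Set.Iio k)

theorem mem_initIdeal {Q : Type*} [CommRing Q] (x : ℕ → Q) {j k : ℕ} (h : j < k) :
    x j ∈ initIdeal x k :=
  Ideal.subset_span ⟨j, h, rfl⟩

theorem initIdeal_mono {Q : Type*} [CommRing Q] (x : ℕ → Q) {j k : ℕ} (h : j ≤ k) :
    initIdeal x j ≤ initIdeal x k :=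
  Ideal.span_mono (Set.image_mono (Set.Iio_subset_Iio h))

theorem initIdeal_succ {Q : Type*} [CommRing Q] (x : ℕ → Q) (k : ℕ) :
    initIdeal x (k + 1) = Ideal.span {x k} ⊔ initIdeal x k := by
  rw [initIdeal, initIdeal, ← Ideal.span_union]
  congr 1
  ext z
  constructor
  · rintro ⟨j, hj, rfl⟩
    rcases (Nat.lt_succ_iff.1 hj).lt_or_eq with h | rfl
    · exact Or.inr ⟨j, h, rfl⟩
    · exact Or.inl rfl
  · rintro (rfl | ⟨j, hj, rfl⟩)
    · exact ⟨k, Nat.lt_succ_self k, rfl⟩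
    · exact ⟨j, Nat.lt_succ_of_lt hj, rfl⟩

theorem mem_initIdeal_succ {Q : Type*} [CommRing Q] (x : ℕ → Q) (k : ℕ) {z : Q} :
    z ∈ initIdeal x (k + 1) ↔ ∃ a, ∃ b ∈ initIdeal x k, a * x k + b = z := by
  rw [initIdeal_succ, Ideal.mem_span_singleton_sup]

theorem mul_mem_initIdeal_imp {Q : Type u} [CommRing Q] [IsNoetherianRing Q] [IsLocalRing Q]
    (x : ℕ → Q) (e : ℕ) (hx : initIdeal x e = maximalIdeal Q)
    (hd : (e : WithBot ℕ∞) ≤ ringKrullDim Q) {k : ℕ} (hk : k < e) {r : Q}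
    (hr : x k * r ∈ initIdeal x k) : r ∈ initIdeal x k := by
  classical
  have hle : initIdeal x k ≤ maximalIdeal Q := hx ▸ initIdeal_mono x hk.le
  have : IsLocalRing (Q ⧸ initIdeal x k) := IsLocalRing.quotient_of_le hle
  have hdom : IsDomain (Q ⧸ initIdeal x k) := by
    refine isDomain_of_span_eq_maximalIdeal (e - k) _
      ((Finset.Ico k e).image fun j => Ideal.Quotient.mk _ (x j)) ?_ ?_ ?_
    · rw [← IsLocalRing.map_maximalIdeal_of_surjective (Ideal.Quotient.mk (initIdeal x k))
        Ideal.Quotient.mk_surjective, ← hx]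
      refine le_antisymm (Ideal.span_le.2 ?_) (Ideal.map_le_iff_le_comap.2 (Ideal.span_le.2 ?_))
      · rintro _ hz
        obtain ⟨j, hj, rfl⟩ := Finset.mem_image.1 (Finset.mem_coe.1 hz)
        exact Ideal.mem_map_of_mem _ (mem_initIdeal x (Finset.mem_Ico.1 hj).2)
      · rintro _ ⟨j, hj, rfl⟩
        by_cases hjk : j < k
        · rw [SetLike.mem_coe, Ideal.mem_comap, Ideal.Quotient.eq_zero_iff_mem.2 (mem_initIdeal x hjk)]
          exact zero_mem _
        · exact Ideal.subset_span (Finset.mem_coe.2 (Finset.mem_image.2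
            ⟨j, Finset.mem_Ico.2 ⟨not_lt.1 hjk, hj⟩, rfl⟩))
    · exact Finset.card_image_le.trans (Nat.card_Ico k e).le
    · have h1 := ringKrullDim_le_ringKrullDim_quotient_add_card ((Finset.range k).image x) (by
        rw [IsLocalRing.ringJacobson_eq_maximalIdeal]
        refine subset_trans ?_ hle
        intro z hz
        obtain ⟨j, hj, rfl⟩ := Finset.mem_image.1 (Finset.mem_coe.1 hz)
        exact mem_initIdeal x (Finset.mem_range.1 hj))
      have h3 : Ideal.span (((Finset.range k).image x : Finset Q) : Set Q) = initIdeal x k := by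
        rw [Finset.coe_image, Finset.coe_range, initIdeal]
      rw [h3] at h1
      have h4 : (((Finset.range k).image x).card : WithBot ℕ∞) ≤ (k : WithBot ℕ∞) := by
        exact_mod_cast Finset.card_image_le.trans (Finset.card_range k).le
      have h2 := hd.trans (h1.trans (add_le_add_right h4 _))
      rw [show e = (e - k) + k by omega, Nat.cast_add] at h2
      exact ENat.WithBot.add_le_add_natCast_right_iff.mp h2
  have hpr : (initIdeal x k).IsPrime := (Ideal.Quotient.isDomain_iff_prime _).1 hdom
  refine (hpr.mem_or_mem hr).resolve_left fun hmem => ?_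
  have hgen : Ideal.span ((((Finset.range e).erase k).image x : Finset Q) : Set Q)
      = maximalIdeal Q := by
    rw [← hx]
    refine le_antisymm (Ideal.span_le.2 ?_) (Ideal.span_le.2 ?_)
    · rintro _ hz
      obtain ⟨j, hj, rfl⟩ := Finset.mem_image.1 (Finset.mem_coe.1 hz)
      exact mem_initIdeal x (Finset.mem_range.1 (Finset.mem_of_mem_erase hj))
    · rintro _ ⟨j, hj, rfl⟩
      by_cases hjk : j = k
      · subst hjk
        refine (Ideal.span_le.2 ?_ : initIdeal x j ≤ _) hmem
        rintro _ ⟨i, hi, rfl⟩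
        have hi' : i < j := hi
        exact Ideal.subset_span (Finset.mem_coe.2 (Finset.mem_image.2
          ⟨i, Finset.mem_erase.2 ⟨hi'.ne, Finset.mem_range.2 (hi'.trans hk)⟩, rfl⟩))
      · exact Ideal.subset_span (Finset.mem_coe.2 (Finset.mem_image.2
          ⟨j, Finset.mem_erase.2 ⟨hjk, Finset.mem_range.2 hj⟩, rfl⟩))
  have hc := Submodule.spanFinrank_span_le_ncard_of_finite
    (R := Q) (Finset.finite_toSet (((Finset.range e).erase k).image x))
  have hc2 : (((Finset.range e).erase k).image x).card ≤ e - 1 := by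
    refine Finset.card_image_le.trans ?_
    rw [Finset.card_erase_of_mem (Finset.mem_range.2 hk), Finset.card_range]
  rw [Set.ncard_coe_finset] at hc
  have h5 := ringKrullDim_le_spanFinrank_maximalIdeal (R := Q)
  rw [← hgen] at h5
  have h6 := hd.trans h5
  have h7 : e ≤ (Ideal.span ((((Finset.range e).erase k).image x : Finset Q) : Set Q)).spanFinrank
    := by exact_mod_cast h6
  have : e ≤ e - 1 := h7.trans (hc.trans hc2)
  omega

/-! ## Koszul factorizations -/

/-- The standard basis of an exterior algebra on `n` generators. -/
def KIdx : ℕ → Type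
  | 0 => Unit
  | n + 1 => KIdx n ⊕ KIdx n

namespace KIdx

instance instFintype : ∀ n, Fintype (KIdx n)
  | 0 => inferInstanceAs (Fintype Unit)
  | n + 1 =>
    have := instFintype n
    inferInstanceAs (Fintype (KIdx n ⊕ KIdx n))

instance instDecidableEq : ∀ n, DecidableEq (KIdx n)
  | 0 => inferInstanceAs (DecidableEq Unit)
  | n + 1 =>
    have := instDecidableEq n
    inferInstanceAs (DecidableEq (KIdx n ⊕ KIdx n))

/-- The basis element `1`. -/
def bot : ∀ n, KIdx n
  | 0 => ()
  | n + 1 => Sum.inl (bot n)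

/-- The basis elements not involving the last generator. -/
def inl {n : ℕ} (s : KIdx n) : KIdx (n + 1) := Sum.inl s

/-- The basis elements involving the last generator. -/
def inr {n : ℕ} (s : KIdx n) : KIdx (n + 1) := Sum.inr s

/-- The exterior degree. -/
def deg : ∀ {n : ℕ}, KIdx n → ℕ
  | 0 => fun _ => 0
  | _ + 1 => Sum.elim (fun s => deg s) fun s => deg s + 1

@[simp] theorem deg_inl {n : ℕ} (s : KIdx n) : deg (inl s) = deg s := rfl

@[simp] theorem deg_inr {n : ℕ} (s : KIdx n) : deg (inr s) = deg s + 1 := rfl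

theorem cases {n : ℕ} {P : KIdx (n + 1) → Prop} (hl : ∀ s, P (inl s)) (hr : ∀ s, P (inr s)) :
    ∀ s, P s
  | Sum.inl s => hl s
  | Sum.inr s => hr s

theorem deg_eq_zero : ∀ {n : ℕ} {s : KIdx n}, deg s = 0 ↔ s = bot n
  | 0, _ => ⟨fun _ => rfl, fun _ => rfl⟩
  | n + 1, s => by
    refine cases (P := fun s => deg s = 0 ↔ s = bot (n + 1)) (fun s => ?_) (fun s => ?_) s
    · rw [deg_inl, deg_eq_zero]
      exact ⟨fun h => congrArg _ h, fun h => Sum.inl_injective h⟩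
    · rw [deg_inr]
      exact ⟨fun h => absurd h (Nat.succ_ne_zero _), fun h => nomatch h⟩

variable {S : Type*} [CommRing S] {V : Type*} [AddCommGroup V] [Module S V]

/-- The Koszul factorization of `∑ yⱼ ζⱼ`: contraction with `y` plus multiplication by `ζ`. -/
def kd (y ζ : ℕ → S) : ∀ n, (KIdx n → V) →ₗ[S] (KIdx n → V)
  | 0 => 0
  | n + 1 => LinearMap.pi (Sum.elim
      (fun s => LinearMap.proj s ∘ₗ kd y ζ n ∘ₗ LinearMap.funLeft S V inl +
        y n • LinearMap.proj (inr s))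
      (fun s => ζ n • LinearMap.proj (inl s) -
        LinearMap.proj s ∘ₗ kd y ζ n ∘ₗ LinearMap.funLeft S V inr))

/-- Left multiplication by the `j`-th generator. -/
def ke (S : Type*) [CommRing S] {V : Type*} [AddCommGroup V] [Module S V] (j : ℕ) :
    ∀ n, (KIdx n → V) →ₗ[S] (KIdx n → V)
  | 0 => 0
  | n + 1 => LinearMap.pi (Sum.elim
      (fun s => if j = n then 0 else LinearMap.proj s ∘ₗ ke S j n ∘ₗ LinearMap.funLeft S V inl)
      (fun s => if j = n then LinearMap.proj (inl s) else
        - LinearMap.proj s ∘ₗ ke S j n ∘ₗ LinearMap.funLeft S V inr))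

variable (y ζ : ℕ → S)

theorem kd_inl {n : ℕ} (w : KIdx (n + 1) → V) (s : KIdx n) :
    kd y ζ (n + 1) w (inl s) = kd y ζ n (w ∘ inl) s + y n • w (inr s) := rfl

theorem kd_inr {n : ℕ} (w : KIdx (n + 1) → V) (s : KIdx n) :
    kd y ζ (n + 1) w (inr s) = ζ n • w (inl s) - kd y ζ n (w ∘ inr) s := rfl

theorem kd_comp_inl {n : ℕ} (w : KIdx (n + 1) → V) :
    kd y ζ (n + 1) w ∘ inl = kd y ζ n (w ∘ inl) + y n • (w ∘ inr) := rfl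

theorem kd_comp_inr {n : ℕ} (w : KIdx (n + 1) → V) :
    kd y ζ (n + 1) w ∘ inr = ζ n • (w ∘ inl) - kd y ζ n (w ∘ inr) := rfl

theorem ke_comp_inl {n j : ℕ} (w : KIdx (n + 1) → V) :
    ke S j (n + 1) w ∘ inl = if j = n then 0 else ke S j n (w ∘ inl) := by
  funext s
  change (if j = n then (0 : (KIdx (n + 1) → V) →ₗ[S] V) else _) w = _
  split_ifs <;> rfl

theorem ke_comp_inr {n j : ℕ} (w : KIdx (n + 1) → V) :
    ke S j (n + 1) w ∘ inr = if j = n then w ∘ inl else - ke S j n (w ∘ inr) := by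
  funext s
  change (if j = n then (LinearMap.proj (inl s) : (KIdx (n + 1) → V) →ₗ[S] V) else _) w = _
  split_ifs <;> rfl

theorem ext_comp {V : Type*} {n : ℕ} {w w' : KIdx (n + 1) → V} (hl : w ∘ inl = w' ∘ inl)
    (hr : w ∘ inr = w' ∘ inr) : w = w' :=
  funext (cases (fun s => congrFun hl s) fun s => congrFun hr s)

theorem kd_kd : ∀ (n : ℕ) (w : KIdx n → V),
    kd y ζ n (kd y ζ n w) = (∑ j ∈ Finset.range n, y j * ζ j) • w
  | 0, w => by simp [kd]
  | n + 1, w => by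
    refine ext_comp ?_ ?_
    · rw [kd_comp_inl, kd_comp_inl, kd_comp_inr, map_add, kd_kd n, map_smul, Finset.sum_range_succ]
      change _ = (_ + _ : S) • (w ∘ inl)
      rw [add_smul, mul_smul, smul_sub]
      abel
    · rw [kd_comp_inr, kd_comp_inl, kd_comp_inr, map_sub, kd_kd n, map_smul, Finset.sum_range_succ]
      change _ = (_ + _ : S) • (w ∘ inr)
      rw [add_smul, mul_comm (y n), mul_smul, smul_add]
      abel

theorem kd_ke : ∀ (n : ℕ) {j : ℕ} (_ : j < n) (w : KIdx n → V),
    kd y ζ n (ke S j n w) + ke S j n (kd y ζ n w) = y j • w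
  | n + 1, j, hj, w => by
    by_cases h : j = n
    · refine ext_comp ?_ ?_
      · change kd y ζ (n + 1) _ ∘ inl + ke S j (n + 1) _ ∘ inl = y j • (w ∘ inl)
        rw [kd_comp_inl, ke_comp_inl, ke_comp_inl, ke_comp_inr, if_pos h, if_pos h, if_pos h,
          map_zero, h]
        abel
      · change kd y ζ (n + 1) _ ∘ inr + ke S j (n + 1) _ ∘ inr = y j • (w ∘ inr)
        rw [kd_comp_inr, ke_comp_inl, ke_comp_inr, ke_comp_inr, if_pos h, if_pos h, if_pos h,
          smul_zero, kd_comp_inl, h]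
        abel
    · have ih := kd_ke n (show j < n by omega)
      refine ext_comp ?_ ?_
      · change kd y ζ (n + 1) _ ∘ inl + ke S j (n + 1) _ ∘ inl = y j • (w ∘ inl)
        rw [kd_comp_inl, ke_comp_inl, ke_comp_inl, ke_comp_inr, if_neg h, if_neg h, if_neg h,
          kd_comp_inl, map_add, map_smul, ← ih, smul_neg]
        abel
      · change kd y ζ (n + 1) _ ∘ inr + ke S j (n + 1) _ ∘ inr = y j • (w ∘ inr)
        rw [kd_comp_inr, ke_comp_inl, ke_comp_inr, ke_comp_inr, if_neg h, if_neg h, if_neg h,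
          kd_comp_inr, map_sub, map_smul, ← ih, map_neg]
        abel

/-- Koszul factorizations are natural. -/
theorem kd_map {S' V' : Type*} [CommRing S'] [AddCommGroup V'] [Module S' V'] {y' ζ' : ℕ → S'}
    (F : V →+ V') : ∀ (n : ℕ) (_ : ∀ j < n, ∀ v, F (y j • v) = y' j • F v)
    (_ : ∀ j < n, ∀ v, F (ζ j • v) = ζ' j • F v) (w : KIdx n → V),
    kd y' ζ' n (F ∘ w) = F ∘ kd y ζ n w
  | 0, _, _, w => funext fun _ => (map_zero F).symm
  | n + 1, hy, hζ, w => by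
    have ih := kd_map F n (fun j hj => hy j (by omega)) (fun j hj => hζ j (by omega))
    refine funext (cases (fun s => ?_) fun s => ?_)
    · rw [kd_inl, Function.comp_assoc, ih]
      simp only [Function.comp_apply, kd_inl, map_add, hy n (Nat.lt_succ_self n)]
    · rw [kd_inr, Function.comp_assoc, ih]
      simp only [Function.comp_apply, kd_inr, map_sub, hζ n (Nat.lt_succ_self n)]

theorem kd_bot_mem (N : Submodule S V) : ∀ (n : ℕ) (_ : ∀ j < n, ∀ v : V, y j • v ∈ N)
    (w : KIdx n → V), kd y ζ n w (bot n) ∈ N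
  | 0, _, _ => N.zero_mem
  | n + 1, h, w => by
    change kd y ζ (n + 1) w (inl (bot n)) ∈ N
    rw [kd_inl]
    exact N.add_mem (kd_bot_mem N n (fun j hj => h j (by omega)) _) (h n (Nat.lt_succ_self n) _)

theorem kd_mem (N : Submodule S V) : ∀ (n : ℕ) {w : KIdx n → V} (_ : ∀ s, w s ∈ N),
    ∀ s, kd y ζ n w s ∈ N
  | 0, _, _ => fun _ => N.zero_mem
  | n + 1, _, h => cases
      (fun s => N.add_mem (kd_mem N n (fun s => h (inl s)) s) (N.smul_mem _ (h _)))
      fun s => N.sub_mem (N.smul_mem _ (h _)) (kd_mem N n (fun s => h (inr s)) s)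

theorem single_bot_comp_inl {n : ℕ} (v : V) :
    (Pi.single (bot (n + 1)) v : KIdx (n + 1) → V) ∘ inl = Pi.single (bot n) v := by
  funext s
  by_cases h : s = bot n
  · subst h
    exact (Pi.single_eq_same (M := fun _ => V) (bot (n + 1)) v).trans
      (Pi.single_eq_same (M := fun _ => V) (bot n) v).symm
  · rw [Pi.single_eq_of_ne h]
    exact Pi.single_eq_of_ne (M := fun _ => V) (i := bot (n + 1)) (i' := inl s)
      (fun h' => h (Sum.inl_injective h')) v

theorem single_bot_comp_inr {n : ℕ} (v : V) :
    (Pi.single (bot (n + 1)) v : KIdx (n + 1) → V) ∘ inr = 0 :=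
  funext fun s => Pi.single_eq_of_ne (M := fun _ => V) (i := bot (n + 1)) (i' := inr s)
    (fun h => nomatch h) v

theorem kd_single_bot : ∀ (n : ℕ) {v : V} (_ : ∀ j < n, ζ j • v = 0),
    kd y ζ n (Pi.single (bot n) v) = 0
  | 0, _, _ => rfl
  | n + 1, v, h => by
    refine ext_comp ?_ ?_
    · rw [kd_comp_inl, single_bot_comp_inl, single_bot_comp_inr,
        kd_single_bot n fun j hj => h j (by omega), smul_zero, add_zero]
      rfl
    · rw [kd_comp_inr, single_bot_comp_inl, single_bot_comp_inr, map_zero, sub_zero,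
        ← Pi.single_smul, h n (Nat.lt_succ_self n), Pi.single_zero]
      rfl

/-- Multiples of `1` by elements of the ideal generated by `y` are boundaries. -/
theorem exists_kd_eq_single_bot (n : ℕ) {v : V} (hv : ∀ j < n, ζ j • v = 0) {a : S}
    (ha : a ∈ initIdeal y n) : ∃ u, kd y ζ n u = Pi.single (bot n) (a • v) := by
  induction ha using Submodule.span_induction with
  | mem a h =>
    obtain ⟨j, hj, rfl⟩ := h
    refine ⟨ke S j n (Pi.single (bot n) v), ?_⟩
    have := kd_ke y ζ n hj (Pi.single (bot n) v)
    rwa [kd_single_bot y ζ n hv, map_zero, add_zero, ← Pi.single_smul] at this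
  | zero => exact ⟨0, by rw [map_zero, zero_smul, Pi.single_zero]⟩
  | add a b _ _ h h' =>
    obtain ⟨u, hu⟩ := h
    obtain ⟨u', hu'⟩ := h'
    exact ⟨u + u', by rw [map_add, hu, hu', add_smul, Pi.single_add]⟩
  | smul r a _ h =>
    obtain ⟨u, hu⟩ := h
    exact ⟨r • u, by rw [map_smul, hu, smul_eq_mul, mul_smul, ← Pi.single_smul]⟩

/-- The Koszul complex of a regular sequence is acyclic. -/
theorem exists_of_kd_eq_zero : ∀ (n : ℕ)
    (_ : ∀ k < n, ∀ r, y k * r ∈ initIdeal y k → r ∈ initIdeal y k) (w : KIdx n → S)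
    (_ : kd y 0 n w = 0), ∃ u a, w = kd y 0 n u + Pi.single (bot n) a
  | 0, _, w, _ => ⟨0, w (), funext fun s => by
      rw [map_zero, zero_add]
      exact (Pi.single_eq_same (M := fun _ => S) (bot 0) _).symm⟩
  | n + 1, h, w, hw => by
    have ih := exists_of_kd_eq_zero n fun k hk => h k (by omega)
    have hl := kd_comp_inl y 0 w
    have hr := kd_comp_inr y 0 w
    rw [hw] at hl hr
    have hr' : kd y 0 n (w ∘ inr) = 0 := by
      have : (0 : ℕ → S) n • (w ∘ inl) = 0 := zero_smul S _
      rw [this, zero_sub] at hr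
      exact neg_eq_zero.1 hr.symm
    obtain ⟨u, β, hu⟩ := ih _ hr'
    have hb : β ∈ initIdeal y n := by
      refine h n (Nat.lt_succ_self n) β ?_
      have h0 := congrFun hl (bot n)
      rw [hu] at h0
      have h1 : (0 : S) = kd y 0 n (w ∘ inl) (bot n) +
        y n * (kd y 0 n u (bot n) + (Pi.single (bot n) β : KIdx n → S) (bot n)) := h0
      rw [Pi.single_eq_same, mul_add] at h1
      have hm : ∀ v, kd y 0 n v (bot n) ∈ initIdeal y n := kd_bot_mem y 0 (initIdeal y n) n
        fun j hj v => Ideal.mul_mem_right _ _ (mem_initIdeal y hj)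
      have h2 : y n * β = -(kd y 0 n (w ∘ inl) (bot n) + y n * kd y 0 n u (bot n)) := by
        linear_combination -h1
      rw [h2]
      exact neg_mem (add_mem (hm _) (Ideal.mul_mem_left _ _ (hm _)))
    obtain ⟨u₁, hu₁⟩ := exists_kd_eq_single_bot y 0 n (v := (1 : S)) (fun _ _ => zero_smul S _) hb
    rw [smul_eq_mul, mul_one] at hu₁
    have hu₂ : w ∘ inr = kd y 0 n (u + u₁) := by rw [hu, map_add, hu₁]
    obtain ⟨u₃, a, h₃⟩ := ih (w ∘ inl + y n • (u + u₁)) (by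
      rw [map_add, map_smul, ← hu₂]
      exact hl.symm)
    refine ⟨Sum.elim u₃ (-(u + u₁)), a, ext_comp ?_ ?_⟩
    · have e1 : (kd y 0 (n + 1) (Sum.elim u₃ (-(u + u₁))) + Pi.single (bot (n + 1)) a) ∘ inl =
        kd y 0 n u₃ + y n • (-(u + u₁)) + Pi.single (bot n) a := by
        rw [← single_bot_comp_inl (n := n) a]; rfl
      rw [e1, smul_neg, eq_sub_of_add_eq h₃]
      abel
    · have e1 : (kd y 0 (n + 1) (Sum.elim u₃ (-(u + u₁))) + Pi.single (bot (n + 1)) a) ∘ inr =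
        (0 : ℕ → S) n • u₃ - kd y 0 n (-(u + u₁)) + 0 := by
        rw [← single_bot_comp_inr a]; rfl
      have : (0 : ℕ → S) n • u₃ = 0 := zero_smul S _
      rw [e1, hu₂, map_neg, this]
      abel

end KIdx

/-! ## Divided powers as a module over polynomial operators -/

/-- The underlying module of the divided power algebra on `c` variables. -/
abbrev DivPow (c : ℕ) (R : Type*) [CommRing R] : Type _ := (Fin c →₀ ℕ) →₀ R

namespace DivPow

open MvPolynomial

variable {c : ℕ} {R : Type*} [CommRing R]

/-- Contraction by a monomial. -/
noncomputable def contract : Multiplicative (Fin c →₀ ℕ) →* Module.End R (DivPow c R) where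
  toFun β := Finsupp.lcomapDomain (· + β.toAdd) (add_left_injective _)
  map_one' := by
    refine LinearMap.ext fun v => Finsupp.ext fun α => ?_
    change v (α + 0) = v α
    rw [add_zero]
  map_mul' β β' := by
    refine LinearMap.ext fun v => Finsupp.ext fun α => ?_
    change v (α + (β.toAdd + β'.toAdd)) = v (α + β.toAdd + β'.toAdd)
    rw [add_assoc]

/-- The action of polynomials by contraction. -/
noncomputable def act (c : ℕ) (R : Type*) [CommRing R] :
    MvPolynomial (Fin c) R →ₐ[R] Module.End R (DivPow c R) :=
  AddMonoidAlgebra.lift R _ _ contract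

noncomputable instance : Module (MvPolynomial (Fin c) R) (DivPow c R) :=
  Module.compHom _ (act c R).toRingHom

theorem smul_def (q : MvPolynomial (Fin c) R) (v : DivPow c R) : q • v = act c R q v := rfl

instance : IsScalarTower R (MvPolynomial (Fin c) R) (DivPow c R) :=
  ⟨fun r q v => by rw [smul_def, smul_def, map_smul]; rfl⟩

theorem C_smul (r : R) (v : DivPow c R) : (C r : MvPolynomial (Fin c) R) • v = r • v := by
  rw [← algebraMap_eq, algebraMap_smul]

@[simp] theorem C_smul_apply (r : R) (v : DivPow c R) (α : Fin c →₀ ℕ) :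
    ((C r : MvPolynomial (Fin c) R) • v) α = r * v α := by
  rw [C_smul]; rfl

@[simp] theorem X_smul_apply (i : Fin c) (v : DivPow c R) (α : Fin c →₀ ℕ) :
    ((X i : MvPolynomial (Fin c) R) • v) α = v (α + Finsupp.single i 1) := by
  rw [smul_def, act]
  change (AddMonoidAlgebra.lift R _ _ contract (AddMonoidAlgebra.single (Finsupp.single i 1) 1)) v α
    = _
  rw [AddMonoidAlgebra.lift_single, one_smul]
  rfl

/-- The elements with coefficients in an ideal. -/
def coeffsIn (c : ℕ) (I : Ideal R) : Submodule (MvPolynomial (Fin c) R) (DivPow c R) where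
  carrier := {v | ∀ α, v α ∈ I}
  zero_mem' := fun _ => I.zero_mem
  add_mem' := fun h h' α => I.add_mem (h α) (h' α)
  smul_mem' q v h := by
    induction q using MvPolynomial.induction_on with
    | C a => exact fun α => by rw [C_smul_apply]; exact I.mul_mem_left _ (h α)
    | add p q hp hq => exact fun α => by rw [add_smul]; exact I.add_mem (hp α) (hq α)
    | mul_X p i hp => exact fun α => by rw [mul_comm, mul_smul, X_smul_apply]; exact hp _

/-- Multiplication by a divided power basis element in normal form. -/
noncomputable def up (i : Fin c) : DivPow c R →ₗ[R] DivPow c R :=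
  Finsupp.lmapDomain R R (· + Finsupp.single i 1)

@[simp] theorem up_apply_add (i : Fin c) (v : DivPow c R) (α : Fin c →₀ ℕ) :
    up i v (α + Finsupp.single i 1) = v α :=
  Finsupp.mapDomain_apply (f := (· + Finsupp.single i 1)) (add_left_injective _) v α

theorem up_apply_of_eq_zero {i : Fin c} (v : DivPow c R) {α : Fin c →₀ ℕ} (h : α i = 0) :
    up i v α = 0 :=
  Finsupp.mapDomain_of_notMem_range _ _ (by
    rintro ⟨β, rfl⟩
    simp at h)

theorem eq_add_single {i : Fin c} {α : Fin c →₀ ℕ} (h : α i ≠ 0) :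
    ∃ β, α = β + Finsupp.single i 1 :=
  ⟨α - Finsupp.single i 1, (tsub_add_cancel_of_le (Finsupp.single_le_iff.2
    (Nat.one_le_iff_ne_zero.2 h))).symm⟩

@[simp] theorem X_smul_up (i : Fin c) (v : DivPow c R) :
    (X i : MvPolynomial (Fin c) R) • up i v = v :=
  Finsupp.ext fun α => by rw [X_smul_apply, up_apply_add]

theorem X_smul_up_of_ne {i j : Fin c} (h : j ≠ i) (v : DivPow c R) :
    (X j : MvPolynomial (Fin c) R) • up i v = up i ((X j : MvPolynomial (Fin c) R) • v) := by
  refine Finsupp.ext fun α => ?_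
  by_cases hα : α i = 0
  · rw [X_smul_apply, up_apply_of_eq_zero _ hα, up_apply_of_eq_zero]
    rw [Finsupp.add_apply, hα, Finsupp.single_eq_of_ne h.symm, add_zero]
  · obtain ⟨β, rfl⟩ := eq_add_single hα
    rw [X_smul_apply, up_apply_add, X_smul_apply, add_right_comm, up_apply_add]

theorem up_mem_coeffsIn {I : Ideal R} {v : DivPow c R} (h : v ∈ coeffsIn c I) (i : Fin c) :
    up i v ∈ coeffsIn c I := fun α => by
  by_cases hα : α i = 0
  · rw [up_apply_of_eq_zero _ hα]; exact I.zero_mem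
  · obtain ⟨β, rfl⟩ := eq_add_single hα
    rw [up_apply_add]; exact h β

/-- The linear form `∑ zₖⱼ Xₖ`. -/
noncomputable def zeta (z : Fin c → ℕ → R) (j : ℕ) : MvPolynomial (Fin c) R :=
  ∑ k, C (z k j) * X k

theorem zeta_smul_apply (z : Fin c → ℕ → R) (j : ℕ) (v : DivPow c R) (α : Fin c →₀ ℕ) :
    (zeta z j • v) α = ∑ k, z k j * v (α + Finsupp.single k 1) := by
  simp only [zeta, Finset.sum_smul, Finsupp.finsetSum_apply, mul_smul, C_smul_apply, X_smul_apply]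

/-- Change of coefficients. -/
noncomputable def mapR {R' : Type*} [CommRing R'] (φ : R →+* R') : DivPow c R →+ DivPow c R' :=
  Finsupp.mapRange.addMonoidHom φ.toAddMonoidHom

@[simp] theorem mapR_apply {R' : Type*} [CommRing R'] (φ : R →+* R') (v : DivPow c R)
    (α : Fin c →₀ ℕ) : mapR φ v α = φ (v α) := rfl

/-- The Koszul factorization on divided powers. -/
noncomputable def D (y : ℕ → R) (z : Fin c → ℕ → R) (e : ℕ) :
    (KIdx e → DivPow c R) →ₗ[MvPolynomial (Fin c) R] (KIdx e → DivPow c R) :=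
  KIdx.kd (fun j => C (y j)) (zeta z) e

theorem D_mapR {R' : Type*} [CommRing R'] (φ : R →+* R') {y : ℕ → R} {z : Fin c → ℕ → R} {e : ℕ}
    {y' : ℕ → R'} {z' : Fin c → ℕ → R'} (hy : ∀ j < e, φ (y j) = y' j)
    (hz : ∀ k, ∀ j < e, φ (z k j) = z' k j) (w : KIdx e → DivPow c R) :
    D y' z' e (mapR φ ∘ w) = mapR φ ∘ D y z e w := by
  refine KIdx.kd_map _ _ _ e (fun j hj v => Finsupp.ext fun α => ?_)
    (fun j hj v => Finsupp.ext fun α => ?_) w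
  · simp only [mapR_apply, C_smul_apply, map_mul, hy j hj]
  · simp only [mapR_apply, zeta_smul_apply, map_sum, map_mul, hz _ j hj]

theorem sum_C_mul_zeta (y : ℕ → R) (z : Fin c → ℕ → R) (e : ℕ) (f : Fin c → R)
    (hf : ∀ k, f k = ∑ j ∈ Finset.range e, z k j * y j) :
    ∑ j ∈ Finset.range e, C (y j) * zeta z j = ∑ k, C (f k) * X k := by
  simp only [zeta, Finset.mul_sum, hf, map_sum, Finset.sum_mul, map_mul]
  rw [Finset.sum_comm]
  exact Finset.sum_congr rfl fun _ _ => Finset.sum_congr rfl fun _ _ => by ring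

theorem D_D (y : ℕ → R) (z : Fin c → ℕ → R) (e : ℕ) (f : Fin c → R)
    (hf : ∀ k, f k = ∑ j ∈ Finset.range e, z k j * y j) (w : KIdx e → DivPow c R) :
    D y z e (D y z e w) = ∑ k, f k • (X k : MvPolynomial (Fin c) R) • w := by
  rw [D, KIdx.kd_kd, sum_C_mul_zeta y z e f hf, Finset.sum_smul]
  refine Finset.sum_congr rfl fun k _ => ?_
  rw [mul_smul, ← algebraMap_eq, algebraMap_smul]

/-- The elements with coefficients in an ideal. -/
def coeffsInPi (e c : ℕ) (I : Ideal R) :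
    Submodule (MvPolynomial (Fin c) R) (KIdx e → DivPow c R) where
  carrier := {w | ∀ s, w s ∈ coeffsIn c I}
  zero_mem' := fun _ => zero_mem _
  add_mem' := fun h h' s => add_mem (h s) (h' s)
  smul_mem' q _ h := fun s => Submodule.smul_mem _ q (h s)

theorem D_mem {e : ℕ} {I : Ideal R} {w : KIdx e → DivPow c R} (y : ℕ → R) (z : Fin c → ℕ → R)
    (h : w ∈ coeffsInPi e c I) : D y z e w ∈ coeffsInPi e c I :=
  KIdx.kd_mem _ _ _ e h

theorem smul_mem_coeffsInPi {e : ℕ} {I : Ideal R} {a : R} (ha : a ∈ I)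
    (w : KIdx e → DivPow c R) : a • w ∈ coeffsInPi e c I :=
  fun s α => I.mul_mem_right (w s α) ha

theorem coeffsInPi_mono {e : ℕ} {I J : Ideal R} (h : I ≤ J) :
    coeffsInPi e c I ≤ coeffsInPi e c J := fun _ hw s α => h (hw s α)

/-- Multiples of the unit. -/
noncomputable def unit (e c : ℕ) (a : R) : KIdx e → DivPow c R :=
  Pi.single (KIdx.bot e) (Finsupp.single 0 a)

/-- Elements supported on the exterior part. -/
theorem exists_eq_single_zero {v : DivPow c R}
    (h : ∀ k, (X k : MvPolynomial (Fin c) R) • v = 0) : v = Finsupp.single 0 (v 0) := by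
  refine Finsupp.ext fun α => ?_
  by_cases hα : α = 0
  · rw [hα, Finsupp.single_eq_same]
  · rw [Finsupp.single_eq_of_ne hα]
    obtain ⟨k, hk⟩ : ∃ k, α k ≠ 0 := by
      by_contra! hc
      exact hα (Finsupp.ext hc)
    obtain ⟨β, rfl⟩ := eq_add_single hk
    rw [← X_smul_apply, h k]
    rfl

theorem zeta_smul_single_zero (z : Fin c → ℕ → R) (j : ℕ) (a : R) :
    zeta z j • (Finsupp.single 0 a : DivPow c R) = 0 := by
  refine Finsupp.ext fun α => ?_
  rw [zeta_smul_apply]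
  refine Finset.sum_eq_zero fun k _ => ?_
  rw [Finsupp.single_eq_of_ne, mul_zero]
  intro h
  have := DFunLike.congr_fun h k
  simp at this

/-- Exactness, before reduction, of the Tate construction on a regular sequence `f` contained in
the ideal generated by a regular sequence `x`. -/
theorem exists_sub_mem (x : ℕ → R) (z : Fin c → ℕ → R) (e : ℕ)
    (hx : ∀ k < e, ∀ r, x k * r ∈ initIdeal x k → r ∈ initIdeal x k)
    (f : ℕ → R) (hfz : ∀ k : Fin c, f k = ∑ j ∈ Finset.range e, z k j * x j)
    (hf : ∀ k < c, ∀ r, f k * r ∈ initIdeal f k → r ∈ initIdeal f k) :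
    ∀ (i : ℕ) (_ : i ≤ c) (v : KIdx e → DivPow c R)
      (_ : ∀ k : Fin c, i ≤ k → (X k : MvPolynomial (Fin c) R) • v = 0)
      (_ : D x z e v ∈ coeffsInPi e c (initIdeal f i)),
      ∃ u a, v - D x z e u - unit e c a ∈ coeffsInPi e c (initIdeal f i)
  | 0, _, v, hv, hD => by
    have h0 : initIdeal f 0 = ⊥ := by
      have : Set.Iio 0 = (∅ : Set ℕ) := by ext; simp
      rw [initIdeal, this, Set.image_empty, Ideal.span_empty]
    have hv' : v = (Finsupp.singleAddHom 0 : R →+ DivPow c R) ∘ fun s => v s 0 :=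
      funext fun s => exists_eq_single_zero fun k => congrFun (hv k (Nat.zero_le _)) s
    have hmap : ∀ w : KIdx e → R, D x z e ((Finsupp.singleAddHom 0 : R →+ DivPow c R) ∘ w) =
        (Finsupp.singleAddHom 0 : R →+ DivPow c R) ∘ KIdx.kd x 0 e w := fun w => by
      refine KIdx.kd_map _ _ _ e (fun j hj r => ?_) (fun j hj r => ?_) w
      · rw [C_smul]
        exact (Finsupp.smul_single _ _ _).symm
      · rw [Finsupp.singleAddHom_apply, Finsupp.singleAddHom_apply, zeta_smul_single_zero]
        change Finsupp.single 0 ((0 : R) • r) = 0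
        rw [zero_smul, Finsupp.single_zero]
    have hk : KIdx.kd x 0 e (fun s => v s 0) = 0 := by
      funext s
      have h1 := hD s 0
      rw [h0, hv', hmap] at h1
      simpa using h1
    obtain ⟨u, a, hu⟩ := KIdx.exists_of_kd_eq_zero x e hx _ hk
    refine ⟨(Finsupp.singleAddHom 0 : R →+ DivPow c R) ∘ u, a, ?_⟩
    suffices v - D x z e ((Finsupp.singleAddHom 0 : R →+ DivPow c R) ∘ u) - unit e c a = 0 by
      rw [this]; exact zero_mem _
    rw [hmap, sub_sub, sub_eq_zero, hv', hu]
    funext s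
    rw [Function.comp_apply, Pi.add_apply, map_add, Pi.add_apply]
    congr 1
    by_cases hs : s = KIdx.bot e
    · rw [hs, unit, Pi.single_eq_same, Pi.single_eq_same]; rfl
    · rw [unit, Pi.single_eq_of_ne hs, Pi.single_eq_of_ne hs, map_zero]
  | i + 1, hi, v, hv, hD => by
    classical
    set I := initIdeal f i with hI
    let i' : Fin c := ⟨i, hi⟩
    have hDX : ∀ (k : Fin c) w, D x z e ((X k : MvPolynomial (Fin c) R) • w) =
      (X k : MvPolynomial (Fin c) R) • D x z e w := fun k w => map_smul _ _ _
    have hφ : ∀ t : R, ∃ q, (t = 0 → q = 0) ∧ (t ∈ initIdeal f (i + 1) → t - f i * q ∈ I) := by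
      intro t
      by_cases ht : t = 0
      · exact ⟨0, fun _ => rfl, fun _ => by rw [ht, mul_zero, sub_zero]; exact I.zero_mem⟩
      by_cases ht' : t ∈ initIdeal f (i + 1)
      · obtain ⟨a, b, hb, hab⟩ := (mem_initIdeal_succ f i).1 ht'
        refine ⟨a, fun h => absurd h ht, fun _ => ?_⟩
        rwa [← hab, mul_comm a, add_sub_cancel_left]
      · exact ⟨0, fun _ => rfl, fun h => absurd h ht'⟩
    choose φ hφ0 hφ1 using hφ
    -- a quotient of the differential by `f i`
    let h : KIdx e → DivPow c R := fun s => (D x z e v s).mapRange φ (hφ0 0 rfl)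
    have hh : D x z e v - f i • h ∈ coeffsInPi e c I := fun s α => hφ1 _ (hD s α)
    have hhX : ∀ k : Fin c, i + 1 ≤ k → (X k : MvPolynomial (Fin c) R) • h = 0 := fun k hk => by
      refine funext fun s => Finsupp.ext fun α => ?_
      rw [Pi.smul_apply, X_smul_apply]
      change φ (D x z e v s (α + Finsupp.single k 1)) = 0
      rw [← X_smul_apply, ← Pi.smul_apply, ← hDX, hv k hk, map_zero]
      exact hφ0 0 rfl
    have hDD : ∀ w : KIdx e → DivPow c R, (∀ k : Fin c, i + 1 ≤ k →
        (X k : MvPolynomial (Fin c) R) • w = 0) →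
        D x z e (D x z e w) - f i • (X i' : MvPolynomial (Fin c) R) • w ∈ coeffsInPi e c I := by
      intro w hw
      rw [D_D x z e (fun k => f k) hfz, ← Finset.add_sum_erase _ _ (Finset.mem_univ i'),
        add_sub_cancel_left]
      refine Submodule.sum_mem _ fun k hk => ?_
      rcases lt_or_ge (k : ℕ) i with hki | hki
      · exact smul_mem_coeffsInPi (mem_initIdeal f hki) _
      · have : (k : ℕ) ≠ i := fun h => (Finset.ne_of_mem_erase hk) (Fin.ext h)
        rw [hw k (by omega), smul_zero]
        exact zero_mem _
    have hDsm : ∀ (r : R) w, D x z e (r • w) = r • D x z e w := fun r w =>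
      ((D x z e).restrictScalars R).map_smul r w
    have hreg : D x z e h - (X i' : MvPolynomial (Fin c) R) • v ∈ coeffsInPi e c I := by
      intro s α
      refine hf i hi _ ?_
      have h1 := sub_mem (hDD v hv) (D_mem x z hh)
      rw [map_sub, hDsm] at h1
      have h2 := h1 s α
      convert h2 using 1
      simp only [Pi.sub_apply, Finsupp.sub_apply, Pi.smul_apply, Finsupp.smul_apply, smul_eq_mul]
      ring
    have hupX : ∀ w : KIdx e → DivPow c R, (X i' : MvPolynomial (Fin c) R) • (up i' ∘ w) = w :=
      fun w => funext fun s => X_smul_up _ _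
    have hupX' : ∀ (k : Fin c) (_ : i + 1 ≤ k) (w : KIdx e → DivPow c R),
        (X k : MvPolynomial (Fin c) R) • (up i' ∘ w) =
          up i' ∘ ((X k : MvPolynomial (Fin c) R) • w) := fun k hk w =>
      funext fun s => X_smul_up_of_ne (fun h => by rw [h] at hk; exact absurd hk (by simp [i'])) _
    have hup0 : (up i' : DivPow c R →ₗ[R] _) ∘ (0 : KIdx e → DivPow c R) = 0 :=
      funext fun s => map_zero _
    set h' : KIdx e → DivPow c R := up i' ∘ h with hh'
    have hh'X : ∀ k : Fin c, i + 1 ≤ k → (X k : MvPolynomial (Fin c) R) • h' = 0 := fun k hk => by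
      rw [hh', hupX' k hk, hhX k hk, hup0]
    set v₁ := v - D x z e h' with hv₁
    have hv₁X : (X i' : MvPolynomial (Fin c) R) • v₁ ∈ coeffsInPi e c I := by
      rw [hv₁, smul_sub, ← hDX, hh', hupX, ← neg_sub]
      exact neg_mem hreg
    have hv₁X' : ∀ k : Fin c, i + 1 ≤ k → (X k : MvPolynomial (Fin c) R) • v₁ = 0 := fun k hk => by
      rw [hv₁, smul_sub, ← hDX, hv k hk, hh'X k hk, map_zero, sub_zero]
    have hDv₁ : D x z e v₁ ∈ coeffsInPi e c I := by
      have h1 := sub_mem hh (hDD h' hh'X)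
      rw [hh', hupX, ← hh'] at h1
      rw [hv₁, map_sub]
      convert h1 using 1
      abel
    set g : KIdx e → DivPow c R := up i' ∘ ((X i' : MvPolynomial (Fin c) R) • v₁) with hg
    have hgI : g ∈ coeffsInPi e c I := fun s => up_mem_coeffsIn (hv₁X s) i'
    obtain ⟨u, a, hu⟩ := exists_sub_mem x z e hx f hfz hf i (by omega) (v₁ - g) (fun k hk => by
      rcases hk.eq_or_lt with hk | hk
      · have : k = i' := Fin.ext hk.symm
        rw [this, smul_sub, hg, hupX, sub_self]
      · rw [smul_sub, hv₁X' k hk, hg, hupX' k hk, smul_comm, hv₁X' k hk, smul_zero, hup0,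
          sub_zero]) (by
      rw [map_sub]
      exact sub_mem hDv₁ (D_mem x z hgI))
    refine ⟨u + h', a, coeffsInPi_mono (initIdeal_mono f (Nat.le_succ i)) ?_⟩
    have := add_mem hu hgI
    convert this using 1
    rw [map_add, hv₁]
    abel

end DivPow

namespace DivPow

open MvPolynomial

variable {c : ℕ} {R : Type*} [CommRing R]

open Classical in
/-- Truncation to the basis elements satisfying a predicate. -/
noncomputable def filt (p : (Fin c →₀ ℕ) → Prop) : DivPow c R →ₗ[R] DivPow c R where
  toFun := Finsupp.filter p
  map_add' _ _ := Finsupp.filter_add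
  map_smul' _ _ := Finsupp.filter_smul

open Classical in
theorem filt_apply (p : (Fin c →₀ ℕ) → Prop) (v : DivPow c R) (α : Fin c →₀ ℕ) :
    filt p v α = if p α then v α else 0 := Finsupp.filter_apply _ _ _

/-- The projections of the Tate construction onto its homogeneous components. -/
noncomputable def proj (e : ℕ) (n : ℤ) : (KIdx e → DivPow c R) →ₗ[R] (KIdx e → DivPow c R) :=
  LinearMap.pi fun s => filt (fun α => (s.deg : ℤ) + 2 * α.degree = n) ∘ₗ LinearMap.proj s

theorem proj_apply (e : ℕ) (n : ℤ) (w : KIdx e → DivPow c R) (s : KIdx e) (α : Fin c →₀ ℕ) :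
    proj e n w s α = if (s.deg : ℤ) + 2 * α.degree = n then w s α else 0 := by
  classical
  refine (filt_apply _ _ _).trans ?_
  split_ifs <;> rfl

theorem proj_comp_inl (e : ℕ) (n : ℤ) (w : KIdx (e + 1) → DivPow c R) :
    proj (e + 1) n w ∘ KIdx.inl = proj e n (w ∘ KIdx.inl) := rfl

theorem proj_comp_inr (e : ℕ) (n : ℤ) (w : KIdx (e + 1) → DivPow c R) :
    proj (e + 1) n w ∘ KIdx.inr = proj e (n - 1) (w ∘ KIdx.inr) := by
  classical
  refine funext fun s => Finsupp.ext fun α => ?_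
  rw [Function.comp_apply, proj_apply, proj_apply, KIdx.deg_inr]
  refine if_congr ?_ rfl rfl
  push_cast
  omega

theorem degree_add_single (α : Fin c →₀ ℕ) (k : Fin c) :
    (α + Finsupp.single k 1).degree = α.degree + 1 := by
  rw [map_add, Finsupp.degree_single]

theorem D_proj (y : ℕ → R) (z : Fin c → ℕ → R) : ∀ (e : ℕ) (n : ℤ) (w : KIdx e → DivPow c R),
    D y z e (proj e (n + 1) w) = proj e n (D y z e w)
  | 0, n, w => (map_zero (proj 0 n)).symm
  | e + 1, n, w => by
    classical
    have ih : ∀ (n : ℤ) (w : KIdx e → DivPow c R), KIdx.kd (fun j => C (y j)) (zeta z) e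
      (proj e (n + 1) w) = proj e n (KIdx.kd (fun j => C (y j)) (zeta z) e w) := D_proj y z e
    rw [D]
    refine KIdx.ext_comp ?_ ?_
    · rw [KIdx.kd_comp_inl, proj_comp_inl, proj_comp_inr, proj_comp_inl, KIdx.kd_comp_inl, ih,
        map_add, add_sub_cancel_right]
      congr 1
      refine funext fun s => Finsupp.ext fun α => ?_
      rw [proj_apply, Pi.smul_apply, C_smul_apply, proj_apply, Pi.smul_apply, C_smul_apply]
      split_ifs <;> simp
    · rw [KIdx.kd_comp_inr, proj_comp_inl, proj_comp_inr, proj_comp_inr, KIdx.kd_comp_inr,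
        add_sub_cancel_right, map_sub, ← ih, sub_add_cancel]
      congr 1
      refine funext fun s => Finsupp.ext fun α => ?_
      rw [proj_apply, Pi.smul_apply, zeta_smul_apply, Pi.smul_apply, zeta_smul_apply]
      simp only [proj_apply, degree_add_single]
      by_cases h : (s.deg : ℤ) + 2 * α.degree = n - 1
      · rw [if_pos h]
        refine Finset.sum_congr rfl fun k _ => ?_
        rw [if_pos (by push_cast; omega)]
      · rw [if_neg h]
        refine Finset.sum_eq_zero fun k _ => ?_
        rw [if_neg (by push_cast; omega), mul_zero]

theorem exists_sum_proj (e : ℕ) (w : KIdx e → DivPow c R) :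
    ∃ F : Finset ℤ, ∑ n ∈ F, proj e n w = w := by
  classical
  refine ⟨Finset.univ.biUnion fun s : KIdx e => (w s).support.image fun α =>
    (s.deg : ℤ) + 2 * α.degree, funext fun s => Finsupp.ext fun α => ?_⟩
  rw [Finset.sum_apply, Finsupp.finsetSum_apply]
  simp only [proj_apply]
  rw [Finset.sum_ite_eq]
  split_ifs with h
  · rfl
  · by_contra h0
    exact h (Finset.mem_biUnion.2 ⟨s, Finset.mem_univ s, Finset.mem_image.2
      ⟨α, Finsupp.mem_support_iff.2 fun h1 => h0 h1.symm, rfl⟩⟩)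

/-- The Tate construction. -/
noncomputable def tate (y : ℕ → R) (z : Fin c → ℕ → R) (e : ℕ)
    (h : ∀ k, ∑ j ∈ Finset.range e, z k j * y j = 0) :
    GradedDiff R (KIdx e → DivPow c R) where
  d := (D y z e).restrictScalars R
  π := proj e
  d_d w := by
    change D y z e (D y z e w) = 0
    rw [D_D y z e 0 fun k => (h k).symm]
    exact Finset.sum_eq_zero fun k _ => zero_smul R _
  π_same n w := by
    classical
    refine funext fun s => Finsupp.ext fun α => ?_
    simp only [proj_apply]
    split_ifs <;> rfl
  π_ne m n w hmn := by
    classical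
    refine funext fun s => Finsupp.ext fun α => ?_
    simp only [proj_apply]
    split_ifs with h1 h2
    · exact absurd (h1.symm.trans h2) hmn
    · rfl
    · rfl
  exists_sum_π := exists_sum_proj e
  d_π_succ n w := D_proj y z e n w

theorem exists_X_pow_smul (i : Fin c) (v : DivPow c R) :
    ∃ k₀ : ℕ, ∀ k ≥ k₀, (X i ^ k : MvPolynomial (Fin c) R) • v = 0 := by
  have key : ∀ (k : ℕ) (v : DivPow c R) α, ((X i ^ k : MvPolynomial (Fin c) R) • v) α =
      v (α + Finsupp.single i k) := by
    intro k
    induction k with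
    | zero => intro v α; rw [pow_zero, one_smul, Finsupp.single_zero, add_zero]
    | succ k ih =>
      intro v α
      rw [pow_succ, mul_smul, ih, X_smul_apply, add_assoc, ← Finsupp.single_add]
  induction v using Finsupp.induction_linear with
  | zero => exact ⟨0, fun k _ => smul_zero _⟩
  | add v w hv hw =>
    obtain ⟨k, hk⟩ := hv
    obtain ⟨l, hl⟩ := hw
    refine ⟨max k l, fun m hm => ?_⟩
    rw [smul_add, hk m (le_trans (le_max_left _ _) hm), hl m (le_trans (le_max_right _ _) hm),
      add_zero]
  | single β r =>
    refine ⟨β i + 1, fun k hk => Finsupp.ext fun α => ?_⟩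
    rw [key, Finsupp.single_eq_of_ne]
    · rfl
    · intro h
      have := DFunLike.congr_fun h i
      simp at this
      omega

/-- Coefficients in an ideal. -/
theorem mem_smul_top {e : ℕ} {I : Ideal R} {w : KIdx e → DivPow c R}
    (hw : w ∈ coeffsInPi e c I) : w ∈ I • (⊤ : Submodule R (KIdx e → DivPow c R)) := by
  classical
  rw [← LinearMap.sum_single_apply (φ := fun _ : KIdx e => DivPow c R) w]
  refine Submodule.sum_mem _ fun s _ => ?_
  have h1 : w s ∈ I • (⊤ : Submodule R (DivPow c R)) := by
    rw [← Finsupp.sum_single (w s)]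
    refine Submodule.sum_mem _ fun α _ => ?_
    rw [← mul_one (w s α), ← smul_eq_mul, ← Finsupp.smul_single]
    exact Submodule.smul_mem_smul (hw s α) trivial
  have h2 := Submodule.mem_map_of_mem (f := LinearMap.single R (fun _ : KIdx e => DivPow c R) s) h1
  rw [Submodule.map_smul''] at h2
  exact Submodule.smul_mono le_rfl le_top h2

/-- Elements of bounded degree form a finitely generated module. -/
theorem mem_span_of_degree_le {e : ℕ} {d : ℕ} {w : KIdx e → DivPow c R}
    (hw : ∀ s α, w s α ≠ 0 → α.degree ≤ d) :
    w ∈ Submodule.span R (Set.range fun p : KIdx e × {α : Fin c →₀ ℕ | α.degree ≤ d} =>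
      (Pi.single p.1 (Finsupp.single (p.2 : Fin c →₀ ℕ) (1 : R)) : KIdx e → DivPow c R)) := by
  classical
  rw [← LinearMap.sum_single_apply (φ := fun _ : KIdx e => DivPow c R) w]
  refine Submodule.sum_mem _ fun s _ => ?_
  change LinearMap.single R (fun _ : KIdx e => DivPow c R) s (w s) ∈ _
  rw [← Finsupp.sum_single (w s), Finsupp.sum, map_sum]
  refine Submodule.sum_mem _ fun α hα => ?_
  rw [← mul_one (w s α), ← smul_eq_mul, ← Finsupp.smul_single, map_smul]
  exact Submodule.smul_mem _ _ (Submodule.subset_span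
    ⟨⟨s, α, hw s α (Finsupp.mem_support_iff.1 hα)⟩, rfl⟩)

theorem fg_of_degree_le [IsNoetherianRing R] {e : ℕ} (d : ℕ) {N : Submodule R (KIdx e → DivPow c R)}
    (hN : ∀ w ∈ N, ∀ s α, w s α ≠ 0 → α.degree ≤ d) : N.FG := by
  have := (Finsupp.finite_of_degree_le (σ := Fin c) d).to_subtype
  have h1 := Submodule.fg_span (R := R) (Set.finite_range
    fun p : KIdx e × {α : Fin c →₀ ℕ | α.degree ≤ d} =>
      (Pi.single p.1 (Finsupp.single (p.2 : Fin c →₀ ℕ) (1 : R)) : KIdx e → DivPow c R))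
  have := isNoetherian_of_fg_of_noetherian _ h1
  exact Submodule.FG.of_le h1 fun w hw => mem_span_of_degree_le (hN w hw)

end DivPow

namespace DivPow

open MvPolynomial

section

variable {c : ℕ} {R : Type*} [CommRing R]

theorem proj_zero (e : ℕ) (w : KIdx e → DivPow c R) :
    proj e 0 w = unit e c (w (KIdx.bot e) 0) := by
  refine funext fun s => Finsupp.ext fun α => ?_
  rw [proj_apply]
  by_cases hs : s = KIdx.bot e
  · subst hs
    rw [unit, Pi.single_eq_same, KIdx.deg_eq_zero.2 rfl]
    by_cases hα : α = 0
    · subst hα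
      rw [Finsupp.single_eq_same, if_pos (by simp)]
    · rw [Finsupp.single_eq_of_ne hα, if_neg]
      have : α.degree ≠ 0 := fun h => hα ((Finsupp.degree_eq_zero_iff α).1 h)
      omega
  · have : s.deg ≠ 0 := fun h => hs (KIdx.deg_eq_zero.1 h)
    rw [unit, Pi.single_eq_of_ne hs, if_neg (by omega)]
    rfl

theorem proj_unit (e : ℕ) {n : ℤ} (hn : n ≠ 0) (a : R) : proj e n (unit e c a) = 0 := by
  refine funext fun s => Finsupp.ext fun α => ?_
  rw [proj_apply]
  split_ifs with h
  · by_cases hs : s = KIdx.bot e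
    · subst hs
      rw [KIdx.deg_eq_zero.2 rfl] at h
      rw [unit, Pi.single_eq_same, Finsupp.single_eq_of_ne]
      · rfl
      · rintro rfl
        exact hn (by simpa using h.symm)
    · rw [unit, Pi.single_eq_of_ne hs]
      rfl
  · rfl

theorem exists_D_eq_unit (y : ℕ → R) (z : Fin c → ℕ → R) (e : ℕ) {a : R}
    (ha : a ∈ initIdeal y e) : ∃ u, D y z e u = unit e c a := by
  have h1 : (C a : MvPolynomial (Fin c) R) ∈ initIdeal (fun j => (C (y j) :
      MvPolynomial (Fin c) R)) e := by
    have := Ideal.mem_map_of_mem (C : R →+* MvPolynomial (Fin c) R) ha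
    rw [initIdeal, Ideal.map_span, ← Set.image_comp] at this
    exact this
  obtain ⟨u, hu⟩ := KIdx.exists_kd_eq_single_bot _ (zeta z) e
    (v := (Finsupp.single 0 1 : DivPow c R)) (fun j _ => zeta_smul_single_zero z j 1) h1
  refine ⟨u, hu.trans ?_⟩
  rw [C_smul, Finsupp.smul_single, smul_eq_mul, mul_one]
  rfl

theorem D_bot_mem (y : ℕ → R) (z : Fin c → ℕ → R) (e : ℕ) (w : KIdx e → DivPow c R)
    (α : Fin c →₀ ℕ) : D y z e w (KIdx.bot e) α ∈ initIdeal y e :=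
  KIdx.kd_bot_mem _ _ (coeffsIn c (initIdeal y e)) e (fun j hj v α => by
    rw [C_smul_apply]
    exact Ideal.mul_mem_right _ _ (mem_initIdeal y hj)) w α

theorem X_smul_proj (e : ℕ) (i : Fin c) (n : ℤ) (w : KIdx e → DivPow c R) :
    (X i : MvPolynomial (Fin c) R) • proj e (n + 2) w =
      proj e n ((X i : MvPolynomial (Fin c) R) • w) := by
  refine funext fun s => Finsupp.ext fun α => ?_
  rw [Pi.smul_apply, X_smul_apply, proj_apply, proj_apply, Pi.smul_apply, X_smul_apply,
    degree_add_single]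
  refine if_congr ?_ rfl rfl
  push_cast
  omega

/-- Elements are recovered from their contractions and their part of divided power degree `0`. -/
theorem exists_retraction (c : ℕ) (R : Type*) [CommRing R] :
    ∃ τ : Fin c → DivPow c R →ₗ[R] DivPow c R, ∀ v : DivPow c R,
      v = filt (fun α => α = 0) v + ∑ i, τ i ((X i : MvPolynomial (Fin c) R) • v) := by
  classical
  have hg : ∀ α : Fin c →₀ ℕ, α ≠ 0 → ∃ i, α i ≠ 0 := fun α hα => by
    by_contra! h
    exact hα (Finsupp.ext h)
  choose g hg using hg
  refine ⟨fun i => filt (fun α => ∃ h : α ≠ 0, g α h = i) ∘ₗ up i, fun v => Finsupp.ext fun α => ?_⟩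
  rw [Finsupp.add_apply, Finsupp.finsetSum_apply, filt_apply]
  simp only [LinearMap.comp_apply, filt_apply]
  by_cases hα : α = 0
  · rw [if_pos hα, Finset.sum_eq_zero, add_zero]
    rintro i -
    rw [if_neg]
    rintro ⟨h, -⟩
    exact h hα
  · rw [if_neg hα, zero_add, Finset.sum_eq_single (g α hα)]
    · rw [if_pos ⟨hα, rfl⟩]
      have key : ∀ i, α i ≠ 0 → v α = up i ((X i : MvPolynomial (Fin c) R) • v) α := by
        intro i hi
        obtain ⟨β, rfl⟩ := eq_add_single hi
        rw [up_apply_add, X_smul_apply]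
      exact key _ (hg α hα)
    · rintro i - hi
      rw [if_neg]
      rintro ⟨h, rfl⟩
      exact hi rfl
    · intro h
      exact absurd (Finset.mem_univ _) h

end

variable {c : ℕ} {A : Type u} [CommRing A]

theorem tate_isTate [IsLocalRing A] [IsNoetherianRing A] (y : ℕ → A) (z : Fin c → ℕ → A) (e : ℕ)
    (h : ∀ k, ∑ j ∈ Finset.range e, z k j * y j = 0) (hy : initIdeal y e = maximalIdeal A)
    (hex : ∀ n ≥ 1, (tate y z e h).ExactAt n) : (tate y z e h).IsTate (Fin c) where
  d_smul q w := map_smul (D y z e) q w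
  X_smul i n w := X_smul_proj e i n w
  projective := inferInstance
  π_neg n hn w := funext fun s => Finsupp.ext fun α => by
    change proj e n w s α = 0
    rw [proj_apply, if_neg (by omega)]
  fg_piece n := by
    refine fg_of_degree_le n.toNat fun w hw s α hne => ?_
    have hw' : proj e n w = w := (tate y z e h).mem_piece.1 hw
    rw [← hw', proj_apply] at hne
    by_cases h1 : (s.deg : ℤ) + 2 * α.degree = n
    · omega
    · rw [if_neg h1] at hne
      exact absurd rfl hne
  exactAt := hex
  coker := by
    let g : (KIdx e → DivPow c A) →ₗ[A] A ⧸ maximalIdeal A :=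
      (maximalIdeal A).mkQ ∘ₗ Finsupp.lapply 0 ∘ₗ LinearMap.proj (KIdx.bot e)
    have hg : ∀ w, g w = (maximalIdeal A).mkQ (w (KIdx.bot e) 0) := fun w => rfl
    have hsurj : Function.Surjective g := fun t => by
      obtain ⟨a, rfl⟩ := (maximalIdeal A).mkQ_surjective t
      exact ⟨unit e c a, by rw [hg, unit, Pi.single_eq_same, Finsupp.single_eq_same]⟩
    have hker : LinearMap.ker ((tate y z e h).π 0) ⊔ (tate y z e h).B 0 = LinearMap.ker g := by
      ext w
      rw [GradedDiff.mem_ker_sup_B, LinearMap.mem_ker, hg, Submodule.mkQ_apply,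
        Submodule.Quotient.mk_eq_zero]
      change proj e 0 w ∈ _ ↔ _
      rw [proj_zero]
      constructor
      · intro hw
        obtain ⟨u, -, hu⟩ := (tate y z e h).mem_B.1 hw
        have h1 := D_bot_mem y z e u 0
        have h2 : D y z e u = unit e c (w (KIdx.bot e) 0) := hu
        rw [h2, hy, unit, Pi.single_eq_same, Finsupp.single_eq_same] at h1
        exact h1
      · intro hw
        obtain ⟨u, hu⟩ := exists_D_eq_unit y z e (hy.symm ▸ hw)
        refine (tate y z e h).mem_B_of_d (u := u) hu ?_
        rw [← proj_zero]
        exact (tate y z e h).π_same 0 w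
    exact ⟨(Submodule.quotEquivOfEq _ _ hker).trans (g.quotKerEquivOfSurjective hsurj)⟩
  exists_pow_smul i w := by
    choose k hk using fun s => exists_X_pow_smul i (w s)
    exact ⟨Finset.univ.sup k, funext fun s => hk s _ (Finset.le_sup (Finset.mem_univ s))⟩
  exists_section i := ⟨LinearMap.pi fun s => up i ∘ₗ LinearMap.proj s,
    fun w => funext fun s => X_smul_up i (w s),
    fun j hj w => funext fun s => X_smul_up_of_ne hj (w s)⟩
  exists_retraction := by
    obtain ⟨τ, hτ⟩ := exists_retraction c A
    refine ⟨LinearMap.pi fun s => filt (fun α => α = 0) ∘ₗ LinearMap.proj s, ?_,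
      fun i => LinearMap.pi fun s => τ i ∘ₗ LinearMap.proj s, fun w => funext fun s => ?_⟩
    · refine fg_of_degree_le 0 ?_
      rintro _ ⟨w, rfl⟩ s α hne
      by_cases hα : α = 0
      · rw [hα, map_zero]
      · refine absurd ?_ hne
        exact (filt_apply _ _ _).trans (if_neg hα)
    · rw [Pi.add_apply, Finset.sum_apply]
      exact hτ (w s)
  exists_homotopy := by
    refine ⟨y '' Set.Iio e, hy, ?_⟩
    rintro _ ⟨j, hj, rfl⟩
    refine ⟨KIdx.ke _ j e, fun w => ?_⟩
    refine (KIdx.kd_ke (fun j => C (y j)) (zeta z) e hj w).trans ?_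
    rw [← algebraMap_eq, algebraMap_smul]

end DivPow

namespace DivPow

open MvPolynomial

section

variable {c e : ℕ} {R R' : Type*} [CommRing R] [CommRing R']

theorem exists_mapR_comp_eq {φ : R →+* R'} (hφ : Function.Surjective φ)
    (w : KIdx e → DivPow c R') : ∃ w' : KIdx e → DivPow c R, mapR φ ∘ w' = w := by
  have : ∀ t, ∃ r, φ r = t ∧ (t = 0 → r = 0) := fun t => by
    by_cases ht : t = 0
    · exact ⟨0, by rw [ht, map_zero], fun _ => rfl⟩
    · obtain ⟨r, hr⟩ := hφ t
      exact ⟨r, hr, fun h => absurd h ht⟩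
  choose g hg hg0 using this
  exact ⟨fun s => (w s).mapRange g (hg0 0 rfl), funext fun s => Finsupp.ext fun α => hg _⟩

theorem mapR_comp_unit (φ : R →+* R') (a : R) : mapR φ ∘ unit e c a = unit e c (φ a) := by
  funext s
  by_cases hs : s = KIdx.bot e
  · subst hs
    rw [Function.comp_apply, unit, unit, Pi.single_eq_same, Pi.single_eq_same]
    exact Finsupp.mapRange_single (hf := map_zero φ)
  · rw [Function.comp_apply, unit, unit, Pi.single_eq_of_ne hs, Pi.single_eq_of_ne hs, map_zero]

theorem mapR_comp_eq_zero {φ : R →+* R'} {w : KIdx e → DivPow c R} :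
    mapR φ ∘ w = 0 ↔ w ∈ coeffsInPi e c (RingHom.ker φ) :=
  ⟨fun h s α => DFunLike.congr_fun (congrFun h s) α,
    fun h => funext fun s => Finsupp.ext fun α => h s α⟩

theorem mapR_comp_add (φ : R →+* R') (w w' : KIdx e → DivPow c R) :
    mapR φ ∘ (w + w') = mapR φ ∘ w + mapR φ ∘ w' := funext fun _ => map_add _ _ _

theorem mapR_comp_sub (φ : R →+* R') (w w' : KIdx e → DivPow c R) :
    mapR φ ∘ (w - w') = mapR φ ∘ w - mapR φ ∘ w' := funext fun _ => map_sub _ _ _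

/-- Exactness of the Tate construction over a complete intersection. -/
theorem exists_eq_add_unit {φ : R →+* R'} (hφ : Function.Surjective φ) (x : ℕ → R)
    (z : Fin c → ℕ → R) (hx : ∀ k < e, ∀ r, x k * r ∈ initIdeal x k → r ∈ initIdeal x k)
    (f : ℕ → R) (hfz : ∀ k : Fin c, f k = ∑ j ∈ Finset.range e, z k j * x j)
    (hf : ∀ k < c, ∀ r, f k * r ∈ initIdeal f k → r ∈ initIdeal f k)
    (hker : RingHom.ker φ = initIdeal f c) {y' : ℕ → R'} {z' : Fin c → ℕ → R'}
    (hy : ∀ j < e, φ (x j) = y' j) (hz : ∀ k, ∀ j < e, φ (z k j) = z' k j)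
    (v : KIdx e → DivPow c R') (hv : D y' z' e v = 0) :
    ∃ u a, v = D y' z' e u + unit e c a := by
  obtain ⟨w, rfl⟩ := exists_mapR_comp_eq hφ v
  rw [D_mapR φ hy hz, mapR_comp_eq_zero, hker] at hv
  obtain ⟨u, a, h⟩ := exists_sub_mem x z e hx f hfz hf c le_rfl w
    (fun k hk => absurd k.isLt (not_lt.2 hk)) hv
  rw [← hker, ← mapR_comp_eq_zero, mapR_comp_sub, mapR_comp_sub, ← D_mapR φ hy hz,
    mapR_comp_unit] at h
  exact ⟨_, _, by rw [← sub_eq_zero, ← h]; abel⟩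

theorem proj_mem {I : Ideal R} {w : KIdx e → DivPow c R} (h : w ∈ coeffsInPi e c I) (n : ℤ) :
    proj e n w ∈ coeffsInPi e c I := fun s α => by
  rw [proj_apply]
  split_ifs
  · exact h s α
  · exact I.zero_mem

end

variable {c e : ℕ} {A : Type u} [CommRing A] [IsLocalRing A] [IsNoetherianRing A]

theorem exactAt_tate (y : ℕ → A) (z : Fin c → ℕ → A)
    (h : ∀ k, ∑ j ∈ Finset.range e, z k j * y j = 0)
    (hA : ∀ v : KIdx e → DivPow c (AdicCompletion (maximalIdeal A) A),
      D (fun j => algebraMap A _ (y j)) (fun k j => algebraMap A _ (z k j)) e v = 0 →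
      ∃ u a, v = D (fun j => algebraMap A _ (y j)) (fun k j => algebraMap A _ (z k j)) e u +
        unit e c a) {n : ℤ} (hn : 1 ≤ n) : (tate y z e h).ExactAt n := by
  set T := tate y z e h with hT
  intro w hw
  obtain ⟨hw1, hw2⟩ := T.mem_Z.1 hw
  have hdw : D y z e w = 0 := hw2
  have happ : ∀ t : ℕ, ∃ u a, w - D y z e u - unit e c a ∈ coeffsInPi e c (maximalIdeal A ^ t) := by
    intro t
    obtain ⟨u, a, hu⟩ := hA (mapR (algebraMap A _) ∘ w) (by
      rw [D_mapR (y := y) (z := z) _ (fun _ _ => rfl) (fun _ _ _ => rfl), hdw]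
      exact funext fun s => map_zero _)
    let ψ : AdicCompletion (maximalIdeal A) A →+* A ⧸ maximalIdeal A ^ t :=
      (AdicCompletion.evalₐ (maximalIdeal A) t).toRingHom
    have hψ : ∀ r, ψ (algebraMap A _ r) = Ideal.Quotient.mk (maximalIdeal A ^ t) r := fun r => by
      simp [ψ]
    obtain ⟨u', hu'⟩ := exists_mapR_comp_eq (φ := Ideal.Quotient.mk (maximalIdeal A ^ t))
      Ideal.Quotient.mk_surjective (mapR ψ ∘ u)
    obtain ⟨a', ha'⟩ := Ideal.Quotient.mk_surjective (ψ a)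
    refine ⟨u', a', ?_⟩
    rw [← Ideal.mk_ker (I := maximalIdeal A ^ t), ← mapR_comp_eq_zero, mapR_comp_sub,
      mapR_comp_sub, mapR_comp_unit, ha', ← D_mapR (Ideal.Quotient.mk (maximalIdeal A ^ t))
      (fun j _ => rfl) (fun k j _ => rfl), hu', sub_sub, sub_eq_zero]
    have h1 := congrArg (fun v => mapR ψ ∘ v) hu
    rw [mapR_comp_add, mapR_comp_unit, ← D_mapR ψ (fun j _ => hψ _) (fun k j _ => hψ _)] at h1
    rw [← h1]
    funext s
    exact Finsupp.ext fun α => (hψ _).symm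
  have hfg : (T.piece n).FG := by
    refine fg_of_degree_le n.toNat fun w hw s α hne => ?_
    have hw' : proj e n w = w := T.mem_piece.1 hw
    rw [← hw', proj_apply] at hne
    by_cases h1 : (s.deg : ℤ) + 2 * α.degree = n
    · omega
    · rw [if_neg h1] at hne
      exact absurd rfl hne
  let N := (T.piece n).map (T.B n).mkQ
  have hN : Module.Finite A N := Module.Finite.iff_fg.2 (hfg.map _)
  have hwN : (T.B n).mkQ w ∈ N := Submodule.mem_map_of_mem (T.mem_piece.2 hw1)
  have hmem : (⟨_, hwN⟩ : N) ∈ (⨅ t : ℕ, maximalIdeal A ^ t • ⊤ : Submodule A N) := by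
    refine (Submodule.mem_iInf _).2 fun t => Submodule.mem_smul_top_iff _ _ _ |>.2 ?_
    obtain ⟨u, a, hu⟩ := happ t
    have h1 := proj_mem hu n
    rw [map_sub, map_sub, proj_unit e (by omega), sub_zero, ← D_proj] at h1
    have h2 : proj e n w = w := hw1
    have h3 := Submodule.mem_map_of_mem (f := proj e n) (mem_smul_top h1)
    rw [Submodule.map_smul'', map_sub, h2, D_proj, h2, ← LinearMap.comp_apply] at h3
    have h4 : proj e n (proj e n (D y z e u)) = D y z e (proj e (n + 1) u) := by
      rw [D_proj]; exact T.π_same n _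
    rw [LinearMap.comp_apply, h4] at h3
    have h5 := Submodule.mem_map_of_mem (f := (T.B n).mkQ) h3
    rw [Submodule.map_smul'', map_sub] at h5
    have h6 : (T.B n).mkQ (D y z e (proj e (n + 1) u)) = 0 := by
      rw [Submodule.mkQ_apply, Submodule.Quotient.mk_eq_zero]
      refine T.mem_B_of_d (u := T.π (n + 1) u) rfl ?_
      rw [← h4]
      exact T.π_same n _
    rw [h6, sub_zero] at h5
    have h7 : (⊤ : Submodule A (KIdx e → DivPow c A)).map (proj e n) = T.piece n :=
      Submodule.map_top _
    rw [h7] at h5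
    exact h5
  rw [Ideal.iInf_pow_smul_eq_bot_of_isLocalRing _ (maximalIdeal.isMaximal A).ne_top,
    Submodule.mem_bot] at hmem
  have h0 : (T.B n).mkQ w = 0 := congrArg Subtype.val hmem
  rwa [Submodule.mkQ_apply, Submodule.Quotient.mk_eq_zero] at h0

end DivPow

/-! ## Complete intersections -/

theorem mem_initIdeal_iff {Q : Type*} [CommRing Q] (x : ℕ → Q) (e : ℕ) (r : Q) :
    r ∈ initIdeal x e ↔ ∃ a : Fin e → Q, ∑ j, a j * x j = r := by
  have : x '' Set.Iio e = Set.range fun j : Fin e => x j := by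
    ext t
    constructor
    · rintro ⟨j, hj, rfl⟩
      exact ⟨⟨j, hj⟩, rfl⟩
    · rintro ⟨j, rfl⟩
      exact ⟨j, j.isLt, rfl⟩
  rw [initIdeal, this, Ideal.mem_span_range_iff_exists_fun]

theorem initIdeal_le_iff {Q : Type*} [CommRing Q] {x : ℕ → Q} {e : ℕ} {I : Ideal Q} :
    initIdeal x e ≤ I ↔ ∀ j < e, x j ∈ I := by
  rw [initIdeal, Ideal.span_le, Set.image_subset_iff]
  rfl

theorem initIdeal_getD {Q : Type*} [CommRing Q] (rs : List Q) {k : ℕ} (hk : k ≤ rs.length) :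
    initIdeal (fun i => rs.getD i 0) k = Ideal.ofList (rs.take k) := by
  rw [initIdeal, Ideal.ofList]
  congr 1
  ext t
  simp only [Set.mem_image, Set.mem_Iio, Set.mem_ofPred_eq, List.mem_take_iff_getElem]
  constructor
  · rintro ⟨j, hj, rfl⟩
    exact ⟨j, lt_min hj (hj.trans_le hk), (List.getD_eq_getElem _ _ (hj.trans_le hk)).symm⟩
  · rintro ⟨j, hj, rfl⟩
    exact ⟨j, hj.trans_le (min_le_left _ _),
      List.getD_eq_getElem _ _ (hj.trans_le (min_le_right _ _))⟩

theorem mul_mem_initIdeal_getD_imp {Q : Type*} [CommRing Q] {rs : List Q}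
    (h : RingTheory.Sequence.IsWeaklyRegular Q rs) {k : ℕ} (hk : k < rs.length) {r : Q}
    (hr : rs.getD k 0 * r ∈ initIdeal (fun i => rs.getD i 0) k) :
    r ∈ initIdeal (fun i => rs.getD i 0) k := by
  rw [initIdeal_getD rs hk.le] at hr ⊢
  rw [List.getD_eq_getElem _ _ hk] at hr
  have h1 := (isSMulRegular_quotient_iff_mem_of_smul_mem _ _).1 (h.regular_mod_prev k hk) r
  simpa using h1 (by simpa using hr)

theorem IsLocalRing.initIdeal_eq_maximalIdeal {Q : Type*} [CommRing Q] [IsNoetherianRing Q]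
    [IsLocalRing Q] {x : ℕ → Q} {e : ℕ} (hx : ∀ j < e, x j ∈ maximalIdeal Q)
    (h : ∀ a ∈ maximalIdeal Q, ∃ b ∈ initIdeal x e, a - b ∈ maximalIdeal Q ^ 2) :
    initIdeal x e = maximalIdeal Q := by
  refine le_antisymm (initIdeal_le_iff.2 hx) ?_
  refine Submodule.le_of_le_smul_of_le_jacobson_bot (I := maximalIdeal Q)
    (IsNoetherian.noetherian _) (IsLocalRing.maximalIdeal_le_jacobson _) fun a ha => ?_
  obtain ⟨b, hb, hab⟩ := h a ha
  rw [smul_eq_mul, ← pow_two]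
  exact Submodule.mem_sup.2 ⟨b, hb, a - b, hab, by ring⟩

/-- A lift of a relation `∑ a j * x j = 0` along a surjection onto a flat algebra can be corrected
by Koszul relations so that its coefficients descend. -/
theorem exists_descend_relation {A B Q ι : Type*} [CommRing A] [CommRing B] [CommRing Q]
    [Algebra A B] [Module.Flat A B] [Fintype ι] {f : Q →+* B} (hf : Function.Surjective f)
    {x : ι → Q} {y : ι → A} (hxy : ∀ j, f (x j) = algebraMap A B (y j))
    (hd : ∀ v : B, ∃ r : A, ∃ q : ι → Q, v = algebraMap A B r + f (∑ l, q l * x l))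
    (a : ι → Q) (h : f (∑ j, a j * x j) = 0) :
    ∃ (a' : ι → Q) (z : ι → A), ∑ j, a' j * x j = ∑ j, a j * x j ∧
      (∀ j, f (a' j) = algebraMap A B (z j)) ∧ ∑ j, z j * y j = 0 := by
  have h0 : ∑ j, y j • f (a j) = 0 := by
    rw [← h, map_sum]
    exact Finset.sum_congr rfl fun j _ => by rw [map_mul, hxy, Algebra.smul_def, mul_comm]
  obtain ⟨n, g, v, hv, hg⟩ := Module.Flat.isTrivialRelation_of_sum_smul_eq_zero
    (R := A) (M := B) (f := y) (x := fun j => f (a j)) h0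
  choose r q hrq using fun i => hd (v i)
  choose G hG using fun j i => hf (algebraMap A B (g j i))
  let W : ι → ι → Q := fun l j => ∑ i, G j i * q i l
  have h1 : ∑ l, (∑ k, W k l * x k - ∑ j, W l j * x j) * x l = 0 := by
    simp only [sub_mul, Finset.sum_sub_distrib, Finset.sum_mul]
    rw [sub_eq_zero, Finset.sum_comm]
    exact Finset.sum_congr rfl fun _ _ => Finset.sum_congr rfl fun _ _ => by ring
  have h2 : ∀ l, f (∑ k, W k l * x k) = f (a l) - algebraMap A B (∑ i, g l i * r i) := by
    intro l
    have e1 : ∑ k, W k l * x k = ∑ i, G l i * ∑ k, q i k * x k := by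
      simp only [W, Finset.sum_mul, Finset.mul_sum]
      rw [Finset.sum_comm]
      exact Finset.sum_congr rfl fun _ _ => Finset.sum_congr rfl fun _ _ => by ring
    rw [e1, show f (a l) = _ from hv l, map_sum, map_sum, ← Finset.sum_sub_distrib]
    refine Finset.sum_congr rfl fun i _ => ?_
    rw [map_mul, hG, Algebra.smul_def, map_mul, hrq i]
    ring
  have h3 : ∀ l, f (∑ j, W l j * x j) = 0 := by
    intro l
    have e1 : f (∑ j, W l j * x j) = ∑ i, f (q i l) * algebraMap A B (∑ j, y j * g j i) := by
      simp only [W, Finset.sum_mul, Finset.mul_sum, map_sum]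
      rw [Finset.sum_comm]
      refine Finset.sum_congr rfl fun _ _ => Finset.sum_congr rfl fun _ _ => ?_
      simp only [map_mul, hG, hxy]
      ring
    rw [e1]
    exact Finset.sum_eq_zero fun i _ => by rw [hg, map_zero, mul_zero]
  refine ⟨fun l => a l - (∑ k, W k l * x k - ∑ j, W l j * x j), fun l => ∑ i, g l i * r i, ?_,
    fun l => ?_, ?_⟩
  · simp only [sub_mul _ _ (x _)] at h1 ⊢
    rw [Finset.sum_sub_distrib, h1, sub_zero]
  · rw [map_sub, map_sub, h2, h3]
    ring
  · have e1 : ∑ l, (∑ i, g l i * r i) * y l = ∑ i, r i * ∑ l, y l * g l i := by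
      simp only [Finset.sum_mul, Finset.mul_sum]
      rw [Finset.sum_comm]
      exact Finset.sum_congr rfl fun _ _ => Finset.sum_congr rfl fun _ _ => by ring
    rw [e1]
    exact Finset.sum_eq_zero fun i _ => by rw [hg, mul_zero]

section

variable {A : Type u} [CommRing A] [IsLocalRing A] [IsNoetherianRing A]

theorem AdicCompletion.mem_maximalIdeal_pow_iff (n : ℕ)
    (v : AdicCompletion (maximalIdeal A) A) :
    v ∈ maximalIdeal (AdicCompletion (maximalIdeal A) A) ^ n ↔
      AdicCompletion.evalₐ (maximalIdeal A) n v = 0 := by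
  rw [AdicCompletion.maximalIdeal_eq_map, ← Ideal.map_pow, ← Submodule.restrictScalars_mem A,
    ← Ideal.smul_top_eq_map,
    AdicCompletion.pow_smul_top_eq_ker_eval (maximalIdeal A).fg_of_isNoetherianRing,
    LinearMap.mem_ker]
  have hI : maximalIdeal A ^ n • (⊤ : Ideal A) = maximalIdeal A ^ n := Ideal.mul_top _
  constructor
  · intro h
    rw [← AdicCompletion.factor_eval_eq_evalₐ _ _ hI.le, h, _root_.map_zero]
  · intro h
    rw [← AdicCompletion.factor_evalₐ_eq_eval _ _ hI.ge, h, _root_.map_zero]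

theorem AdicCompletion.exists_sub_algebraMap_mem (n : ℕ)
    (v : AdicCompletion (maximalIdeal A) A) :
    ∃ r : A, v - algebraMap A _ r ∈ maximalIdeal (AdicCompletion (maximalIdeal A) A) ^ n := by
  obtain ⟨r, hr⟩ := Ideal.Quotient.mk_surjective (AdicCompletion.evalₐ (maximalIdeal A) n v)
  refine ⟨r, (AdicCompletion.mem_maximalIdeal_pow_iff n _).2 ?_⟩
  rw [map_sub, sub_eq_zero, ← hr]
  simp

theorem AdicCompletion.algebraMap_mem_maximalIdeal_pow_iff (n : ℕ) (a : A) :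
    algebraMap A (AdicCompletion (maximalIdeal A) A) a ∈
      maximalIdeal (AdicCompletion (maximalIdeal A) A) ^ n ↔ a ∈ maximalIdeal A ^ n := by
  rw [AdicCompletion.mem_maximalIdeal_pow_iff, ← Ideal.Quotient.eq_zero_iff_mem]
  simp

/-- Generators of the maximal ideal of a regular local ring mapping onto the completion of `A` can
be chosen to lie over generators of the maximal ideal of `A`. -/
theorem exists_initIdeal_eq_maximalIdeal {Q : Type*} [CommRing Q] [IsLocalRing Q]
    [IsNoetherianRing Q] {f : Q →+* AdicCompletion (maximalIdeal A) A}
    (hf : Function.Surjective f) {x₀ : ℕ → Q} {e : ℕ} (hx₀ : initIdeal x₀ e = maximalIdeal Q) :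
    ∃ (x : ℕ → Q) (y : ℕ → A), initIdeal x e = maximalIdeal Q ∧
      initIdeal y e = maximalIdeal A ∧ ∀ j, f (x j) = algebraMap A _ (y j) := by
  have hm := IsLocalRing.map_maximalIdeal_of_surjective f hf
  have hlift : ∀ n : ℕ, ∀ v ∈ maximalIdeal (AdicCompletion (maximalIdeal A) A) ^ n,
      ∃ q ∈ maximalIdeal Q ^ n, f q = v := fun n v hv => by
    rwa [← hm, ← Ideal.map_pow, Ideal.mem_map_iff_of_surjective f hf] at hv
  have hmem : ∀ q ∈ maximalIdeal Q, f q ∈ maximalIdeal (AdicCompletion (maximalIdeal A) A) :=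
    fun q hq => hm ▸ Ideal.mem_map_of_mem f hq
  choose y hy using fun j => AdicCompletion.exists_sub_algebraMap_mem 2 (f (x₀ j))
  choose δ hδ hδf using fun j => hlift 2 _ (hy j)
  have hsq : maximalIdeal Q ^ 2 ≤ maximalIdeal Q := Ideal.pow_le_self two_ne_zero
  have hfx : ∀ j, f (x₀ j - δ j) = algebraMap A _ (y j) := fun j => by
    rw [map_sub, hδf]
    ring
  have hxm : ∀ j < e, x₀ j - δ j ∈ maximalIdeal Q := fun j hj =>
    sub_mem (hx₀ ▸ mem_initIdeal x₀ hj) (hsq (hδ j))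
  have hx : initIdeal (fun j => x₀ j - δ j) e = maximalIdeal Q := by
    refine IsLocalRing.initIdeal_eq_maximalIdeal hxm fun a ha => ?_
    rw [← hx₀] at ha
    obtain ⟨q, rfl⟩ := (mem_initIdeal_iff _ _ _).1 ha
    refine ⟨_, (mem_initIdeal_iff _ _ _).2 ⟨q, rfl⟩, ?_⟩
    rw [← Finset.sum_sub_distrib]
    refine sum_mem fun j _ => ?_
    rw [← mul_sub, sub_sub_cancel]
    exact Ideal.mul_mem_left _ _ (hδ j)
  have hym : ∀ j < e, y j ∈ maximalIdeal A := fun j hj => by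
    have := (AdicCompletion.algebraMap_mem_maximalIdeal_pow_iff 1 (y j)).1
      (by rw [pow_one, ← hfx]; exact hmem _ (hxm j hj))
    rwa [pow_one] at this
  refine ⟨_, y, hx, IsLocalRing.initIdeal_eq_maximalIdeal hym fun a ha => ?_, hfx⟩
  obtain ⟨t, ht, hta⟩ := hlift 1 (algebraMap A _ a)
    ((AdicCompletion.algebraMap_mem_maximalIdeal_pow_iff 1 a).2 (by rwa [pow_one]))
  rw [pow_one, ← hx] at ht
  obtain ⟨q, rfl⟩ := (mem_initIdeal_iff _ _ _).1 ht
  choose b hb using fun j => AdicCompletion.exists_sub_algebraMap_mem 1 (f (q j))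
  refine ⟨_, (mem_initIdeal_iff _ _ _).2 ⟨b, rfl⟩, ?_⟩
  rw [← AdicCompletion.algebraMap_mem_maximalIdeal_pow_iff, map_sub, ← hta, map_sum, map_sum,
    ← Finset.sum_sub_distrib]
  refine sum_mem fun j _ => ?_
  rw [map_mul, map_mul, hfx, ← sub_mul, pow_two]
  refine Ideal.mul_mem_mul ?_ ?_
  · simpa using hb j
  · rw [← hfx]
    exact hmem _ (hxm j j.isLt)

/-- The residue field of a complete intersection has a Tate resolution. -/
theorem IsCompleteIntersectionLocalRing.exists_isTate (hA : IsCompleteIntersectionLocalRing A) :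
    ∃ (c e : ℕ) (y : ℕ → A) (z : Fin c → ℕ → A) (h : ∀ k, ∑ j ∈ Finset.range e, z k j * y j = 0),
      (DivPow.tate y z e h).IsTate (Fin c) := by
  obtain ⟨Q, _, ⟨_, _, s, hs, hdim⟩, f, hf, rs, hrs, hker⟩ := hA
  obtain ⟨x₀, hx₀⟩ : ∃ x₀ : ℕ → Q, initIdeal x₀ s.card = maximalIdeal Q := by
    refine ⟨fun j => if hj : j < s.card then s.equivFin.symm ⟨j, hj⟩ else 0, ?_⟩
    rw [← IsLocalRing.eq_maximalIdeal hs, initIdeal]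
    congr 1
    ext t
    constructor
    · rintro ⟨j, hj, rfl⟩
      simp only [dif_pos (Set.mem_Iio.1 hj)]
      exact (s.equivFin.symm ⟨j, hj⟩).2
    · intro ht
      refine ⟨s.equivFin ⟨t, ht⟩, (s.equivFin ⟨t, ht⟩).isLt, ?_⟩
      simp
  obtain ⟨x, y, hx, hy, hxy⟩ := exists_initIdeal_eq_maximalIdeal hf hx₀
  have hkF : RingHom.ker f = initIdeal (fun i => rs.getD i 0) rs.length := by
    rw [initIdeal_getD rs le_rfl, List.take_length, hker, Ideal.ofList]
  have hd : ∀ v : AdicCompletion (maximalIdeal A) A, ∃ r : A, ∃ q : Fin s.card → Q,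
      v = algebraMap A _ r + f (∑ l, q l * x l) := fun v => by
    obtain ⟨r, hr⟩ := AdicCompletion.exists_sub_algebraMap_mem 1 v
    rw [pow_one, ← IsLocalRing.map_maximalIdeal_of_surjective f hf,
      Ideal.mem_map_iff_of_surjective f hf] at hr
    obtain ⟨t, ht, htv⟩ := hr
    rw [← hx] at ht
    obtain ⟨q, rfl⟩ := (mem_initIdeal_iff _ _ _).1 ht
    exact ⟨r, q, by rw [htv]; ring⟩
  have : Module.Flat A (AdicCompletion (maximalIdeal A) A) :=
    AdicCompletion.flat_of_isNoetherian _
  have hrel : ∀ k : Fin rs.length, ∃ (a : Fin s.card → Q) (z : Fin s.card → A),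
      rs.getD k 0 = ∑ j, a j * x j ∧ (∀ j, f (a j) = algebraMap A _ (z j)) ∧
        ∑ j, z j * y j = 0 := fun k => by
    have hk : rs.getD k 0 ∈ RingHom.ker f := hkF ▸ mem_initIdeal (fun i => rs.getD i 0) k.isLt
    have hm : rs.getD k 0 ∈ initIdeal x s.card :=
      hx ▸ le_maximalIdeal (RingHom.ker_ne_top f) hk
    obtain ⟨a, ha⟩ := (mem_initIdeal_iff _ _ _).1 hm
    obtain ⟨a', z, h1, h2, h3⟩ := exists_descend_relation hf (x := fun j : Fin s.card => x j)
      (y := fun j => y j) (fun j => hxy j) hd a (ha ▸ hk)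
    exact ⟨a', z, by rw [h1, ha], h2, h3⟩
  choose a z ha haz hz using hrel
  have hext : ∀ {R : Type u} [CommRing R] (b : Fin s.card → R) (w : ℕ → R),
      ∑ j ∈ Finset.range s.card, (if hj : j < s.card then b ⟨j, hj⟩ else 0) * w j =
        ∑ j, b j * w j := fun b w => by
    rw [Finset.sum_range]
    exact Finset.sum_congr rfl fun j _ => by rw [dif_pos j.isLt]
  have h0 : ∀ k, ∑ j ∈ Finset.range s.card,
      (if hj : j < s.card then z k ⟨j, hj⟩ else 0) * y j = 0 := fun k => by rw [hext, hz]
  refine ⟨rs.length, s.card, y, fun k j => if hj : j < s.card then z k ⟨j, hj⟩ else 0, h0,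
    DivPow.tate_isTate y _ _ h0 hy fun n hn => DivPow.exactAt_tate y _ h0 (fun v hv => ?_) hn⟩
  exact DivPow.exists_eq_add_unit hf x
    (fun k j => if hj : j < s.card then a k ⟨j, hj⟩ else 0)
    (fun k hk r hr => mul_mem_initIdeal_imp x s.card hx hdim.le hk hr)
    (fun i => rs.getD i 0) (fun k => by rw [hext, ha])
    (fun k hk r hr => mul_mem_initIdeal_getD_imp hrs.toIsWeaklyRegular hk hr) hkF
    (fun j _ => hxy j) (fun k j hj => by simp only [dif_pos hj, haz]) v hv

end

/-- Proposition `Tt` of the paper. Over a complete intersection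
noetherian local ring `A`, a finitely generated module `M` is a test module if and only
if it is a Test module. -/
theorem isTestModule_iff_isCapitalTestModule_of_complete_intersection
    (A : Type u) [CommRing A] [IsLocalRing A] [IsNoetherianRing A]
    (hA : IsCompleteIntersectionLocalRing A)
    (M : Type u) [AddCommGroup M] [Module A M] [Module.Finite A M] :
    IsTestModule A M ↔ IsCapitalTestModule A M := by
  refine ⟨IsTestModule.isCapitalTestModule, fun hM => hM.isTestModule fun F hF => ?_⟩
  obtain ⟨c, e, y, z, h, hT⟩ := hA.exists_isTate
  exact hT.growthDichotomy hM F hF
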